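/- arXiv:2507.23467 — 4 statements merged into one kernel-verified Lean document; each statement's English description precedes it below -/
import Mathlib

section
/- Fix r > 0 and 0 < α < 1. The function f(z) = z^(r-1) Σ_{l=0}^∞ (-z)^l / (l! Γ(r(1-α) - αl)) on (0,∞) satisfies the Mellin transform identity ∫₀^∞ x^(z-1) f(x) dx = Γ(r-1+z) / Γ(r-α+αz) for all complex z with Re(z) > 1 - r. -/
open MeasureTheory Set

/-- The Wright function `W_{λ,μ}`. -/
noncomputable def wright (lam mu z : ℝ) : ℝ :=
  ∑' l : ℕ, z ^ l / (l.factorial * Real.Gamma (lam * l + mu))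

open MeasureTheory Set Filter Topology

namespace FoxH

lemma slit (ζ : ℂ) (h : ζ.im ≠ 0) (y : ℝ) : (1 + y * ζ : ℂ) ∈ Complex.slitPlane := by
  by_cases hy : y = 0
  · subst hy; simp
  · right; simp [hy, h]

lemma lower (ζ : ℂ) (R η : ℝ) (hR : 0 < R) (hη : 0 < η) (h1 : ‖ζ‖ ≤ R) (h2 : η ≤ |ζ.im|)
    (y : ℝ) (hy : 0 ≤ y) : min (1 / 2) (η / (2 * R)) ≤ ‖(1 + y * ζ : ℂ)‖ := by
  by_cases h : y ≤ 1 / (2 * R)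
  · apply (min_le_left _ _).trans
    have h3 : ‖(y * ζ : ℂ)‖ ≤ 1 / 2 := by
      rw [norm_mul, Complex.norm_real, Real.norm_of_nonneg hy]
      calc y * ‖ζ‖ ≤ 1 / (2 * R) * R := by gcongr
        _ = 1 / 2 := by field_simp
    have := norm_sub_le (1 + y * ζ : ℂ) (y * ζ)
    simp only [add_sub_cancel_right, norm_one] at this
    linarith
  · push Not at h
    apply (min_le_right _ _).trans
    apply le_trans _ (Complex.abs_im_le_norm _)
    have : (1 + y * ζ : ℂ).im = y * ζ.im := by simp
    rw [this, abs_mul, abs_of_nonneg hy]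
    calc η / (2 * R) = 1 / (2 * R) * η := by ring
      _ ≤ _ := by gcongr

lemma growth (m p c α ε : ℝ) (hm : 0 < m) (hα1 : α < 1) (hε : 0 < ε) :
    ∃ C, 0 ≤ C ∧ ∀ u, m ≤ u → u ^ p * Real.exp (c * u ^ α) ≤ C * Real.exp (ε * u) := by
  have ho : (fun u : ℝ => p * Real.log u + c * u ^ α) =o[atTop] fun u => u := by
    refine Asymptotics.IsLittleO.add ?_ ?_
    · exact Real.isLittleO_log_id_atTop.const_mul_left p
    · have : (fun u : ℝ => u ^ α) =o[atTop] fun u => u := by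
        rw [Asymptotics.isLittleO_iff_tendsto' (by
          filter_upwards [eventually_gt_atTop 0] with u hu h using absurd h hu.ne')]
        refine (tendsto_rpow_neg_atTop (y := 1 - α) (by linarith)).congr' ?_
        filter_upwards [eventually_gt_atTop 0] with u hu
        rw [neg_sub, Real.rpow_sub_one hu.ne']
      exact this.const_mul_left c
  obtain ⟨U, hU⟩ := eventually_atTop.1 ((ho.bound hε).and (eventually_gt_atTop 0))
  have hc : ContinuousOn (fun u : ℝ => u ^ p * Real.exp (c * u ^ α)) (Icc m U) := by
    have h0 : ∀ u ∈ Icc m U, u ≠ 0 := fun u hu => (hm.trans_le hu.1).ne'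
    have a1 : ContinuousOn (fun u : ℝ => u ^ p) (Icc m U) :=
      continuousOn_id.rpow_const (fun u hu => Or.inl (h0 u hu))
    have a2 : ContinuousOn (fun u : ℝ => u ^ α) (Icc m U) :=
      continuousOn_id.rpow_const (fun u hu => Or.inl (h0 u hu))
    exact a1.mul (Real.continuous_exp.comp_continuousOn (continuousOn_const.mul a2))
  obtain ⟨C, hC⟩ := isCompact_Icc.exists_bound_of_continuousOn hc
  refine ⟨max C 1, by positivity, fun u hu => ?_⟩
  have hu0 : 0 < u := hm.trans_le hu
  by_cases h : u ≤ U
  · have h1 := (le_abs_self _).trans (hC u ⟨hu, h⟩)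
    have h2 : 1 ≤ Real.exp (ε * u) := Real.one_le_exp (by positivity)
    calc _ ≤ C := h1
      _ ≤ max C 1 * 1 := by simp
      _ ≤ _ := by gcongr
  · push Not at h
    have h1 := (hU u h.le).1
    rw [Real.norm_of_nonneg hu0.le] at h1
    have h2 := (le_abs_self _).trans h1
    rw [Real.rpow_def_of_pos hu0, ← Real.exp_add]
    calc _ ≤ Real.exp (ε * u) := by
            apply Real.exp_le_exp.2; linarith
      _ = 1 * Real.exp (ε * u) := by ring
      _ ≤ _ := by gcongr; exact le_max_right _ _

lemma norm_cpow_bd (t w : ℂ) (ht : t ≠ 0) :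
    ‖t ^ (-w)‖ ≤ Real.exp (Real.pi * |w.im|) * ‖t‖ ^ (-w.re) := by
  rw [Complex.norm_cpow_of_ne_zero ht, div_eq_mul_inv, ← Real.exp_neg, mul_comm, Complex.neg_re]
  refine mul_le_mul_of_nonneg_right (Real.exp_le_exp.2 ?_) (by positivity)
  · have : -(t.arg * (-w).im) = t.arg * w.im := by simp
    rw [this]
    calc _ ≤ |t.arg * w.im| := le_abs_self _
      _ = |t.arg| * |w.im| := abs_mul _ _
      _ ≤ _ := by gcongr; exact Complex.abs_arg_le_pi t

/-- integrand bound with uniform constant -/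
lemma bound_unif (w : ℂ) (c α : ℝ) (hα1 : α < 1) (R η δ : ℝ) (hR : 0 < R)
    (hη : 0 < η) (hδ : 0 < δ) :
    ∃ C, 0 ≤ C ∧ ∀ ζ : ℂ, ‖ζ‖ ≤ R → η ≤ |ζ.im| → ζ.re ≤ -δ → ∀ y : ℝ, 0 ≤ y →
      ‖Complex.exp (1 + y * ζ) * (1 + y * ζ) ^ (-w)‖ * Real.exp (c * ‖(1 + y * ζ : ℂ)‖ ^ α)
        ≤ C * Real.exp (-(δ / 2) * y) := by
  have hm : 0 < min (1 / 2) (η / (2 * R)) := by positivity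
  obtain ⟨C, hC0, hC⟩ := growth _ (-w.re) c α (δ / (2 * R)) hm hα1 (by positivity)
  refine ⟨Real.exp 1 * Real.exp (Real.pi * |w.im|) * C * Real.exp (δ / (2 * R)), by positivity,
    fun ζ h1 h2 h3 y hy => ?_⟩
  have hl := lower ζ R η hR hη h1 h2 y hy
  have h0 : (1 + y * ζ : ℂ) ≠ 0 := by
    intro h; rw [h, norm_zero] at hl; linarith
  have hn : ‖(1 + y * ζ : ℂ)‖ ≤ 1 + y * R := by
    apply (norm_add_le _ _).trans
    rw [norm_mul, Complex.norm_real, Real.norm_of_nonneg hy, norm_one]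
    gcongr
  have he : ‖Complex.exp (1 + y * ζ)‖ ≤ Real.exp 1 * Real.exp (-δ * y) := by
    rw [Complex.norm_exp, ← Real.exp_add]
    apply Real.exp_le_exp.2
    simp
    nlinarith
  rw [norm_mul]
  calc _ ≤ (Real.exp 1 * Real.exp (-δ * y)) *
          (Real.exp (Real.pi * |w.im|) * ‖(1 + y * ζ : ℂ)‖ ^ (-w.re)) *
            Real.exp (c * ‖(1 + y * ζ : ℂ)‖ ^ α) := by
        gcongr; exact norm_cpow_bd _ _ h0
    _ = (Real.exp 1 * Real.exp (-δ * y)) * Real.exp (Real.pi * |w.im|) *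
        (‖(1 + y * ζ : ℂ)‖ ^ (-w.re) * Real.exp (c * ‖(1 + y * ζ : ℂ)‖ ^ α)) := by ring
    _ ≤ (Real.exp 1 * Real.exp (-δ * y)) * Real.exp (Real.pi * |w.im|) *
        (C * Real.exp (δ / (2 * R) * (1 + y * R))) := by
        refine mul_le_mul_of_nonneg_left ((hC _ hl).trans ?_) (by positivity)
        gcongr
    _ = _ := by
        have : Real.exp (-(δ / 2) * y) * Real.exp (δ / (2 * R))
            = Real.exp (-δ * y) * Real.exp (δ / (2 * R) * (1 + y * R)) := by
          rw [← Real.exp_add, ← Real.exp_add]; congr 1; field_simp; ring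
        linear_combination (-Real.exp 1 * Real.exp (Real.pi * |w.im|) * C) * this

lemma cont_t (ζ : ℂ) : Continuous (fun y : ℝ => (1 + y * ζ : ℂ)) := by fun_prop

lemma cont_pow (ζ : ℂ) (h : ζ.im ≠ 0) (w : ℂ) :
    Continuous (fun y : ℝ => (1 + y * ζ : ℂ) ^ w) := by
  rw [continuous_iff_continuousAt]
  intro y
  exact (cont_t ζ).continuousAt.cpow continuousAt_const (slit ζ h y)

lemma cont_f (ζ : ℂ) (h : ζ.im ≠ 0) (w : ℂ) :
    Continuous (fun y : ℝ => Complex.exp (1 + y * ζ) * (1 + y * ζ) ^ (-w)) :=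
  (Complex.continuous_exp.comp (cont_t ζ)).mul (cont_pow ζ h _)

lemma bound_one (ζ : ℂ) (h : ζ.im ≠ 0) (hr : ζ.re < 0) (w : ℂ) (c α : ℝ) (hα1 : α < 1) :
    ∃ C, 0 ≤ C ∧ ∃ b, 0 < b ∧ ∀ y : ℝ, 0 ≤ y →
      ‖Complex.exp (1 + y * ζ) * (1 + y * ζ) ^ (-w)‖ * Real.exp (c * ‖(1 + y * ζ : ℂ)‖ ^ α)
        ≤ C * Real.exp (-b * y) := by
  obtain ⟨C, h0, hC⟩ := bound_unif w c α hα1 ‖ζ‖ |ζ.im| (-ζ.re)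
    (norm_pos_iff.2 (by rintro rfl; simp at h)) (abs_pos.2 h) (by linarith)
  exact ⟨C, h0, -ζ.re / 2, by linarith, fun y hy => hC ζ le_rfl le_rfl (by simp) y hy⟩

lemma int_exp (b : ℝ) (hb : 0 < b) : IntegrableOn (fun y : ℝ => Real.exp (-b * y)) (Ioi 0) :=
  integrableOn_exp_mul_Ioi (by linarith) 0

lemma int_f (ζ : ℂ) (h : ζ.im ≠ 0) (hr : ζ.re < 0) (w : ℂ) :
    IntegrableOn (fun y : ℝ => Complex.exp (1 + y * ζ) * (1 + y * ζ) ^ (-w)) (Ioi 0) := by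
  obtain ⟨C, h0, b, hb, hC⟩ := bound_one ζ h hr w 0 0 (by norm_num)
  refine Integrable.mono' ((int_exp b hb).const_mul C) (cont_f ζ h w).aestronglyMeasurable ?_
  filter_upwards [ae_restrict_mem measurableSet_Ioi] with y hy
  simpa using hC y (le_of_lt hy)

noncomputable def J (ζ w : ℂ) : ℂ :=
  ζ * ∫ y in Ioi (0 : ℝ), Complex.exp (1 + y * ζ) * (1 + y * ζ) ^ (-w)

lemma hasDeriv_F (t w : ℂ) (ht : t ∈ Complex.slitPlane) :
    HasDerivAt (fun t : ℂ => Complex.exp t * t ^ (-w))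
      (Complex.exp t * t ^ (-w) - w * (Complex.exp t * t ^ (-(w + 1)))) t := by
  have h1 := (Complex.hasDerivAt_exp t).mul ((hasDerivAt_id t).cpow_const (c := -w) ht)
  have e : Complex.exp t * id t ^ (-w) + Complex.exp t * (-w * id t ^ (-w - 1) * 1) =
      Complex.exp t * t ^ (-w) - w * (Complex.exp t * t ^ (-(w + 1))) := by
    rw [show -w - 1 = -(w + 1) by ring]
    simp only [id]
    ring
  rw [← e]
  exact h1

lemma J_rec (ζ : ℂ) (h : ζ.im ≠ 0) (hr : ζ.re < 0) (w : ℂ) :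
    J ζ w - w * J ζ (w + 1) = - Complex.exp 1 := by
  have hd : ∀ y : ℝ, HasDerivAt (fun y : ℝ => Complex.exp (1 + y * ζ) * (1 + y * ζ) ^ (-w))
      ((Complex.exp (1 + y * ζ) * (1 + y * ζ) ^ (-w) -
        w * (Complex.exp (1 + y * ζ) * (1 + y * ζ) ^ (-(w + 1)))) * ζ) y := by
    intro y
    have h1 := hasDeriv_F _ w (slit ζ h y)
    have h2 : HasDerivAt (fun y : ℝ => (1 + y * ζ : ℂ)) ζ y := by
      have := ((Complex.ofRealCLM.hasDerivAt (x := y)).mul_const ζ).const_add 1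
      simpa using this
    exact h1.comp y h2
  have i1 := int_f ζ h hr w
  have i2 := int_f ζ h hr (w + 1)
  have ht : Tendsto (fun y : ℝ => Complex.exp (1 + y * ζ) * (1 + y * ζ) ^ (-w)) atTop (𝓝 0) := by
    obtain ⟨C, h0, b, hb, hC⟩ := bound_one ζ h hr w 0 0 (by norm_num)
    have hz : Tendsto (fun y : ℝ => C * Real.exp (-b * y)) atTop (𝓝 0) := by
      rw [show (0 : ℝ) = C * 0 by simp]
      refine (Real.tendsto_exp_atBot.comp ?_).const_mul C
      exact tendsto_id.const_mul_atTop_of_neg (by linarith)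
    refine squeeze_zero_norm' ?_ hz
    filter_upwards [eventually_ge_atTop 0] with y hy
    simpa using hC y hy
  have key := integral_Ioi_of_hasDerivAt_of_tendsto (a := 0) (hd 0).continuousAt.continuousWithinAt
    (fun y _ => hd y) ((i1.sub (i2.const_mul w)).mul_const ζ) ht
  rw [integral_mul_const, integral_sub i1 (i2.const_mul w), integral_const_mul] at key
  simp only [Complex.ofReal_zero, zero_mul, add_zero, Complex.one_cpow, mul_one, zero_sub] at key
  rw [← key, J, J]; ring

lemma cone_const {U : Set ℂ} (hU : IsOpen U) (hc : IsPreconnected U) {f : ℂ → ℂ}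
    (hd : DifferentiableOn ℂ f U) (h0 : ∀ z ∈ U, z ≠ 0)
    (hs : ∀ z ∈ U, ∀ l : ℝ, 0 < l → f (l * z) = f z) {x y : ℂ} (hx : x ∈ U) (hy : y ∈ U) :
    f x = f y := by
  refine hU.is_const_of_deriv_eq_zero hc hd ?_ hx hy
  intro z hz
  have h1 : HasDerivAt f (deriv f z) (((1 : ℝ) : ℂ) * z) := by
    simpa using (hd.differentiableAt (hU.mem_nhds hz)).hasDerivAt
  have h2 : HasDerivAt (fun l : ℝ => (l * z : ℂ)) z 1 := by
    have := ((Complex.ofRealCLM.hasDerivAt (x := 1)).mul_const z)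
    simpa using this
  have h3 := h1.comp (1 : ℝ) h2
  have h4 : HasDerivAt (f ∘ fun l : ℝ => (l * z : ℂ)) 0 1 := by
    refine (hasDerivAt_const (1 : ℝ) (f z)).congr_of_eventuallyEq ?_
    filter_upwards [lt_mem_nhds (zero_lt_one)] with l hl
    exact hs z hz l hl
  have := h3.unique h4
  simpa [h0 z hz] using this

lemma norm_cpow_real (x : ℝ) (hx : 0 < x) (s : ℂ) : ‖(x : ℂ) ^ (s - 1)‖ = x ^ (s.re - 1) := by
  rw [Complex.norm_cpow_eq_rpow_re_of_pos hx]; simp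

lemma int_gamma (σ b : ℝ) (hσ : 0 < σ) (hb : 0 < b) :
    IntegrableOn (fun x : ℝ => x ^ (σ - 1) * Real.exp (-b * x)) (Ioi 0) := by
  have := integrableOn_rpow_mul_exp_neg_mul_rpow (p := 1) (s := σ - 1) (b := b) (by linarith)
    (by norm_num) hb
  simpa using this

lemma meas_cpow (s : ℂ) : Measurable (fun x : ℝ => (x : ℂ) ^ s) := by
  fun_prop

lemma int_gammaC (s a : ℂ) (hs : 0 < s.re) (ha : 0 < a.re) :
    IntegrableOn (fun x : ℝ => (x : ℂ) ^ (s - 1) * Complex.exp (-(a * x))) (Ioi 0) := by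
  refine Integrable.mono' (int_gamma s.re a.re hs ha) ?_ ?_
  · exact ((meas_cpow _).mul (by fun_prop)).aestronglyMeasurable
  · filter_upwards [ae_restrict_mem measurableSet_Ioi] with x hx
    rw [norm_mul, norm_cpow_real x hx, Complex.norm_exp]
    simp

lemma gamma_complex (s a : ℂ) (hs : 0 < s.re) (ha : 0 < a.re) :
    ∫ x in Ioi (0 : ℝ), (x : ℂ) ^ (s - 1) * Complex.exp (-(a * x)) = a ^ (-s) * Complex.Gamma s := by
  set M : ℂ → ℂ := fun a => ∫ x in Ioi (0 : ℝ), (x : ℂ) ^ (s - 1) * Complex.exp (-(a * x)) with hM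
  have hdM : ∀ a : ℂ, 0 < a.re → DifferentiableAt ℂ M a := by
    intro a ha
    have hS : {z : ℂ | a.re / 2 < z.re} ∈ 𝓝 a :=
      (isOpen_lt continuous_const Complex.continuous_re).mem_nhds (by simp; linarith)
    have := hasDerivAt_integral_of_dominated_loc_of_deriv_le (𝕜 := ℂ)
      (μ := volume.restrict (Ioi (0 : ℝ)))
      (F := fun a (x : ℝ) => (x : ℂ) ^ (s - 1) * Complex.exp (-(a * x)))
      (F' := fun a (x : ℝ) => (x : ℂ) ^ (s - 1) * (Complex.exp (-(a * x)) * (-x)))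
      (bound := fun x => x ^ ((s.re + 1) - 1) * Real.exp (-(a.re / 2) * x)) hS
      (Eventually.of_forall fun a => ((meas_cpow _).mul (by fun_prop)).aestronglyMeasurable)
      (int_gammaC s a hs ha)
      ((meas_cpow _).mul (by fun_prop)).aestronglyMeasurable
      (by
        filter_upwards [ae_restrict_mem measurableSet_Ioi] with x hx z hz
        have hx' : 0 < x := hx
        rw [norm_mul, norm_cpow_real x hx, norm_mul, Complex.norm_exp, norm_neg, Complex.norm_real,
          Real.norm_of_nonneg hx'.le, add_sub_cancel_right]
        have : x ^ s.re = x ^ (s.re - 1) * x := by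
          rw [Real.rpow_sub_one hx'.ne']; field_simp
        rw [this]
        have h2 : Real.exp (-(z * x)).re ≤ Real.exp (-(a.re / 2) * x) := by
          apply Real.exp_le_exp.2
          have hz : a.re / 2 < z.re := hz
          simp
          have hx'' := hx'
          nlinarith
        calc _ ≤ x ^ (s.re - 1) * (Real.exp (-(a.re / 2) * x) * x) := by gcongr
          _ = _ := by ring)
      (int_gamma _ _ (by linarith) (by linarith))
      (by
        filter_upwards with x z hz
        have : HasDerivAt (fun z : ℂ => -(z * x)) (-x : ℂ) z := by
          have := ((hasDerivAt_id z).mul_const (x : ℂ)).neg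
          rw [one_mul] at this
          exact this
        exact this.cexp.const_mul _)
    exact this.2.differentiableAt
  have hU : IsOpen {z : ℂ | 0 < z.re} := isOpen_lt continuous_const Complex.continuous_re
  have hsl : ∀ z : ℂ, 0 < z.re → z ∈ Complex.slitPlane := fun z hz => Or.inl hz
  have key := cone_const (f := fun a => a ^ s * M a) hU
    (convex_halfSpace_re_gt 0).isPreconnected
    (fun z hz => ((differentiableAt_id.cpow_const (hsl z hz)).mul
      (hdM z hz)).differentiableWithinAt)
    (fun z hz => Complex.slitPlane_ne_zero (hsl z hz))
    (by
      intro z hz l hl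
      have e : M (l * z) = (l : ℂ) ^ (-s) * M z := by
        have := integral_comp_mul_left_Ioi
          (fun x : ℝ => (x : ℂ) ^ (s - 1) * Complex.exp (-(z * x))) 0 hl
        simp only [mul_zero] at this
        have h2 : M z = (l : ℂ) * ∫ x in Ioi (0 : ℝ), ((l * x : ℝ) : ℂ) ^ (s - 1) *
            Complex.exp (-(z * (l * x : ℝ))) := by
          rw [this, Complex.real_smul]
          have : (l : ℂ) ≠ 0 := by exact_mod_cast hl.ne'
          push_cast
          rw [mul_inv_cancel_left₀ this]
        rw [h2, hM]
        rw [← integral_const_mul, ← integral_const_mul]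
        refine setIntegral_congr_fun measurableSet_Ioi fun x hx => ?_
        have hl' : (l : ℂ) ≠ 0 := by exact_mod_cast hl.ne'
        push_cast
        rw [Complex.mul_cpow_ofReal_nonneg hl.le (le_of_lt hx), Complex.cpow_sub _ _ hl',
          Complex.cpow_neg, Complex.cpow_one]
        have : (l : ℂ) ^ s ≠ 0 := by simp [Complex.cpow_eq_zero_iff, hl']
        field_simp
      have hl' : (l : ℂ) ≠ 0 := by exact_mod_cast hl.ne'
      rw [e, Complex.cpow_def_of_ne_zero (mul_ne_zero hl' (Complex.slitPlane_ne_zero (hsl z hz))) s,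
        Complex.log_ofReal_mul hl (Complex.slitPlane_ne_zero (hsl z hz)), add_mul, Complex.exp_add,
        Complex.ofReal_log hl.le, ← Complex.cpow_def_of_ne_zero hl',
        ← Complex.cpow_def_of_ne_zero (Complex.slitPlane_ne_zero (hsl z hz)), Complex.cpow_neg]
      have : (l : ℂ) ^ s ≠ 0 := by simp [Complex.cpow_eq_zero_iff, hl']
      field_simp)
    (x := a) (y := 1) ha (by simp)
  have h1 : M 1 = Complex.Gamma s := by
    have := Complex.integral_cpow_mul_exp_neg_mul_Ioi hs (r := 1) one_pos
    simpa [hM] using this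
  simp only [Complex.one_cpow, one_mul, h1] at key
  rw [← key, Complex.cpow_neg]
  have : a ^ s ≠ 0 := by simp [Complex.cpow_eq_zero_iff, Complex.slitPlane_ne_zero (hsl a ha)]
  field_simp
  rfl

lemma J_scale (ζ w : ℂ) (l : ℝ) (hl : 0 < l) : J (l * ζ) w = J ζ w := by
  have := integral_comp_mul_left_Ioi
    (fun y : ℝ => Complex.exp (1 + y * ζ) * (1 + y * ζ) ^ (-w)) 0 hl
  simp only [mul_zero] at this
  have hl' : (l : ℂ) ≠ 0 := by exact_mod_cast hl.ne'
  rw [J, J]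
  have e : ∫ y in Ioi (0 : ℝ), Complex.exp (1 + y * (l * ζ)) * (1 + y * (l * ζ)) ^ (-w)
    = ∫ y in Ioi (0 : ℝ), Complex.exp (1 + (l * y : ℝ) * ζ) * (1 + (l * y : ℝ) * ζ) ^ (-w) := by
    congr 1; ext y
    rw [show (y * (l * ζ) : ℂ) = (l * y : ℝ) * ζ by push_cast; ring]
  rw [e, this, Complex.real_smul]
  push_cast
  field_simp

lemma J_diff (ζ w : ℂ) (h : ζ.im ≠ 0) (hr : ζ.re < 0) : DifferentiableAt ℂ (fun ζ => J ζ w) ζ := by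
  refine differentiableAt_id.mul ?_
  set η := |ζ.im| / 2 with hη
  set δ := -ζ.re / 2 with hδ
  have hη0 : 0 < η := by have := abs_pos.2 h; positivity
  have hδ0 : 0 < δ := by simp only [hδ]; linarith
  set S : Set ℂ := {z | ‖z‖ < ‖ζ‖ + 1} ∩ ({z | η < |z.im|} ∩ {z | z.re < -δ}) with hS
  have hSo : S ∈ 𝓝 ζ := by
    refine IsOpen.mem_nhds ?_ ?_
    · exact (isOpen_lt continuous_norm continuous_const).inter
        ((isOpen_lt continuous_const (Complex.continuous_im.abs)).inter
          (isOpen_lt Complex.continuous_re continuous_const))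
    · refine ⟨by simp, ?_, ?_⟩
      · simp only [mem_ofPred_eq]; linarith
      · simp only [mem_ofPred_eq, hδ]; linarith
  obtain ⟨C1, hC10, hC1⟩ := bound_unif w 0 0 (by norm_num) (‖ζ‖ + 1) η δ (by positivity) hη0 hδ0
  obtain ⟨C2, hC20, hC2⟩ := bound_unif (w + 1) 0 0 (by norm_num) (‖ζ‖ + 1) η δ (by positivity) hη0 hδ0
  have him : ∀ z ∈ S, z.im ≠ 0 := fun z hz h0 => by
    have := hz.2.1
    simp only [mem_ofPred_eq, h0, abs_zero] at this
    linarith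
  have := hasDerivAt_integral_of_dominated_loc_of_deriv_le (𝕜 := ℂ)
      (μ := volume.restrict (Ioi (0 : ℝ)))
      (F := fun ζ (y : ℝ) => Complex.exp (1 + y * ζ) * (1 + y * ζ) ^ (-w))
      (F' := fun ζ (y : ℝ) => (Complex.exp (1 + y * ζ) * (1 + y * ζ) ^ (-w) -
        w * (Complex.exp (1 + y * ζ) * (1 + y * ζ) ^ (-(w + 1)))) * y)
      (bound := fun y => (C1 + ‖w‖ * C2) * (y ^ ((2 : ℝ) - 1) * Real.exp (-(δ / 2) * y))) hSo
      (by filter_upwards [hSo] with z hz using (cont_f z (him z hz) w).aestronglyMeasurable)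
      (int_f ζ h hr w)
      ((((cont_f ζ h w).sub ((cont_f ζ h (w + 1)).const_mul w)).mul
        Complex.continuous_ofReal).aestronglyMeasurable)
      (by
        filter_upwards [ae_restrict_mem measurableSet_Ioi] with y hy z hz
        have hy' : 0 ≤ y := le_of_lt hy
        have b1 := hC1 z hz.1.le hz.2.1.le hz.2.2.le y hy'
        have b2 := hC2 z hz.1.le hz.2.1.le hz.2.2.le y hy'
        simp only [zero_mul, Real.exp_zero, mul_one] at b1 b2
        rw [norm_mul, Complex.norm_real, Real.norm_of_nonneg hy',
          show (2 : ℝ) - 1 = 1 by norm_num, Real.rpow_one]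
        calc _ ≤ (‖Complex.exp (1 + y * z) * (1 + y * z) ^ (-w)‖ +
              ‖w * (Complex.exp (1 + y * z) * (1 + y * z) ^ (-(w + 1)))‖) * y := by
              gcongr; exact norm_sub_le _ _
          _ ≤ (C1 * Real.exp (-(δ / 2) * y) + ‖w‖ * (C2 * Real.exp (-(δ / 2) * y))) * y := by
              rw [norm_mul w]; gcongr
          _ = _ := by ring)
      ((int_gamma _ _ (by norm_num) (by linarith)).const_mul _)
      (by
        filter_upwards with y z hz
        have h1 := hasDeriv_F _ w (slit z (him z hz) y)
        have h2 : HasDerivAt (fun z : ℂ => (1 + y * z : ℂ)) (y : ℂ) z := by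
          simpa using ((hasDerivAt_id z).const_mul (y : ℂ)).const_add 1
        exact h1.comp z h2)
  exact this.2.differentiableAt

lemma J_const (σ : ℝ) (w : ℂ) {x y : ℂ} (hx : x.re < 0) (hx' : 0 < σ * x.im)
    (hy : y.re < 0) (hy' : 0 < σ * y.im) : J x w = J y w := by
  have him : ∀ z : ℂ, 0 < σ * z.im → z.im ≠ 0 := fun z hz h0 => by simp [h0] at hz
  refine cone_const (U := {z : ℂ | z.re < 0} ∩ {z : ℂ | 0 < σ * z.im}) (f := fun ζ => J ζ w)
    ?_ ?_ ?_ ?_ ?_ ⟨hx, hx'⟩ ⟨hy, hy'⟩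
  · exact (isOpen_lt Complex.continuous_re continuous_const).inter
      (isOpen_lt continuous_const (continuous_const.mul Complex.continuous_im))
  · refine ((convex_halfSpace_re_lt 0).inter ?_).isPreconnected
    refine convex_halfSpace_gt (f := fun z : ℂ => σ * z.im) ?_ 0
    exact (σ • Complex.imLm).isLinear
  · intro z hz
    exact (J_diff z w (him z hz.2) hz.1).differentiableWithinAt
  · rintro z hz rfl
    simpa using hz.1
  · intro z _ l hl
    exact J_scale z w l hl

lemma lower2 (σ k y : ℝ) (hσ : |σ| = 1) (hk0 : 0 ≤ k) (hk : k ≤ 1 / 2) (hy : 0 ≤ y) :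
    (1 + y) / 4 ≤ ‖(1 + y * (σ * Complex.I - k) : ℂ)‖ := by
  have hre : (1 + y * (σ * Complex.I - k) : ℂ).re = 1 - y * k := by simp; ring
  have him : (1 + y * (σ * Complex.I - k) : ℂ).im = y * σ := by simp
  by_cases h : 1 ≤ y
  · refine le_trans ?_ (Complex.abs_im_le_norm _)
    rw [him, abs_mul, hσ, abs_of_nonneg hy]; linarith
  · refine le_trans ?_ (Complex.abs_re_le_norm _)
    rw [hre]
    refine le_trans ?_ (le_abs_self _)
    nlinarith

lemma bound2 (σ k y : ℝ) (hσ : |σ| = 1) (hk0 : 0 ≤ k) (hk : k ≤ 1 / 2) (hy : 0 ≤ y) (w : ℂ)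
    (hw : 1 < w.re) :
    ‖Complex.exp (1 + y * (σ * Complex.I - k)) * (1 + y * (σ * Complex.I - k) : ℂ) ^ (-w)‖ ≤
      Real.exp 1 * Real.exp (Real.pi * |w.im|) * (1 / 4) ^ (-w.re) * (1 + ‖y‖) ^ (-w.re) := by
  have hl := lower2 σ k y hσ hk0 hk hy
  have h0 : (1 + y * (σ * Complex.I - k) : ℂ) ≠ 0 := by
    intro h; rw [h, norm_zero] at hl; linarith
  have he : ‖Complex.exp (1 + y * (σ * Complex.I - k))‖ ≤ Real.exp 1 := by
    rw [Complex.norm_exp]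
    apply Real.exp_le_exp.2
    simp
    positivity
  rw [norm_mul, Real.norm_of_nonneg hy]
  calc _ ≤ Real.exp 1 * (Real.exp (Real.pi * |w.im|) *
        ‖(1 + y * (σ * Complex.I - k) : ℂ)‖ ^ (-w.re)) := by
        gcongr; exact norm_cpow_bd _ _ h0
    _ ≤ Real.exp 1 * (Real.exp (Real.pi * |w.im|) * ((1 / 4) * (1 + y)) ^ (-w.re)) := by
        gcongr ?_ * (?_ * ?_)
        apply Real.rpow_le_rpow_of_nonpos (by positivity) (by linarith) (by linarith)
    _ = _ := by rw [Real.mul_rpow (by norm_num) (by positivity)]; ring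

lemma int_bound2 (K : ℝ) (w : ℂ) (hw : 1 < w.re) :
    Integrable (fun y : ℝ => K * (1 + ‖y‖) ^ (-w.re)) := by
  refine (integrable_one_add_norm ?_).const_mul K
  simpa using hw

lemma J_vert (σ : ℝ) (hσ : |σ| = 1) (w : ℂ) (hw : 1 < w.re) {x : ℂ} (hx : x.re < 0)
    (hx' : 0 < σ * x.im) : J x w = J (σ * Complex.I) w := by
  have hσ2 : σ * σ = 1 := by rw [← abs_mul_abs_self, hσ, one_mul]
  have hσ0 : σ ≠ 0 := by rintro rfl; simp at hσ
  have hlim : Tendsto (fun n : ℕ => J (σ * Complex.I - (1 / ((n : ℝ) + 2) : ℝ)) w) atTop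
      (𝓝 (J (σ * Complex.I) w)) := by
    have h0 : Tendsto (fun n : ℕ => (1 / ((n : ℝ) + 2) : ℝ)) atTop (𝓝 0) := by
      refine Tendsto.div_atTop tendsto_const_nhds ?_
      exact tendsto_atTop_add_const_right _ _ tendsto_natCast_atTop_atTop
    have h0' : Tendsto (fun n : ℕ => (σ * Complex.I - (1 / ((n : ℝ) + 2) : ℝ) : ℂ)) atTop
        (𝓝 (σ * Complex.I)) := by
      have := ((Complex.continuous_ofReal.tendsto 0).comp h0).const_sub (σ * Complex.I : ℂ)
      rw [Complex.ofReal_zero, sub_zero] at this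
      exact this
    refine h0'.mul ?_
    refine tendsto_integral_filter_of_dominated_convergence _ ?_ ?_
      ((int_bound2 (Real.exp 1 * Real.exp (Real.pi * |w.im|) * (1 / 4) ^ (-w.re)) w hw).integrableOn (s := Ioi 0)) ?_
    · refine Eventually.of_forall fun n => (cont_f _ ?_ w).aestronglyMeasurable
      simpa using hσ0
    · refine Eventually.of_forall fun n => ?_
      filter_upwards [ae_restrict_mem measurableSet_Ioi] with y hy
      refine bound2 σ _ y hσ (by positivity) ?_ (le_of_lt hy) w hw
      apply one_div_le_one_div_of_le (by norm_num)
      have : (0 : ℝ) ≤ n := by positivity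
      linarith
    · filter_upwards with y
      have hs : (1 + y * (σ * Complex.I) : ℂ) ∈ Complex.slitPlane := slit _ (by simpa using hσ0) y
      have hc := (hasDeriv_F _ w hs).continuousAt
      have ht := (h0'.const_mul (y : ℂ)).const_add 1
      exact hc.tendsto.comp ht
  refine tendsto_nhds_unique ?_ hlim
  refine tendsto_const_nhds.congr fun n => ?_
  refine J_const σ w hx hx' ?_ ?_
  · have : (0 : ℝ) < 1 / ((n : ℝ) + 2) := by positivity
    rw [Complex.sub_re, Complex.ofReal_re]
    simp only [Complex.re_ofReal_mul, Complex.I_re, mul_zero]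
    linarith
  · rw [Complex.sub_im, Complex.ofReal_im]
    simp [hσ2]

lemma vert_int (w : ℂ) (hw : 1 < w.re) :
    Integrable (fun y : ℝ => Complex.exp (1 + y * Complex.I) * (1 + y * Complex.I) ^ (-w)) := by
  refine Integrable.mono' (int_bound2 (Real.exp 1 * Real.exp (Real.pi * |w.im|) *
    (1 / 4) ^ (-w.re)) w hw) (cont_f _ (by simp) w).aestronglyMeasurable ?_
  filter_upwards with y
  rcases le_total 0 y with hy | hy
  · simpa using bound2 1 0 y (by simp) le_rfl (by norm_num) hy w hw
  · simpa using bound2 (-1) 0 (-y) (by simp) le_rfl (by norm_num) (by linarith) w hw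

lemma vert (w : ℂ) (hw : 1 < w.re) :
    ∫ y : ℝ, Complex.exp (1 + y * Complex.I) * (1 + y * Complex.I) ^ (-w)
      = 2 * Real.pi * (Complex.Gamma w)⁻¹ := by
  have hw0 : 0 < w.re := by linarith
  set g : ℝ → ℂ := (Ioi (0 : ℝ)).indicator
    (fun x : ℝ => (x : ℂ) ^ (w - 1) * Complex.exp (-((1 : ℂ) * x))) with hg
  have hgi : Integrable g :=
    (integrable_indicator_iff measurableSet_Ioi).2 (int_gammaC w 1 hw0 (by simp))
  have hF : FourierTransform.fourier g = fun ξ : ℝ =>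
      (1 + ((2 * Real.pi * ξ : ℝ) : ℂ) * Complex.I) ^ (-w) * Complex.Gamma w := by
    ext ξ
    rw [Real.fourier_real_eq_integral_exp_smul]
    rw [← gamma_complex w (1 + ((2 * Real.pi * ξ : ℝ) : ℂ) * Complex.I) hw0 (by simp),
      ← integral_indicator measurableSet_Ioi]
    congr 1; ext v
    by_cases hv : v ∈ Ioi (0 : ℝ)
    · rw [hg, indicator_of_mem hv, indicator_of_mem hv, smul_eq_mul, mul_left_comm,
        ← Complex.exp_add]
      congr 2
      push_cast; ring
    · rw [hg, indicator_of_notMem hv, indicator_of_notMem hv, smul_zero]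
  have hFi : Integrable (FourierTransform.fourier g) := by
    rw [hF]
    have h1 : Integrable (fun y : ℝ => (1 + y * Complex.I) ^ (-w)) := by
      refine (vert_int w hw).mono (cont_pow _ (by simp) _).aestronglyMeasurable ?_
      filter_upwards with y
      rw [norm_mul, Complex.norm_exp]
      have : (1 : ℝ) ≤ Real.exp 1 := Real.one_le_exp (by norm_num)
      simp
      exact le_mul_of_one_le_left (norm_nonneg _) this
    exact (h1.comp_mul_left' (R := 2 * Real.pi) (by positivity)).mul_const _
  have hc : ContinuousAt g 1 := by
    have h1 : ContinuousAt (fun x : ℝ => (x : ℂ) ^ (w - 1) * Complex.exp (-((1 : ℂ) * x))) 1 := by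
      refine ContinuousAt.mul ?_ (by fun_prop)
      exact Complex.continuousAt_ofReal_cpow_const 1 _ (Or.inr one_ne_zero)
    refine h1.congr ?_
    filter_upwards [lt_mem_nhds (zero_lt_one' ℝ)] with x hx
    rw [hg, indicator_of_mem (show x ∈ Ioi (0 : ℝ) from hx)]
  have inv := hgi.fourierInv_fourier_eq hFi hc
  rw [Real.fourierInv_eq', hF, hg, indicator_of_mem (show (1 : ℝ) ∈ Ioi (0 : ℝ) by simp)] at inv
  have hsub := Measure.integral_comp_mul_left
    (fun y : ℝ => Complex.exp (1 + y * Complex.I) * (1 + y * Complex.I) ^ (-w)) (2 * Real.pi)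
  have e : ∫ v : ℝ, Complex.exp (((2 * Real.pi * inner ℝ v 1 : ℝ) : ℂ) * Complex.I) •
      ((1 + ((2 * Real.pi * v : ℝ) : ℂ) * Complex.I) ^ (-w) * Complex.Gamma w)
    = Complex.exp (-1) * Complex.Gamma w * ∫ v : ℝ, Complex.exp (1 + (2 * Real.pi * v : ℝ) * Complex.I) *
      (1 + (2 * Real.pi * v : ℝ) * Complex.I) ^ (-w) := by
    rw [← integral_const_mul]
    congr 1; ext v
    rw [Complex.exp_add, smul_eq_mul, Complex.exp_neg]
    have : Complex.exp 1 ≠ 0 := Complex.exp_ne_zero _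
    have h2 : (inner ℝ v 1 : ℝ) = v := by simp
    rw [h2]
    field_simp
  rw [e, hsub] at inv
  have hG : Complex.Gamma w ≠ 0 := Complex.Gamma_ne_zero_of_re_pos hw0
  have hπ : |(2 * Real.pi)⁻¹| = (2 * Real.pi)⁻¹ := abs_of_pos (by positivity)
  rw [hπ, Complex.real_smul] at inv
  simp only [Complex.ofReal_one, Complex.one_cpow, one_mul] at inv
  have hp : (Real.pi : ℂ) ≠ 0 := by exact_mod_cast Real.pi_ne_zero
  have he := Complex.exp_ne_zero (-1)
  push_cast at inv
  set I0 := ∫ y : ℝ, Complex.exp (1 + y * Complex.I) * (1 + y * Complex.I) ^ (-w)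
  have h3 : Complex.Gamma w * ((2 * Real.pi : ℂ)⁻¹ * I0) = 1 := by
    apply mul_left_cancel₀ he
    rw [← mul_assoc, inv, mul_one]
  field_simp at h3 ⊢
  linear_combination h3

lemma hankel (x y w : ℂ) (hx : x.re < 0) (hx' : 0 < x.im) (hy : y.re < 0) (hy' : y.im < 0) :
    J x w - J y w = 2 * Real.pi * Complex.I * (Complex.Gamma w)⁻¹ := by
  have base : ∀ w : ℂ, 1 < w.re →
      J x w - J y w = 2 * Real.pi * Complex.I * (Complex.Gamma w)⁻¹ := by
    intro w hw
    rw [J_vert 1 (by simp) w hw hx (by simpa using hx'),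
      J_vert (-1) (by simp) w hw hy (by linarith)]
    have hi := vert_int w hw
    have h1 := intervalIntegral.integral_Iic_add_Ioi (b := 0) hi.integrableOn hi.integrableOn
    have h2 := integral_comp_neg_Iic 0
      (fun y : ℝ => Complex.exp (1 + (-y : ℝ) * Complex.I) * (1 + (-y : ℝ) * Complex.I) ^ (-w))
    simp only [neg_neg, neg_zero] at h2
    rw [h2, vert w hw] at h1
    have e1 : J ((1 : ℝ) * Complex.I) w = Complex.I * ∫ y in Ioi (0 : ℝ),
        Complex.exp (1 + y * Complex.I) * (1 + y * Complex.I) ^ (-w) := by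
      simp [J]
    have e2 : J ((-1 : ℝ) * Complex.I) w = -Complex.I * ∫ y in Ioi (0 : ℝ),
        Complex.exp (1 + (-y : ℝ) * Complex.I) * (1 + (-y : ℝ) * Complex.I) ^ (-w) := by
      simp [J]
    rw [e1, e2]
    linear_combination Complex.I * h1
  have ind : ∀ n : ℕ, ∀ w : ℂ, 1 < w.re + n →
      J x w - J y w = 2 * Real.pi * Complex.I * (Complex.Gamma w)⁻¹ := by
    intro n
    induction n with
    | zero => intro w hw; exact base w (by simpa using hw)
    | succ n ih =>
      intro w hw
      have h1 := ih (w + 1) (by push_cast at hw; simp; linarith)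
      have h2 := J_rec x hx'.ne' hx w
      have h3 := J_rec y hy'.ne hy w
      rw [Complex.one_div_Gamma_eq_self_mul_one_div_Gamma_add_one]
      linear_combination h2 - h3 + w * h1
  obtain ⟨n, hn⟩ := exists_nat_gt (1 - w.re)
  exact ind n w (by linarith)

noncomputable def K (ζ μ : ℂ) (α x : ℝ) : ℂ :=
  ζ * ∫ y in Ioi (0 : ℝ), Complex.exp (1 + y * ζ) * (1 + y * ζ) ^ (-μ) *
    Complex.exp (-((1 + y * ζ) ^ (α : ℂ) * x))

lemma series (ζ μ : ℂ) (h : ζ.im ≠ 0) (hr : ζ.re < 0) (α : ℝ) (hα1 : α < 1) (x : ℝ) :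
    HasSum (fun l : ℕ => ((-x : ℂ) ^ l / l.factorial) * J ζ (μ - α * l)) (K ζ μ α x) := by
  have hne : ∀ y : ℝ, (1 + y * ζ : ℂ) ≠ 0 := fun y => Complex.slitPlane_ne_zero (slit ζ h y)
  have hterm : ∀ (l : ℕ) (y : ℝ), ((-x : ℂ) ^ l / l.factorial) *
      (Complex.exp (1 + y * ζ) * (1 + y * ζ) ^ (-(μ - α * l))) =
      Complex.exp (1 + y * ζ) * (1 + y * ζ) ^ (-μ) *
        ((-((1 + y * ζ) ^ (α : ℂ) * x)) ^ l / l.factorial) := by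
    intro l y
    rw [show -(μ - α * l) = -μ + α * l by ring, Complex.cpow_add _ _ (hne y),
      Complex.cpow_mul_nat, show -((1 + y * ζ) ^ (α : ℂ) * x) = (-x : ℂ) * (1 + y * ζ) ^ (α : ℂ) by ring,
      mul_pow]
    ring
  have key := hasSum_integral_of_dominated_convergence (μ := volume.restrict (Ioi (0 : ℝ)))
    (F := fun (l : ℕ) (y : ℝ) => ((-x : ℂ) ^ l / l.factorial) *
      (Complex.exp (1 + y * ζ) * (1 + y * ζ) ^ (-(μ - α * l))))
    (f := fun y : ℝ => Complex.exp (1 + y * ζ) * (1 + y * ζ) ^ (-μ) *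
      Complex.exp (-((1 + y * ζ) ^ (α : ℂ) * x)))
    (fun l y => ‖Complex.exp (1 + y * ζ) * (1 + y * ζ) ^ (-μ)‖ *
      ((|x| * ‖(1 + y * ζ : ℂ)‖ ^ α) ^ l / l.factorial))
    (fun l => ((cont_f ζ h _).const_mul _).aestronglyMeasurable)
    (by
      intro l
      filter_upwards with y
      rw [hterm, norm_mul, norm_div, norm_pow, norm_neg, norm_mul (_ ^ (α : ℂ)), Complex.norm_cpow_real,
        Complex.norm_real, Complex.norm_natCast, Real.norm_eq_abs, mul_comm (|x|)])
    (by
      filter_upwards with y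
      exact (Real.summable_pow_div_factorial _).mul_left _)
    (by
      obtain ⟨C, h0, b, hb, hC⟩ := bound_one ζ h hr μ |x| α hα1
      have hexp : ∀ u : ℝ, ∑' l : ℕ, u ^ l / l.factorial = Real.exp u := by
        intro u
        rw [Real.exp_eq_exp_ℝ]
        exact (congrFun NormedSpace.exp_eq_tsum_div u).symm
      simp_rw [tsum_mul_left, hexp]
      refine Integrable.mono' ((int_exp b hb).const_mul C) ?_ ?_
      · have h1 : Continuous fun y : ℝ => ‖(1 + y * ζ : ℂ)‖ ^ α :=
          ((cont_t ζ).norm).rpow_const fun y => Or.inl (norm_ne_zero_iff.2 (hne y))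
        exact ((cont_f ζ h μ).norm.mul (Real.continuous_exp.comp
          (h1.const_mul |x|))).aestronglyMeasurable
      · filter_upwards [ae_restrict_mem measurableSet_Ioi] with y hy
        rw [Real.norm_of_nonneg (by positivity)]
        exact hC y (le_of_lt hy))
    (by
      filter_upwards with y
      simp_rw [hterm]
      refine HasSum.mul_left _ ?_
      rw [Complex.exp_eq_exp_ℂ]
      exact NormedSpace.expSeries_div_hasSum_exp _)
  have := key.mul_left ζ
  refine this.congr_fun ?_
  intro l
  rw [J, integral_const_mul]; ring

lemma mellinK (ζ : ℂ) (h : ζ.im ≠ 0) (hr : ζ.re < 0) (μ α φ : ℝ) (hα0 : 0 < α) (hα1 : α < 1)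
    (hφ : 0 ≤ φ) (hαφ : α * φ < Real.pi / 2)
    (harg : ∀ y : ℝ, 0 ≤ y → |(1 + y * ζ : ℂ).arg| ≤ φ) (s : ℂ) (hs : 0 < s.re) :
    IntegrableOn (fun x : ℝ => (x : ℂ) ^ (s - 1) * K ζ μ α x) (Ioi 0) ∧
    ∫ x in Ioi (0 : ℝ), (x : ℂ) ^ (s - 1) * K ζ μ α x = Complex.Gamma s * J ζ (μ + α * s) := by
  have hne : ∀ y : ℝ, (1 + y * ζ : ℂ) ≠ 0 := fun y => Complex.slitPlane_ne_zero (slit ζ h y)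
  have hζ0 : 0 < ‖ζ‖ := norm_pos_iff.2 (by rintro rfl; simp at h)
  have hm0 : 0 < |ζ.im| := abs_pos.2 h
  set m := min (1 / 2) (|ζ.im| / (2 * ‖ζ‖)) with hm
  have hmpos : 0 < m := by positivity
  set δ := m ^ α * Real.cos (α * φ) with hδ
  have hcos : 0 < Real.cos (α * φ) :=
    Real.cos_pos_of_mem_Ioo ⟨by have := Real.pi_pos; nlinarith, hαφ⟩
  have hδ0 : 0 < δ := by positivity
  have hargα : ∀ y : ℝ, 0 ≤ y → |(1 + y * ζ : ℂ).arg * α| ≤ α * φ := by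
    intro y hy
    rw [abs_mul, abs_of_pos hα0, mul_comm]
    exact mul_le_mul_of_nonneg_left (harg y hy) hα0.le
  have hre : ∀ y : ℝ, 0 ≤ y → δ ≤ ((1 + y * ζ : ℂ) ^ (α : ℂ)).re := by
    intro y hy
    rw [Complex.cpow_ofReal_re, hδ]
    have h1 := lower ζ ‖ζ‖ |ζ.im| hζ0 hm0 le_rfl le_rfl y hy
    have h2 : Real.cos (α * φ) ≤ Real.cos ((1 + y * ζ : ℂ).arg * α) := by
      rw [← Real.cos_abs ((1 + y * ζ : ℂ).arg * α)]
      exact Real.cos_le_cos_of_nonneg_of_le_pi (abs_nonneg _) (by have := Real.pi_pos; linarith)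
        (hargα y hy)
    gcongr
  obtain ⟨C, h0, b, hb, hC⟩ := bound_one ζ h hr μ 0 0 (by norm_num)
  set G : ℝ → ℝ → ℂ := fun x y => (x : ℂ) ^ (s - 1) * (Complex.exp (1 + y * ζ) *
    (1 + y * ζ) ^ (-(μ : ℂ)) * Complex.exp (-((1 + y * ζ) ^ (α : ℂ) * x))) with hG
  have hGi : Integrable (Function.uncurry G)
      ((volume.restrict (Ioi (0 : ℝ))).prod (volume.restrict (Ioi (0 : ℝ)))) := by
    have hb1 := Integrable.mul_prod (int_gamma s.re δ hs hδ0) ((int_exp b hb).const_mul C)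
    refine Integrable.mono' hb1 ?_ ?_
    · refine Measurable.aestronglyMeasurable ?_
      refine ((meas_cpow _).comp measurable_fst).mul ?_
      refine ((cont_f ζ h μ).measurable.comp measurable_snd).mul ?_
      refine Complex.measurable_exp.comp ?_
      exact ((((cont_pow ζ h α).measurable.comp measurable_snd)).mul
        (Complex.measurable_ofReal.comp measurable_fst)).neg
    · rw [Measure.prod_restrict]
      filter_upwards [ae_restrict_mem ((measurableSet_Ioi (a := (0 : ℝ))).prod (measurableSet_Ioi (a := (0 : ℝ))))] with p hp
      obtain ⟨x, y⟩ := p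
      have hx : 0 < x := hp.1
      have hy : 0 < y := hp.2
      have hCy := hC y hy.le
      simp only [zero_mul, Real.exp_zero, mul_one] at hCy
      simp only [Function.uncurry, hG]
      rw [norm_mul, norm_mul, norm_cpow_real x hx, Complex.norm_exp (-_)]
      have h3 : Real.exp (-((1 + y * ζ : ℂ) ^ (α : ℂ) * x)).re ≤ Real.exp (-δ * x) := by
        apply Real.exp_le_exp.2
        rw [Complex.neg_re, Complex.re_mul_ofReal]
        have := hre y hy.le
        nlinarith
      calc _ ≤ x ^ (s.re - 1) * (C * Real.exp (-b * y) * Real.exp (-δ * x)) := by gcongr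
        _ = _ := by ring
  have hK : ∀ x : ℝ, (x : ℂ) ^ (s - 1) * K ζ μ α x = ζ * ∫ y in Ioi (0 : ℝ), G x y := by
    intro x
    simp only [hG]
    rw [integral_const_mul, K]; ring
  simp_rw [hK]
  constructor
  · exact hGi.integral_prod_left.const_mul ζ
  · rw [integral_const_mul, integral_integral_swap hGi, J, mul_left_comm]
    congr 1
    rw [← integral_const_mul]
    refine setIntegral_congr_fun measurableSet_Ioi fun y hy => ?_
    have hy' : 0 ≤ y := le_of_lt hy
    have hg := gamma_complex s ((1 + y * ζ) ^ (α : ℂ)) hs (hδ0.trans_le (hre y hy'))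
    have e1 : ∫ x in Ioi (0 : ℝ), G x y = (Complex.exp (1 + y * ζ) * (1 + y * ζ) ^ (-(μ : ℂ))) *
        ∫ x in Ioi (0 : ℝ), (x : ℂ) ^ (s - 1) * Complex.exp (-((1 + y * ζ) ^ (α : ℂ) * x)) := by
      rw [← integral_const_mul]
      congr 1; ext x; simp only [hG]; ring
    have him : (Complex.log (1 + y * ζ) * (α : ℂ)).im = (1 + y * ζ : ℂ).arg * α := by
      rw [Complex.im_mul_ofReal, Complex.log_im]
    have hab := abs_le.1 (hargα y hy')
    have hπ := Real.pi_pos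
    have e2 : ((1 + y * ζ : ℂ) ^ (α : ℂ)) ^ (-s) = (1 + y * ζ : ℂ) ^ ((α : ℂ) * (-s)) := by
      rw [Complex.cpow_mul] <;> rw [him] <;> linarith
    show (∫ x in Ioi (0 : ℝ), G x y) = _
    rw [e1, hg, e2, show -((μ : ℂ) + α * s) = -μ + α * (-s) by ring, Complex.cpow_add _ _ (hne y)]
    ring

lemma arg_le (φ : ℝ) (h1 : Real.pi / 2 < φ) (h2 : φ < Real.pi) (y : ℝ) (hy : 0 ≤ y) :
    |(1 + y * Complex.exp (φ * Complex.I) : ℂ).arg| ≤ φ := by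
  have hπ := Real.pi_pos
  have hsin : 0 < Real.sin φ := Real.sin_pos_of_pos_of_lt_pi (by linarith) h2
  set t : ℂ := 1 + y * Complex.exp (φ * Complex.I) with ht
  have hre : t.re = 1 + y * Real.cos φ := by
    simp [ht, Complex.exp_ofReal_mul_I_re]
  have him : t.im = y * Real.sin φ := by
    simp [ht, Complex.exp_ofReal_mul_I_im]
  have harg0 : 0 ≤ t.arg := Complex.arg_nonneg_iff.2 (by rw [him]; positivity)
  rw [abs_of_nonneg harg0]
  by_contra! hlt
  have hle := Complex.arg_le_pi t
  have hs : 0 < Real.sin (t.arg - φ) := Real.sin_pos_of_pos_of_lt_pi (by linarith) (by linarith)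
  rw [Real.sin_sub] at hs
  have a1 : ‖t‖ * Real.cos t.arg = t.re := Complex.norm_mul_cos_arg t
  have a2 : ‖t‖ * Real.sin t.arg = t.im := Complex.norm_mul_sin_arg t
  have h3 : 0 ≤ ‖t‖ * (Real.sin t.arg * Real.cos φ - Real.cos t.arg * Real.sin φ) := by positivity
  have h4 : ‖t‖ * (Real.sin t.arg * Real.cos φ - Real.cos t.arg * Real.sin φ) = - Real.sin φ := by
    have : ‖t‖ * (Real.sin t.arg * Real.cos φ - Real.cos t.arg * Real.sin φ) =
      (‖t‖ * Real.sin t.arg) * Real.cos φ - (‖t‖ * Real.cos t.arg) * Real.sin φ := by ring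
    rw [this, a1, a2, hre, him]; ring
  linarith

lemma exists_angle (α : ℝ) (hα0 : 0 < α) (hα1 : α < 1) :
    ∃ φ, Real.pi / 2 < φ ∧ φ < Real.pi ∧ α * φ < Real.pi / 2 := by
  have hπ := Real.pi_pos
  have h : Real.pi / 2 < min Real.pi (Real.pi / 2 / α) := by
    refine lt_min (by linarith) ?_
    rw [lt_div_iff₀ hα0]; nlinarith
  obtain ⟨φ, h1, h2⟩ := exists_between h
  refine ⟨φ, h1, h2.trans_le (min_le_left _ _), ?_⟩
  have := h2.trans_le (min_le_right _ _)
  rw [lt_div_iff₀ hα0] at this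
  linarith

end FoxH

theorem mellin_foxH_density (r α : ℝ) (hr : 0 < r) (hα0 : 0 < α) (hα1 : α < 1)
    (z : ℂ) (hz : 1 - r < z.re) :
    ∫ x in Ioi (0 : ℝ),
        (x : ℂ) ^ (z - 1) * ((x ^ (r - 1) * wright (-α) (r * (1 - α)) (-x) : ℝ) : ℂ)
      = Complex.Gamma ((r : ℂ) - 1 + z) / Complex.Gamma ((r : ℂ) - α + α * z) := by
  obtain ⟨φ, h1, h2, h3⟩ := FoxH.exists_angle α hα0 hα1
  have hπ := Real.pi_pos
  set ζ : ℂ := Complex.exp (φ * Complex.I) with hζ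
  have hre : ζ.re < 0 := by
    rw [hζ, Complex.exp_ofReal_mul_I_re]
    exact Real.cos_neg_of_pi_div_two_lt_of_lt h1 (by linarith)
  have him : 0 < ζ.im := by
    rw [hζ, Complex.exp_ofReal_mul_I_im]
    exact Real.sin_pos_of_pos_of_lt_pi (by linarith) h2
  set ζ' : ℂ := (starRingEnd ℂ) ζ with hζ'
  have hre' : ζ'.re < 0 := by simpa [hζ'] using hre
  have him' : ζ'.im < 0 := by simpa [hζ'] using him
  have harg : ∀ y : ℝ, 0 ≤ y → |(1 + y * ζ : ℂ).arg| ≤ φ := FoxH.arg_le φ h1 h2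
  have harg' : ∀ y : ℝ, 0 ≤ y → |(1 + y * ζ' : ℂ).arg| ≤ φ := by
    intro y hy
    have e : (1 + y * ζ' : ℂ) = (starRingEnd ℂ) (1 + y * ζ) := by simp [hζ']
    have hl := harg y hy
    rw [e, Complex.arg_conj, if_neg, abs_neg]
    · exact hl
    · intro h; rw [h, abs_of_pos hπ] at hl; linarith
  set μ : ℝ := r * (1 - α) with hμ
  set s : ℂ := (r : ℂ) - 1 + z with hs
  have hs0 : 0 < s.re := by simp [hs]; linarith
  obtain ⟨i1, m1⟩ := FoxH.mellinK ζ him.ne' hre μ α φ hα0 hα1 (by linarith) h3 harg s hs0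
  obtain ⟨i2, m2⟩ := FoxH.mellinK ζ' him'.ne hre' μ α φ hα0 hα1 (by linarith) h3 harg' s hs0
  have hp : (2 * Real.pi * Complex.I : ℂ) ≠ 0 := by
    simp [Real.pi_ne_zero]
  have hW : ∀ x : ℝ, ((wright (-α) μ (-x) : ℝ) : ℂ) =
      (2 * Real.pi * Complex.I)⁻¹ * (FoxH.K ζ μ α x - FoxH.K ζ' μ α x) := by
    intro x
    have a1 := FoxH.series ζ μ him.ne' hre α hα1 x
    have a2 := FoxH.series ζ' μ him'.ne hre' α hα1 x
    rw [← ((a1.sub a2).mul_left (2 * Real.pi * Complex.I)⁻¹).tsum_eq, wright, Complex.ofReal_tsum]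
    congr 1; ext l
    rw [← mul_sub, FoxH.hankel ζ ζ' _ hre him hre' him']
    push_cast
    rw [← Complex.Gamma_ofReal]
    push_cast
    rw [show (μ : ℂ) - α * l = -α * l + μ by ring]
    field_simp
  have hint : ∀ x ∈ Ioi (0 : ℝ),
      (x : ℂ) ^ (z - 1) * ((x ^ (r - 1) * wright (-α) μ (-x) : ℝ) : ℂ) =
      (2 * Real.pi * Complex.I)⁻¹ * ((x : ℂ) ^ (s - 1) * FoxH.K ζ μ α x -
        (x : ℂ) ^ (s - 1) * FoxH.K ζ' μ α x) := by
    intro x hx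
    have hx' : 0 < x := hx
    have hx0 : (x : ℂ) ≠ 0 := by exact_mod_cast hx'.ne'
    rw [Complex.ofReal_mul, hW, Complex.ofReal_cpow hx'.le,
      show s - 1 = (z - 1) + ((r - 1 : ℝ) : ℂ) by rw [hs]; push_cast; ring,
      Complex.cpow_add _ _ hx0]
    ring
  rw [setIntegral_congr_fun measurableSet_Ioi hint, integral_const_mul, integral_sub i1 i2, m1, m2,
    ← mul_sub, FoxH.hankel ζ ζ' _ hre him hre' him',
    show (μ : ℂ) + α * s = r - α + α * z by rw [hμ, hs]; push_cast; ring]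
  field_simp
end

section
/- Fix r > 0 and 0 < α < 1. The function f(z) = z^(r-1) W_{-α, r(1-α)}(-z), where W_{λ,μ}(z) = Σ_{l≥0} z^l/(l! Γ(λl+μ)), is nonnegative on (0,∞) and integrates to 1, hence is a probability density on (0,∞). -/
open MeasureTheory Set

lemma prod_pos_bound (w : ℝ) (hw : 0 ≤ w) (n : ℕ) :
    ∏ j ∈ Finset.range (n + 2), (w + j) ≤
      w * Real.exp w * (((n + 1 : ℕ) : ℝ) ^ w * ((n + 1).factorial : ℝ)) := by
  induction n with
  | zero =>
    simp [Finset.prod_range_succ]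
    have := Real.add_one_le_exp w
    gcongr
  | succ n ih =>
    rw [Finset.prod_range_succ, Nat.factorial_succ (n + 1)]
    have key : (w + ((n + 2 : ℕ) : ℝ)) * ((n + 1 : ℕ) : ℝ) ^ w
        ≤ ((n + 2 : ℕ) : ℝ) * ((n + 2 : ℕ) : ℝ) ^ w := by
      have h1 : (0 : ℝ) < ((n + 1 : ℕ) : ℝ) := by positivity
      have h2 : (0 : ℝ) < ((n + 2 : ℕ) : ℝ) := by positivity
      have hl := Real.one_sub_inv_le_log_of_pos (div_pos h2 h1)
      have e1 : 1 - (((n + 2 : ℕ) : ℝ) / ((n + 1 : ℕ) : ℝ))⁻¹ = 1 / ((n + 2 : ℕ) : ℝ) := by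
        field_simp; push_cast; ring
      rw [e1] at hl
      have h3 : 1 + w / ((n + 2 : ℕ) : ℝ) ≤ (((n + 2 : ℕ) : ℝ) / ((n + 1 : ℕ) : ℝ)) ^ w := by
        rw [Real.rpow_def_of_pos (div_pos h2 h1)]
        have := Real.add_one_le_exp (Real.log (((n + 2 : ℕ) : ℝ) / ((n + 1 : ℕ) : ℝ)) * w)
        have h4 := mul_le_mul_of_nonneg_right hl hw
        have h5 : 1 / ((n + 2 : ℕ) : ℝ) * w = w / ((n + 2 : ℕ) : ℝ) := by ring
        linarith
      rw [Real.div_rpow h2.le h1.le, le_div_iff₀ (by positivity)] at h3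
      calc _ = ((n + 2 : ℕ) : ℝ) * ((1 + w / ((n + 2 : ℕ) : ℝ)) * ((n + 1 : ℕ) : ℝ) ^ w) := by
            field_simp; ring
        _ ≤ _ := by gcongr
    have hnn : 0 ≤ w + ((n + 2 : ℕ) : ℝ) := by positivity
    calc _ ≤ (w * Real.exp w * (((n + 1 : ℕ) : ℝ) ^ w * ((n + 1).factorial : ℝ)))
            * (w + ((n + 2 : ℕ) : ℝ)) := by
          apply mul_le_mul_of_nonneg_right ih hnn
      _ = w * Real.exp w * ((n + 1).factorial : ℝ) *
            ((w + ((n + 2 : ℕ) : ℝ)) * ((n + 1 : ℕ) : ℝ) ^ w) := by ring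
      _ ≤ w * Real.exp w * ((n + 1).factorial : ℝ) *
            (((n + 2 : ℕ) : ℝ) * ((n + 2 : ℕ) : ℝ) ^ w) := by gcongr
      _ = _ := by push_cast; ring_nf

lemma prod_neg_bound (v : ℝ) (hv : 0 ≤ v) (n : ℕ) :
    |∏ j ∈ Finset.range (n + 1), (-v + j)| * ((n : ℝ) + 1) ^ v ≤
      v * Real.exp v * (v + 1) ^ v * (n.factorial : ℝ) := by
  have small : ∀ n : ℕ, (n : ℝ) ≤ v → |∏ j ∈ Finset.range (n + 1), (-v + j)| * ((n : ℝ) + 1) ^ v ≤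
      v * Real.exp v * (v + 1) ^ v * (n.factorial : ℝ) := by
    intro n hn
    have h1 : |∏ j ∈ Finset.range (n + 1), (-v + j)| ≤ v ^ (n + 1) := by
      rw [Finset.abs_prod]
      calc _ ≤ ∏ j ∈ Finset.range (n + 1), v := by
            apply Finset.prod_le_prod
            · intros; positivity
            · intro j hj
              have : (j : ℝ) ≤ n := by
                have := Finset.mem_range.mp hj
                exact_mod_cast Nat.lt_succ_iff.mp this
              have h0 : (0 : ℝ) ≤ j := by positivity
              rw [abs_le]; constructor <;> linarith
        _ = _ := by simp
    have h2 : v ^ n ≤ Real.exp v * n.factorial := by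
      have := Real.pow_div_factorial_le_exp v hv n
      rwa [div_le_iff₀ (by positivity)] at this
    have h3 : ((n : ℝ) + 1) ^ v ≤ (v + 1) ^ v := by gcongr
    calc _ ≤ v ^ (n + 1) * (v + 1) ^ v := by gcongr
      _ = v * v ^ n * (v + 1) ^ v := by ring
      _ ≤ v * (Real.exp v * n.factorial) * (v + 1) ^ v := by gcongr
      _ = _ := by ring
  induction n with
  | zero => exact small 0 (by simpa using hv)
  | succ n ih =>
    by_cases h : ((n + 1 : ℕ) : ℝ) ≤ v
    · exact small _ h
    push Not at h
    rw [Finset.prod_range_succ, abs_mul, Nat.factorial_succ]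
    have hpos : (0 : ℝ) < (n : ℝ) + 1 := by positivity
    have key : |-v + ((n + 1 : ℕ) : ℝ)| * (((n + 1 : ℕ) : ℝ) + 1) ^ v
        ≤ ((n : ℝ) + 1) * ((n : ℝ) + 1) ^ v := by
      rw [abs_of_pos (by linarith)]
      push_cast at h ⊢
      have h1 : 1 - v / ((n : ℝ) + 1) ≤ Real.exp (- (v / ((n : ℝ) + 1))) := by
        have := Real.add_one_le_exp (- (v / ((n : ℝ) + 1)))
        linarith
      have h2 : (((n : ℝ) + 1 + 1) / ((n : ℝ) + 1)) ^ v ≤ Real.exp (v / ((n : ℝ) + 1)) := by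
        rw [Real.rpow_def_of_pos (by positivity)]
        apply Real.exp_le_exp.mpr
        have := Real.log_le_sub_one_of_pos (x := ((n : ℝ) + 1 + 1) / ((n : ℝ) + 1)) (by positivity)
        have e : ((n : ℝ) + 1 + 1) / ((n : ℝ) + 1) - 1 = 1 / ((n : ℝ) + 1) := by
          field_simp; ring
        rw [e] at this
        calc _ ≤ 1 / ((n : ℝ) + 1) * v := by gcongr
          _ = _ := by ring
      have h3 : (1 - v / ((n : ℝ) + 1)) * (((n : ℝ) + 1 + 1) / ((n : ℝ) + 1)) ^ v ≤ 1 := by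
        calc _ ≤ Real.exp (- (v / ((n : ℝ) + 1))) * Real.exp (v / ((n : ℝ) + 1)) := by
              gcongr
          _ = 1 := by rw [← Real.exp_add]; simp
      rw [Real.div_rpow (by positivity) (by positivity), ← mul_div_assoc,
        div_le_one (by positivity)] at h3
      calc _ = ((n : ℝ) + 1) * ((1 - v / ((n : ℝ) + 1)) * ((n : ℝ) + 1 + 1) ^ v) := by
            field_simp; ring
        _ ≤ _ := by gcongr
    calc _ = |∏ j ∈ Finset.range (n + 1), (-v + j)| *
          (|-v + ((n + 1 : ℕ) : ℝ)| * (((n + 1 : ℕ) : ℝ) + 1) ^ v) := by ring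
      _ ≤ |∏ j ∈ Finset.range (n + 1), (-v + j)| * (((n : ℝ) + 1) * ((n : ℝ) + 1) ^ v) := by gcongr
      _ = ((n : ℝ) + 1) * (|∏ j ∈ Finset.range (n + 1), (-v + j)| * ((n : ℝ) + 1) ^ v) := by ring
      _ ≤ ((n : ℝ) + 1) * (v * Real.exp v * (v + 1) ^ v * (n.factorial : ℝ)) := by gcongr
      _ = _ := by push_cast; ring

/-- reciprocal of the Euler approximation of Gamma -/
noncomputable def rG (w : ℝ) (n : ℕ) : ℝ :=
  (∏ j ∈ Finset.range (n + 1), (w + j)) / ((n : ℝ) ^ w * n.factorial)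

lemma rG_eq (w : ℝ) (n : ℕ) : rG w n = (Real.GammaSeq w n)⁻¹ := by
  simp [rG, Real.GammaSeq]

lemma rG_tendsto (w : ℝ) :
    Filter.Tendsto (rG w) Filter.atTop (nhds (Real.Gamma w)⁻¹) := by
  by_cases h : ∃ m : ℕ, w = -m
  · obtain ⟨m, rfl⟩ := h
    rw [Real.Gamma_neg_nat_eq_zero, inv_zero]
    apply tendsto_const_nhds.congr'
    filter_upwards [Filter.eventually_ge_atTop m] with n hn
    rw [rG, Finset.prod_eq_zero (i := m) (by simp; omega) (by simp)]
    simp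
  · push Not at h
    have := (Real.GammaSeq_tendsto_Gamma w).inv₀ (Real.Gamma_ne_zero h)
    exact this.congr fun n => (rG_eq w n).symm

lemma rG_pos_bound (w : ℝ) (hw : 0 ≤ w) (n : ℕ) : |rG w (n + 1)| ≤ w * Real.exp w := by
  have := prod_pos_bound w hw n
  rw [abs_of_nonneg, rG, div_le_iff₀ (by positivity)]
  · exact this
  · unfold rG; positivity

lemma rG_neg_bound (v : ℝ) (hv : 0 ≤ v) (n : ℕ) :
    |rG (-v) (n + 1)| ≤ v * Real.exp v * (v + 1) ^ v := by
  have := prod_neg_bound v hv (n + 1)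
  have h1 : (0 : ℝ) < ((n + 1 : ℕ) : ℝ) := by positivity
  rw [rG, abs_div, div_le_iff₀ (by positivity),
    abs_of_pos (show (0 : ℝ) < ((n + 1 : ℕ) : ℝ) ^ (-v) * ((n + 1).factorial : ℝ) by positivity),
    Real.rpow_neg h1.le]
  have h2 : ((n + 1 : ℕ) : ℝ) ^ v ≤ (((n + 1 : ℕ) : ℝ) + 1) ^ v := by gcongr; linarith
  have h3 : |∏ j ∈ Finset.range (n + 1 + 1), (-v + (j : ℝ))| * ((n + 1 : ℕ) : ℝ) ^ v ≤
      v * Real.exp v * (v + 1) ^ v * ((n + 1).factorial : ℝ) :=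
    le_trans (by gcongr) this
  rw [← le_div_iff₀ (by positivity)] at h3
  refine h3.trans (le_of_eq ?_)
  field_simp

/-- dominating coefficients -/
noncomputable def Cb (α μ : ℝ) (l : ℕ) : ℝ :=
  μ * Real.exp μ + l * Real.exp l * ((l : ℝ) + 1) ^ (α * l)

lemma rG_bound (α μ : ℝ) (hα0 : 0 < α) (hα1 : α < 1) (hμ : 0 ≤ μ) (l n : ℕ) :
    |rG (μ - α * l) (n + 1)| ≤ Cb α μ l := by
  have hl : (0 : ℝ) ≤ l := by positivity
  have hal : 0 ≤ α * l := by positivity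
  have hal1 : α * l ≤ l := by nlinarith
  rcases le_total 0 (μ - α * l) with h | h
  · refine (rG_pos_bound _ h n).trans ?_
    have : μ - α * l ≤ μ := by linarith
    have h1 : (μ - α * l) * Real.exp (μ - α * l) ≤ μ * Real.exp μ := by gcongr
    have h2 : 0 ≤ l * Real.exp l * ((l : ℝ) + 1) ^ (α * l) := by positivity
    unfold Cb; linarith
  · have h0 : 0 ≤ α * l - μ := by linarith
    have hb := rG_neg_bound (α * l - μ) h0 n
    rw [neg_sub] at hb
    refine hb.trans ?_
    have h1 : α * l - μ ≤ l := by linarith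
    have h3 : (α * l - μ + 1) ^ (α * l - μ) ≤ ((l : ℝ) + 1) ^ (α * l) := by
      calc _ ≤ ((l : ℝ) + 1) ^ (α * l - μ) := by gcongr
        _ ≤ _ := Real.rpow_le_rpow_of_exponent_le (by linarith) (by linarith)
    have h2 : (α * l - μ) * Real.exp (α * l - μ) * (α * l - μ + 1) ^ (α * l - μ) ≤
      l * Real.exp l * ((l : ℝ) + 1) ^ (α * l) := by gcongr
    have h4 : 0 ≤ μ * Real.exp μ := by positivity
    unfold Cb; linarith

lemma Cb_summable (α μ M : ℝ) (hα0 : 0 < α) (hα1 : α < 1) (hM : 0 ≤ M) :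
    Summable (fun l : ℕ => M ^ l / l.factorial * Cb α μ l) := by
  simp only [Cb, mul_add]
  refine ((Real.summable_pow_div_factorial M).mul_right _).add ?_
  have hb : Filter.Tendsto (fun l : ℕ => M * Real.exp 3 * ((l : ℝ) + 1) ^ (-(1 - α)))
      Filter.atTop (nhds 0) := by
    have h := (tendsto_rpow_neg_atTop (y := 1 - α) (by linarith)).comp
      (Filter.tendsto_atTop_add_const_right _ (1 : ℝ) (tendsto_natCast_atTop_atTop (R := ℝ)))
    simpa using h.const_mul (M * Real.exp 3)
  have hev := hb.eventually (ge_mem_nhds (show (0 : ℝ) < 1 / 2 by norm_num))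
  refine Summable.of_norm_bounded_eventually_nat (g := fun l : ℕ => Real.exp 1 * (1 / 2 : ℝ) ^ l)
    ((summable_geometric_of_lt_one (by norm_num) (by norm_num)).mul_left _) ?_
  filter_upwards [hev] with l hl
  have hl1 : (0 : ℝ) < (l : ℝ) + 1 := by positivity
  rw [Real.norm_of_nonneg (by positivity)]
  have h1 : ((l : ℝ) + 1) ^ l / l.factorial ≤ Real.exp (l + 1) :=
    Real.pow_div_factorial_le_exp _ hl1.le l
  have h2 : ((l : ℝ) + 1) ^ (α * l) = ((l : ℝ) + 1) ^ l * (((l : ℝ) + 1) ^ (-(1 - α))) ^ l := by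
    rw [← Real.rpow_natCast (((l : ℝ) + 1) ^ (-(1 - α))), ← Real.rpow_mul hl1.le,
      ← Real.rpow_natCast, ← Real.rpow_add hl1]
    congr 1; ring
  have h3 : (l : ℝ) ≤ Real.exp l := by
    have := Real.add_one_le_exp (l : ℝ); linarith
  have h4 : Real.exp ((l : ℝ)) = Real.exp 1 ^ l := by
    rw [← Real.exp_nat_mul, mul_one]
  have h5 : Real.exp 3 = Real.exp 1 ^ 3 := by
    rw [← Real.exp_nat_mul]; norm_num
  calc _ = M ^ l * (l * Real.exp l * (((l : ℝ) + 1) ^ l / l.factorial *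
            (((l : ℝ) + 1) ^ (-(1 - α))) ^ l)) := by rw [h2]; ring
    _ ≤ M ^ l * (Real.exp l * Real.exp l * (Real.exp (l + 1) *
            (((l : ℝ) + 1) ^ (-(1 - α))) ^ l)) := by gcongr
    _ = Real.exp 1 * (M * Real.exp 3 * ((l : ℝ) + 1) ^ (-(1 - α))) ^ l := by
        rw [Real.exp_add, h4, h5, mul_pow, mul_pow]; ring
    _ ≤ _ := by gcongr

/-- polynomial-times-exponential approximants, defined by a positive recursion -/
noncomputable def Bf (α : ℝ) : ℕ → ℝ → ℝ → ℝ
  | 0, _, X => Real.exp (-X)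
  | n + 1, μ, X => μ * Bf α n (μ + 1) X + α * X * Bf α n (μ + 1 - α) X

lemma Bf_nonneg (α : ℝ) (hα0 : 0 < α) (hα1 : α < 1) (n : ℕ) :
    ∀ μ X : ℝ, 0 ≤ μ → 0 ≤ X → 0 ≤ Bf α n μ X := by
  induction n with
  | zero => intro μ X _ _; exact (Real.exp_pos _).le
  | succ n ih =>
    intro μ X hμ hX
    have h1 := ih (μ + 1) X (by linarith) hX
    have h2 := ih (μ + 1 - α) X (by linarith) hX
    simp only [Bf]; positivity

lemma prod_shift (w : ℝ) (n : ℕ) :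
    ∏ j ∈ Finset.range (n + 1), (w + j) = w * ∏ j ∈ Finset.range n, (w + 1 + j) := by
  rw [Finset.prod_range_succ', mul_comm]
  congr 1
  · simp
  · apply Finset.prod_congr rfl; intros; push_cast; ring

lemma hasSum_of_eq {f g : ℕ → ℝ} {a : ℝ} (h : HasSum g a) (e : ∀ l, f l = g l) : HasSum f a := by
  rwa [show f = g from funext e]

lemma Bf_hasSum (α : ℝ) (n : ℕ) : ∀ μ X : ℝ,
    HasSum (fun l : ℕ => (-X) ^ l / l.factorial * ∏ j ∈ Finset.range n, (μ - α * l + j))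
      (Bf α n μ X) := by
  induction n with
  | zero =>
    intro μ X
    have := NormedSpace.expSeries_div_hasSum_exp (-X)
    rw [← Real.exp_eq_exp_ℝ] at this
    simpa [Bf] using this
  | succ n ih =>
    intro μ X
    simp only [prod_shift, Bf]
    have h1 := (ih (μ + 1) X).mul_left μ
    have h2 := (ih (μ + 1 - α) X).mul_left (α * X)
    have h3 : HasSum (fun l : ℕ => (-X) ^ l / l.factorial *
        (-(α * l) * ∏ j ∈ Finset.range n, (μ - α * l + 1 + j)))
        (α * X * Bf α n (μ + 1 - α) X) := by
      rw [← hasSum_nat_add_iff' 1]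
      simp only [Finset.range_one, Finset.sum_singleton, Nat.cast_zero, mul_zero, neg_zero,
        zero_mul, sub_zero]
      refine hasSum_of_eq h2 fun l => ?_
      have e : ∀ j : ℕ, μ - α * ((l + 1 : ℕ) : ℝ) + 1 + (j : ℝ) = μ + 1 - α - α * l + j :=
        fun j => by push_cast; ring
      simp only [e]
      rw [Nat.factorial_succ, pow_succ]
      push_cast
      field_simp
    have := h1.add h3
    refine hasSum_of_eq this fun l => ?_
    have e : ∀ j : ℕ, μ + 1 - α * l + (j : ℝ) = μ - α * l + 1 + j := fun j => by ring
    simp only [e]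
    ring

lemma Bf_integral (α : ℝ) (n : ℕ) : ∀ μ ρ : ℝ, 0 < ρ →
    IntegrableOn (fun X => X ^ (ρ - 1) * Bf α n μ X) (Ioi 0) ∧
    ∫ X in Ioi (0 : ℝ), X ^ (ρ - 1) * Bf α n μ X =
      Real.Gamma ρ * ∏ j ∈ Finset.range n, (μ + α * ρ + j) := by
  induction n with
  | zero =>
    intro μ ρ hρ
    simp only [Bf, Finset.range_zero, Finset.prod_empty, mul_one, mul_comm (_ ^ (ρ - 1))]
    exact ⟨Real.GammaIntegral_convergent hρ, (Real.Gamma_eq_integral hρ).symm⟩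
  | succ n ih =>
    intro μ ρ hρ
    obtain ⟨i1, e1⟩ := ih (μ + 1) ρ hρ
    obtain ⟨i2, e2⟩ := ih (μ + 1 - α) (ρ + 1) (by linarith)
    have hc : EqOn (fun X => X ^ (ρ - 1) * Bf α (n + 1) μ X)
        (fun X => μ * (X ^ (ρ - 1) * Bf α n (μ + 1) X) +
          α * (X ^ (ρ + 1 - 1) * Bf α n (μ + 1 - α) X)) (Ioi 0) := by
      intro X hX
      have hX : 0 < X := hX
      have : X ^ (ρ + 1 - 1) = X ^ (ρ - 1) * X := by
        rw [← Real.rpow_add_one hX.ne']; congr 1; ring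
      simp only [this, Bf]; ring
    refine ⟨IntegrableOn.congr_fun ((i1.const_mul μ).add (i2.const_mul α)) hc.symm
      measurableSet_Ioi, ?_⟩
    rw [setIntegral_congr_fun measurableSet_Ioi hc,
      integral_add (i1.const_mul μ) (i2.const_mul α), integral_const_mul, integral_const_mul,
      e1, e2, prod_shift, Real.Gamma_add_one hρ.ne']
    have a1 : ∀ j : ℕ, μ + 1 + α * ρ + (j : ℝ) = μ + α * ρ + 1 + j := fun j => by ring
    have a2 : ∀ j : ℕ, μ + 1 - α + α * (ρ + 1) + (j : ℝ) = μ + α * ρ + 1 + j := fun j => by ring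
    simp only [a1, a2]
    ring

/-- approximants of the Wright function -/
noncomputable def fA (α μ : ℝ) (n : ℕ) (x : ℝ) : ℝ :=
  (((n + 1 : ℕ) : ℝ) ^ μ * (n + 1).factorial)⁻¹ *
    Bf α (n + 2) μ (x * ((n + 1 : ℕ) : ℝ) ^ α)

lemma fA_nonneg (α μ : ℝ) (hα0 : 0 < α) (hα1 : α < 1) (hμ : 0 ≤ μ) (n : ℕ) (x : ℝ) (hx : 0 ≤ x) :
    0 ≤ fA α μ n x := by
  have := Bf_nonneg α hα0 hα1 (n + 2) μ (x * ((n + 1 : ℕ) : ℝ) ^ α) hμ (by positivity)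
  unfold fA; positivity

lemma fA_hasSum (α μ : ℝ) (n : ℕ) (x : ℝ) :
    HasSum (fun l : ℕ => (-x) ^ l / l.factorial * rG (μ - α * l) (n + 1)) (fA α μ n x) := by
  have h := (Bf_hasSum α (n + 2) μ (x * ((n + 1 : ℕ) : ℝ) ^ α)).mul_left
    ((((n + 1 : ℕ) : ℝ) ^ μ * (n + 1).factorial)⁻¹)
  refine hasSum_of_eq h fun l => ?_
  have h1 : (0 : ℝ) < ((n + 1 : ℕ) : ℝ) := by positivity
  rw [rG, Real.rpow_sub h1, Real.rpow_mul h1.le, Real.rpow_natCast, ← neg_mul, mul_pow]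
  have h2 : (0 : ℝ) < ((n + 1 : ℕ) : ℝ) ^ α := by positivity
  have h3 : (0 : ℝ) < ((n + 1 : ℕ) : ℝ) ^ μ := by positivity
  field_simp

lemma fA_integral (α μ ρ : ℝ) (hρ : 0 < ρ) (n : ℕ) :
    IntegrableOn (fun x => x ^ (ρ - 1) * fA α μ n x) (Ioi 0) ∧
    ∫ x in Ioi (0 : ℝ), x ^ (ρ - 1) * fA α μ n x =
      Real.Gamma ρ * rG (μ + α * ρ) (n + 1) := by
  obtain ⟨i, e⟩ := Bf_integral α (n + 2) μ ρ hρ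
  have h1 : (0 : ℝ) < ((n + 1 : ℕ) : ℝ) := by positivity
  set c : ℝ := ((n + 1 : ℕ) : ℝ) ^ α with hc
  have h2 : 0 < c := by positivity
  set k : ℝ := (((n + 1 : ℕ) : ℝ) ^ μ * (n + 1).factorial)⁻¹ with hk
  have hcg : EqOn (fun x => x ^ (ρ - 1) * fA α μ n x)
      (fun x => k * (c ^ (ρ - 1))⁻¹ * ((x * c) ^ (ρ - 1) * Bf α (n + 2) μ (x * c))) (Ioi 0) := by
    intro x hx
    have hx : 0 < x := hx
    have h3 : 0 < c ^ (ρ - 1) := by positivity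
    simp only [fA, ← hc, ← hk]
    rw [Real.mul_rpow hx.le h2.le]
    field_simp
  have i' : IntegrableOn (fun x => (x * c) ^ (ρ - 1) * Bf α (n + 2) μ (x * c)) (Ioi 0) := by
    rw [integrableOn_Ioi_comp_mul_right_iff (fun X => X ^ (ρ - 1) * Bf α (n + 2) μ X) 0 h2,
      zero_mul]
    exact i
  refine ⟨IntegrableOn.congr_fun (i'.const_mul _) hcg.symm measurableSet_Ioi, ?_⟩
  rw [setIntegral_congr_fun measurableSet_Ioi hcg, integral_const_mul,
    integral_comp_mul_right_Ioi (fun X => X ^ (ρ - 1) * Bf α (n + 2) μ X) 0 h2, zero_mul, e,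
    rG, Real.rpow_add h1, Real.rpow_mul h1.le, ← hc, Real.rpow_sub_one h2.ne', hk, smul_eq_mul]
  have h3 : 0 < c ^ ρ := by positivity
  have h4 : (0 : ℝ) < ((n + 1 : ℕ) : ℝ) ^ μ := by positivity
  field_simp

lemma fA_bound (α μ : ℝ) (hα0 : 0 < α) (hα1 : α < 1) (hμ : 0 ≤ μ) (n : ℕ) (x M : ℝ)
    (hx : 0 ≤ x) (hM : x ≤ M) :
    |fA α μ n x| ≤ ∑' l : ℕ, M ^ l / l.factorial * Cb α μ l := by
  rw [← (fA_hasSum α μ n x).tsum_eq, ← Real.norm_eq_abs]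
  refine tsum_of_norm_bounded (Cb_summable α μ M hα0 hα1 (hx.trans hM)).hasSum fun l => ?_
  rw [norm_mul, norm_div, norm_pow, norm_neg, Real.norm_of_nonneg hx, Real.norm_eq_abs,
    Real.norm_eq_abs, abs_of_nonneg (show (0 : ℝ) ≤ (l.factorial : ℝ) by positivity)]
  have := rG_bound α μ hα0 hα1 hμ l n
  have hM0 : 0 ≤ M := hx.trans hM
  gcongr

lemma fA_tendsto (α μ : ℝ) (hα0 : 0 < α) (hα1 : α < 1) (hμ : 0 ≤ μ) (x : ℝ) (hx : 0 ≤ x) :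
    Filter.Tendsto (fun n => fA α μ n x) Filter.atTop (nhds (wright (-α) μ (-x))) := by
  have e : (fun n => fA α μ n x) =
      fun n => ∑' l : ℕ, (-x) ^ l / l.factorial * rG (μ - α * l) (n + 1) := by
    ext n; exact (fA_hasSum α μ n x).tsum_eq.symm
  rw [e, wright]
  refine tendsto_tsum_of_dominated_convergence (Cb_summable α μ x hα0 hα1 hx) ?_ ?_
  · intro l
    have h := ((rG_tendsto (μ - α * l)).comp (Filter.tendsto_add_atTop_nat 1)).const_mul
      ((-x) ^ l / (l.factorial : ℝ))
    rw [show -α * (l : ℝ) + μ = μ - α * l by ring, ← div_div, div_eq_mul_inv _ (Real.Gamma _)]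
    exact h
  · refine Filter.Eventually.of_forall fun n l => ?_
    rw [norm_mul, norm_div, norm_pow, norm_neg, Real.norm_of_nonneg hx, Real.norm_eq_abs,
      Real.norm_eq_abs, abs_of_nonneg (show (0 : ℝ) ≤ (l.factorial : ℝ) by positivity)]
    have := rG_bound α μ hα0 hα1 hμ l n
    gcongr

theorem foxH_is_probability_density (r α : ℝ) (hr : 0 < r) (hα0 : 0 < α) (hα1 : α < 1) :
    (∀ x : ℝ, 0 < x → 0 ≤ x ^ (r - 1) * wright (-α) (r * (1 - α)) (-x)) ∧
    ∫ x in Ioi (0 : ℝ), x ^ (r - 1) * wright (-α) (r * (1 - α)) (-x) = 1 := by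
  set μ := r * (1 - α) with hμd
  have hμ : 0 ≤ μ := mul_nonneg hr.le (by linarith)
  have hnn : ∀ x : ℝ, 0 < x → 0 ≤ x ^ (r - 1) * wright (-α) μ (-x) := by
    intro x hx
    refine mul_nonneg (by positivity) ?_
    exact ge_of_tendsto' (fA_tendsto α μ hα0 hα1 hμ x hx.le)
      fun n => fA_nonneg α μ hα0 hα1 hμ n x hx.le
  refine ⟨hnn, ?_⟩
  set g : ℝ → ℝ := fun x => x ^ (r - 1) * wright (-α) μ (-x) with hg
  set G : ℕ → ℝ → ℝ := fun n x => x ^ (r - 1) * fA α μ n x with hG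
  have hGi : ∀ n, IntegrableOn (G n) (Ioi 0) := fun n => (fA_integral α μ r hr n).1
  have hGnn : ∀ n x, 0 < x → 0 ≤ G n x := fun n x hx =>
    mul_nonneg (by positivity) (fA_nonneg α μ hα0 hα1 hμ n x hx.le)
  -- total masses of the approximants converge to one
  have hmass : Filter.Tendsto (fun n => ∫ x in Ioi (0 : ℝ), G n x) Filter.atTop (nhds 1) := by
    have h := ((rG_tendsto (μ + α * r)).comp (Filter.tendsto_add_atTop_nat 1)).const_mul
      (Real.Gamma r)
    have e : μ + α * r = r := by rw [hμd]; ring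
    rw [e, mul_inv_cancel₀ (Real.Gamma_pos_of_pos hr).ne'] at h
    refine h.congr fun n => ?_
    rw [hG, (fA_integral α μ r hr n).2, e]; rfl
  -- uniform first moment bound
  obtain ⟨K, hK0, hK⟩ : ∃ K : ℝ, 0 ≤ K ∧
      ∀ n, ∫ x in Ioi (0 : ℝ), x ^ (r + 1 - 1) * fA α μ n x ≤ K := by
    have hw : 0 ≤ μ + α * (r + 1) := by positivity
    have hΓ := Real.Gamma_pos_of_pos (show 0 < r + 1 by linarith)
    refine ⟨Real.Gamma (r + 1) * ((μ + α * (r + 1)) * Real.exp (μ + α * (r + 1))),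
      by positivity, fun n => ?_⟩
    rw [(fA_integral α μ (r + 1) (by linarith) n).2]
    have := (le_abs_self _).trans (rG_pos_bound _ hw n)
    gcongr
  have hptw : ∀ x, 0 < x → Filter.Tendsto (fun n => G n x) Filter.atTop (nhds (g x)) :=
    fun x hx => (fA_tendsto α μ hα0 hα1 hμ x hx.le).const_mul _
  have hsub : ∀ M : ℝ, Ioc 0 M ⊆ Ioi (0 : ℝ) := fun M x hx => hx.1
  have hae : ∀ M : ℝ, ∀ᵐ x ∂(volume.restrict (Ioc 0 M)),
      Filter.Tendsto (fun n => G n x) Filter.atTop (nhds (g x)) := fun M =>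
    (ae_restrict_iff' measurableSet_Ioc).mpr (Filter.Eventually.of_forall fun x hx => hptw x hx.1)
  set S : ℝ → ℝ := fun M => ∑' l : ℕ, M ^ l / l.factorial * Cb α μ l with hS
  have hbi : ∀ M : ℝ, IntegrableOn (fun x : ℝ => x ^ (r - 1) * S M) (Ioc 0 M) := fun M => by
    have := (intervalIntegral.intervalIntegrable_rpow' (a := 0) (b := M)
      (show -1 < r - 1 by linarith)).1
    exact this.mul_const _
  have hGb : ∀ M n, ∀ᵐ x ∂(volume.restrict (Ioc 0 M)), ‖G n x‖ ≤ x ^ (r - 1) * S M := fun M n =>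
    (ae_restrict_iff' measurableSet_Ioc).mpr (Filter.Eventually.of_forall fun x hx => by
      have hx0 : 0 < x := hx.1
      have := fA_bound α μ hα0 hα1 hμ n x M hx0.le hx.2
      rw [hG, norm_mul, Real.norm_of_nonneg (by positivity), Real.norm_eq_abs]
      gcongr)
  have hGm : ∀ M n, AEStronglyMeasurable (G n) (volume.restrict (Ioc 0 M)) := fun M n =>
    ((hGi n).mono_set (hsub M)).aestronglyMeasurable
  have hlim : ∀ M : ℝ, Filter.Tendsto (fun n => ∫ x in Ioc 0 M, G n x) Filter.atTop
      (nhds (∫ x in Ioc 0 M, g x)) := fun M =>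
    tendsto_integral_of_dominated_convergence _ (hGm M) (hbi M) (hGb M) (hae M)
  have hgi : ∀ M : ℝ, IntegrableOn g (Ioc 0 M) := fun M => by
    refine (hbi M).mono' (aestronglyMeasurable_of_tendsto_ae _ (hGm M) (hae M)) ?_
    have hall : ∀ᵐ x ∂(volume.restrict (Ioc 0 M)), ∀ n, ‖G n x‖ ≤ x ^ (r - 1) * S M :=
      ae_all_iff.mpr (hGb M)
    filter_upwards [hall, hae M] with x h1 h2
    exact le_of_tendsto' h2.norm h1
  have hle : ∀ M : ℝ, ∫ x in Ioc 0 M, g x ≤ 1 := fun M =>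
    le_of_tendsto_of_tendsto' (hlim M) hmass fun n =>
      setIntegral_mono_set (hGi n)
        ((ae_restrict_iff' measurableSet_Ioi).mpr
          (Filter.Eventually.of_forall fun x hx => hGnn n x hx))
        (hsub M).eventuallyLE
  have hge : ∀ M : ℝ, 0 < M → 1 - K / M ≤ ∫ x in Ioc 0 M, g x := fun M hM => by
    refine le_of_tendsto_of_tendsto' (hmass.sub_const (K / M)) (hlim M) fun n => ?_
    have hsplit : ∫ x in Ioi (0 : ℝ), G n x =
        (∫ x in Ioc 0 M, G n x) + ∫ x in Ioi M, G n x := by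
      rw [← setIntegral_union (Ioc_disjoint_Ioi le_rfl) measurableSet_Ioi
        ((hGi n).mono_set (hsub M)) ((hGi n).mono_set (Ioi_subset_Ioi hM.le)),
        Ioc_union_Ioi_eq_Ioi hM.le]
    have i1 := (fA_integral α μ (r + 1) (by linarith) n).1
    have htail : ∫ x in Ioi M, G n x ≤ K / M := by
      calc ∫ x in Ioi M, G n x ≤ ∫ x in Ioi M, M⁻¹ * (x ^ (r + 1 - 1) * fA α μ n x) := by
            refine setIntegral_mono_on ((hGi n).mono_set (Ioi_subset_Ioi hM.le))
              ((i1.mono_set (Ioi_subset_Ioi hM.le)).const_mul _) measurableSet_Ioi ?_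
            intro x hx
            have hx : M < x := hx
            have hx0 : 0 < x := hM.trans hx
            have e : x ^ (r + 1 - 1) = x ^ (r - 1) * x := by
              rw [← Real.rpow_add_one hx0.ne']; congr 1; ring
            have h0 := hGnn n x hx0
            have h1 : 1 ≤ M⁻¹ * x := by
              rw [inv_mul_eq_div, le_div_iff₀ hM]; linarith
            calc G n x = 1 * G n x := (one_mul _).symm
              _ ≤ (M⁻¹ * x) * G n x := by gcongr
              _ = _ := by rw [e]; simp only [hG]; ring
        _ = M⁻¹ * ∫ x in Ioi M, x ^ (r + 1 - 1) * fA α μ n x := integral_const_mul _ _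
        _ ≤ M⁻¹ * ∫ x in Ioi 0, x ^ (r + 1 - 1) * fA α μ n x := by
            refine mul_le_mul_of_nonneg_left ?_ (inv_nonneg.mpr hM.le)
            refine setIntegral_mono_set i1 ((ae_restrict_iff' measurableSet_Ioi).mpr
              (Filter.Eventually.of_forall fun x hx => ?_)) (Ioi_subset_Ioi hM.le).eventuallyLE
            have hx : 0 < x := hx
            exact mul_nonneg (by positivity) (fA_nonneg α μ hα0 hα1 hμ n x hx.le)
        _ ≤ M⁻¹ * K := by gcongr; exact hK n
        _ = K / M := by ring
    linarith
  have hgI : IntegrableOn g (Ioi 0) := by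
    refine integrableOn_Ioi_of_intervalIntegral_norm_bounded (b := fun M : ℝ => M)
      (l := Filter.atTop) 1 0 hgi Filter.tendsto_id ?_
    filter_upwards [Filter.eventually_ge_atTop (0 : ℝ)] with M hM
    rw [intervalIntegral.integral_of_le hM]
    refine le_trans (le_of_eq ?_) (hle M)
    exact setIntegral_congr_fun measurableSet_Ioc fun x hx => Real.norm_of_nonneg (hnn x hx.1)
  have hT := intervalIntegral_tendsto_integral_Ioi (b := fun M : ℝ => M)
      (l := Filter.atTop) 0 hgI Filter.tendsto_id
  refine tendsto_nhds_unique hT ?_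
  have hlow : Filter.Tendsto (fun M : ℝ => 1 - K / M) Filter.atTop (nhds 1) := by
    simpa using (tendsto_const_nhds (x := (1 : ℝ))).sub
      (Filter.Tendsto.const_div_atTop (g := fun M : ℝ => M) Filter.tendsto_id K)
  refine tendsto_of_tendsto_of_tendsto_of_le_of_le' hlow tendsto_const_nhds ?_ ?_
  · filter_upwards [Filter.eventually_gt_atTop (0 : ℝ)] with M hM
    rw [intervalIntegral.integral_of_le hM.le]
    exact hge M hM
  · filter_upwards [Filter.eventually_gt_atTop (0 : ℝ)] with M hM
    rw [intervalIntegral.integral_of_le hM.le]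
    exact hle M
end

section
/- Fix r > 0 and 0 < α < 1. The Laplace transform of the Wright function t ↦ W_{-α, r(1-α)}(-t) is the generalized Mittag-Leffler function: ∫₀^∞ e^(-st) W_{-α,r(1-α)}(-t) dt = E_{α, r(1-α)+α}(-s) for s > 0. -/
open MeasureTheory Set

/-- The two-parameter Mittag-Leffler function `E_{α,β}`. -/
noncomputable def mittagLeffler2 (a b z : ℝ) : ℝ :=
  ∑' n : ℕ, z ^ n / Real.Gamma (a * n + b)

/-- Direction of the ray. -/
noncomputable def wrDir (θ : ℝ) : ℂ := ⟨Real.cos θ, Real.sin θ⟩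

/-- The contour `a + x e^{iθ}`. -/
noncomputable def wrU (θ a x : ℝ) : ℂ := (a : ℂ) + (x : ℂ) * wrDir θ

/-- The Hankel integrand. -/
noncomputable def wrH (θ a z x : ℝ) : ℂ :=
  Complex.exp (wrU θ a x) * (wrU θ a x) ^ ((-z : ℝ) : ℂ) * wrDir θ

lemma wrDir_eq (θ : ℝ) : wrDir θ = Complex.exp (θ * Complex.I) := by
  apply Complex.ext <;> simp [wrDir, Complex.exp_ofReal_mul_I_re, Complex.exp_ofReal_mul_I_im]

lemma wrDir_norm (θ : ℝ) : ‖wrDir θ‖ = 1 := by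
  rw [wrDir_eq]; exact Complex.norm_exp_ofReal_mul_I θ

lemma wrU_re (θ a x : ℝ) : (wrU θ a x).re = a + x * Real.cos θ := by
  simp [wrU, wrDir]

lemma wrU_im (θ a x : ℝ) : (wrU θ a x).im = x * Real.sin θ := by
  simp [wrU, wrDir]

lemma wrU_norm_ge_a (θ a x : ℝ) : a * Real.sin θ ≤ ‖wrU θ a x‖ := by
  have h1 := Complex.abs_im_le_norm (wrU θ a x * (starRingEnd ℂ) (wrDir θ))
  rw [norm_mul, RCLike.norm_conj, wrDir_norm, mul_one] at h1
  have h2 : (wrU θ a x * (starRingEnd ℂ) (wrDir θ)).im = -(a * Real.sin θ) := by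
    rw [Complex.mul_im, wrU_re, wrU_im]
    simp [wrDir]; ring
  rw [h2, abs_neg] at h1
  exact (le_abs_self _).trans h1

lemma wrU_norm_ge_x (θ a x : ℝ) : x * Real.sin θ ≤ ‖wrU θ a x‖ := by
  have h1 := Complex.abs_im_le_norm (wrU θ a x)
  rw [wrU_im] at h1
  exact (le_abs_self _).trans h1

lemma wrU_norm_le (θ a x : ℝ) (ha : 0 ≤ a) (hx : 0 ≤ x) : ‖wrU θ a x‖ ≤ a + x := by
  refine (norm_add_le _ _).trans ?_
  rw [norm_mul, wrDir_norm, Complex.norm_real, Complex.norm_real, Real.norm_of_nonneg ha,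
    Real.norm_of_nonneg hx, mul_one]

lemma wrU_exp_norm (θ a x : ℝ) :
    ‖Complex.exp (wrU θ a x)‖ = Real.exp a * Real.exp (Real.cos θ * x) := by
  rw [Complex.norm_exp, wrU_re, ← Real.exp_add, mul_comm x]

lemma wrU_slit (θ a x : ℝ) (hσ : 0 < Real.sin θ) (_ha : 0 ≤ a) (hx : 0 ≤ x) (h : 0 < a ∨ 0 < x) :
    wrU θ a x ∈ Complex.slitPlane := by
  rw [Complex.mem_slitPlane_iff, wrU_re, wrU_im]
  rcases hx.eq_or_lt with rfl | hx
  · left; rcases h with h | h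
    · simpa using h
    · exact absurd h (lt_irrefl _)
  · right; positivity

lemma wrH_norm (θ a z x : ℝ) :
    ‖wrH θ a z x‖ = Real.exp a * Real.exp (Real.cos θ * x) * ‖wrU θ a x‖ ^ (-z) := by
  rw [wrH, norm_mul, norm_mul, wrDir_norm, mul_one, wrU_exp_norm, Complex.norm_cpow_real]

lemma wrU_cont (θ a : ℝ) : Continuous (wrU θ a) := by
  unfold wrU; fun_prop

lemma wrU_cont' (θ x : ℝ) : Continuous (fun a => wrU θ a x) := by
  unfold wrU; fun_prop

lemma wrU_cpow_cont (θ a : ℝ) (w : ℂ) (hσ : 0 < Real.sin θ) (ha : 0 < a) :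
    ContinuousOn (fun x => (wrU θ a x) ^ w) (Ici 0) :=
  (wrU_cont θ a).continuousOn.cpow_const fun x hx => wrU_slit θ a x hσ ha.le hx (Or.inl ha)

lemma wrH_cont (θ a z : ℝ) (hσ : 0 < Real.sin θ) (ha : 0 < a) :
    ContinuousOn (wrH θ a z) (Ici 0) := by
  unfold wrH
  exact ((Complex.continuous_exp.comp (wrU_cont θ a)).continuousOn.mul
    (wrU_cpow_cont θ a _ hσ ha)).mul continuousOn_const

lemma wrU_rpow_bigO (θ a w ε : ℝ) (hσ : 0 < Real.sin θ) (ha : 0 < a) (hε : 0 < ε) :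
    (fun x => ‖wrU θ a x‖ ^ w) =O[Filter.atTop] fun x => Real.exp (ε * x) := by
  rcases le_total 0 w with hw | hw
  · have h1 : (fun x => ‖wrU θ a x‖ ^ w) =O[Filter.atTop] fun x : ℝ => x ^ w := by
      refine Asymptotics.IsBigO.of_bound (2 ^ w) ?_
      filter_upwards [Filter.eventually_ge_atTop a] with x hx
      have hx0 : 0 ≤ x := ha.le.trans hx
      rw [Real.norm_of_nonneg (by positivity), Real.norm_of_nonneg (by positivity),
        ← Real.mul_rpow (by norm_num) hx0]
      refine Real.rpow_le_rpow (norm_nonneg _) ?_ hw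
      linarith [wrU_norm_le θ a x ha.le hx0]
    exact h1.trans (isLittleO_rpow_exp_pos_mul_atTop w hε).isBigO
  · refine Asymptotics.IsBigO.of_bound ((a * Real.sin θ) ^ w) ?_
    filter_upwards [Filter.eventually_ge_atTop 0] with x hx
    rw [Real.norm_of_nonneg (by positivity), Real.norm_of_nonneg (by positivity)]
    have h1 : ‖wrU θ a x‖ ^ w ≤ (a * Real.sin θ) ^ w :=
      Real.rpow_le_rpow_of_nonpos (by positivity) (wrU_norm_ge_a θ a x) hw
    have h2 : 1 ≤ Real.exp (ε * x) := Real.one_le_exp (by positivity)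
    have h3 : 0 ≤ (a * Real.sin θ) ^ w := by positivity
    nlinarith

lemma wrH_bigO (θ a z : ℝ) (hσ : 0 < Real.sin θ) (hc : Real.cos θ < 0) (ha : 0 < a) :
    (wrH θ a z) =O[Filter.atTop] fun x => Real.exp (-(-Real.cos θ / 2) * x) := by
  have h1 := (Asymptotics.isBigO_refl (fun x => Real.exp a * Real.exp (Real.cos θ * x))
    Filter.atTop).mul (wrU_rpow_bigO θ a (-z) (-Real.cos θ / 2) hσ ha (by linarith))
  have h2 : (wrH θ a z) =O[Filter.atTop] fun x =>
      Real.exp a * Real.exp (Real.cos θ * x) * Real.exp (-Real.cos θ / 2 * x) := by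
    rw [← Asymptotics.isBigO_norm_left]
    simp_rw [wrH_norm]
    exact h1
  refine h2.trans ?_
  refine Asymptotics.IsBigO.of_bound (Real.exp a) (Filter.Eventually.of_forall fun x => ?_)
  rw [Real.norm_of_nonneg (by positivity), Real.norm_of_nonneg (by positivity), mul_assoc,
    ← Real.exp_add]
  apply le_of_eq; congr 2; ring

lemma wrH_int (θ a z : ℝ) (hσ : 0 < Real.sin θ) (hc : Real.cos θ < 0) (ha : 0 < a) :
    IntegrableOn (wrH θ a z) (Ioi 0) := by
  have h := integrable_of_isBigO_exp_neg (f := fun x => ‖wrH θ a z x‖) (a := 0)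
    (b := -Real.cos θ / 2) (by linarith) (wrH_cont θ a z hσ ha).norm
    (wrH_bigO θ a z hσ hc ha).norm_left
  refine (integrable_norm_iff ?_).1 h
  exact ((wrH_cont θ a z hσ ha).mono Ioi_subset_Ici_self).aestronglyMeasurable measurableSet_Ioi

lemma wrH_tendsto (θ a z : ℝ) (hσ : 0 < Real.sin θ) (hc : Real.cos θ < 0) (ha : 0 < a) :
    Filter.Tendsto (wrH θ a z) Filter.atTop (nhds 0) := by
  refine (wrH_bigO θ a z hσ hc ha).trans_tendsto ?_
  refine Real.tendsto_exp_atBot.comp ?_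
  exact Filter.tendsto_id.const_mul_atTop_of_neg (by linarith)

/-- derivative of the integrand along the contour -/
lemma wrH_deriv_x (θ a z x : ℝ) (hU : wrU θ a x ∈ Complex.slitPlane) :
    HasDerivAt (wrH θ a z) ((wrH θ a z x - z * wrH θ a (z + 1) x) * wrDir θ) x := by
  have h0 : HasDerivAt (wrU θ a) (wrDir θ) x := by
    unfold wrU
    simpa using ((Complex.ofRealCLM.hasDerivAt (x := x)).mul_const (wrDir θ)).const_add (a : ℂ)
  have h1 : HasDerivAt (fun y => (wrU θ a y) ^ ((-z : ℝ) : ℂ)) _ x :=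
    (Complex.hasStrictDerivAt_cpow_const (c := ((-z : ℝ) : ℂ)) hU).hasDerivAt.comp x h0
  have h := ((h0.cexp).mul h1).mul_const (wrDir θ)
  refine h.congr_deriv ?_
  simp only [wrH]
  rw [show ((-(z + 1) : ℝ) : ℂ) = ((-z : ℝ) : ℂ) - 1 by push_cast; ring]
  push_cast; ring

lemma wrH_deriv_a (θ a z x : ℝ) (hU : wrU θ a x ∈ Complex.slitPlane) :
    HasDerivAt (fun b => wrH θ b z x) (wrH θ a z x - z * wrH θ a (z + 1) x) a := by
  have h0 : HasDerivAt (fun b => wrU θ b x) 1 a := by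
    unfold wrU
    simpa using (Complex.ofRealCLM.hasDerivAt (x := a)).add_const ((x : ℂ) * wrDir θ)
  have h1 : HasDerivAt (fun y => (wrU θ y x) ^ ((-z : ℝ) : ℂ)) _ a :=
    HasDerivAt.comp (h₂ := fun u : ℂ => u ^ ((-z : ℝ) : ℂ)) a
      (Complex.hasStrictDerivAt_cpow_const (c := ((-z : ℝ) : ℂ)) hU).hasDerivAt h0
  have h := ((h0.cexp).mul h1).mul_const (wrDir θ)
  refine h.congr_deriv ?_
  simp only [wrH]
  rw [show ((-(z + 1) : ℝ) : ℂ) = ((-z : ℝ) : ℂ) - 1 by push_cast; ring]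
  push_cast; ring

lemma wrDir_ne (θ : ℝ) : wrDir θ ≠ 0 := by
  rw [wrDir_eq]; exact Complex.exp_ne_zero _

/-- The total derivative integrates to a real number. -/
lemma wrH_ibp (θ a z : ℝ) (hσ : 0 < Real.sin θ) (hc : Real.cos θ < 0) (ha : 0 < a) :
    (∫ x in Ioi (0 : ℝ), (wrH θ a z x - z * wrH θ a (z + 1) x)).im = 0 := by
  have hi : IntegrableOn (fun x => (wrH θ a z x - z * wrH θ a (z + 1) x)) (Ioi 0) :=
    (wrH_int θ a z hσ hc ha).sub ((wrH_int θ a (z + 1) hσ hc ha).const_mul _)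
  have h := integral_Ioi_of_hasDerivAt_of_tendsto' (a := 0)
    (fun x hx => wrH_deriv_x θ a z x (wrU_slit θ a x hσ ha.le hx (Or.inl ha)))
    (hi.mul_const _) (wrH_tendsto θ a z hσ hc ha)
  rw [integral_mul_const] at h
  have h2 : wrH θ a z 0 = ((Real.exp a * a ^ (-z) : ℝ) : ℂ) * wrDir θ := by
    simp only [wrH, wrU]
    rw [Complex.ofReal_mul, Complex.ofReal_cpow ha.le]
    simp
  rw [h2, zero_sub, ← neg_mul] at h
  have h3 := mul_right_cancel₀ (wrDir_ne θ) h
  rw [h3, ← Complex.ofReal_neg, Complex.ofReal_im]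

lemma wrH_rec (θ a z : ℝ) (hσ : 0 < Real.sin θ) (hc : Real.cos θ < 0) (ha : 0 < a) :
    (∫ x in Ioi (0 : ℝ), wrH θ a z x).im = z * (∫ x in Ioi (0 : ℝ), wrH θ a (z + 1) x).im := by
  have h := wrH_ibp θ a z hσ hc ha
  rw [integral_sub (wrH_int θ a z hσ hc ha) ((wrH_int θ a (z + 1) hσ hc ha).const_mul _),
    integral_const_mul, Complex.sub_im, Complex.im_ofReal_mul] at h
  linarith

/-- Integrand of the rotated Gamma integral. -/
noncomputable def wrG (w θ x : ℝ) : ℂ :=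
  ((x ^ (w - 1) : ℝ) : ℂ) * Complex.exp (x * wrDir θ + w * θ * Complex.I)

lemma wrG_exp_norm (w θ x : ℝ) :
    ‖Complex.exp (x * wrDir θ + w * θ * Complex.I)‖ = Real.exp (Real.cos θ * x) := by
  rw [Complex.norm_exp]
  congr 1
  simp [wrDir, mul_comm]

lemma wrG_norm (w θ x : ℝ) (hx : 0 < x) :
    ‖wrG w θ x‖ = x ^ (w - 1) * Real.exp (Real.cos θ * x) := by
  rw [wrG, norm_mul, wrG_exp_norm, Complex.norm_real, Real.norm_of_nonneg (by positivity)]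

lemma wrG_meas (w θ : ℝ) : Measurable (wrG w θ) := by
  unfold wrG; fun_prop

lemma wr_rpow_exp_int (s c : ℝ) (hs : -1 < s) (hc : c < 0) :
    IntegrableOn (fun x : ℝ => x ^ s * Real.exp (c * x)) (Ioi 0) := by
  have := integrableOn_rpow_mul_exp_neg_mul_rpow hs one_pos (neg_pos.2 hc)
  simpa using this

lemma wrG_int (w θ : ℝ) (hw : 0 < w) (hc : Real.cos θ < 0) : IntegrableOn (wrG w θ) (Ioi 0) := by
  refine (wr_rpow_exp_int (w - 1) (Real.cos θ) (by linarith) hc).mono'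
    (wrG_meas w θ).aestronglyMeasurable ?_
  exact (ae_restrict_mem measurableSet_Ioi).mono fun x hx => (wrG_norm w θ x hx).le

lemma wrG_deriv_θ (w θ x : ℝ) :
    HasDerivAt (fun t => wrG w t x) (Complex.I * (wrG w θ x * (x * wrDir θ + w))) θ := by
  have h0 : HasDerivAt (fun t : ℝ => (t : ℂ)) 1 θ := Complex.ofRealCLM.hasDerivAt
  have h1 : HasDerivAt wrDir (wrDir θ * Complex.I) θ := by
    have : wrDir = fun t : ℝ => Complex.exp (t * Complex.I) := funext wrDir_eq
    rw [this]
    simpa using (h0.mul_const Complex.I).cexp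
  have h2 := (((h1.const_mul (x : ℂ)).add ((h0.const_mul (w : ℂ)).mul_const Complex.I)).cexp).const_mul
    ((x ^ (w - 1) : ℝ) : ℂ)
  refine h2.congr_deriv ?_
  simp only [wrG, Pi.add_apply]
  ring

lemma wrG_deriv_x (w θ x : ℝ) (hx : 0 < x) :
    HasDerivAt (fun y : ℝ => ((y ^ w : ℝ) : ℂ) * Complex.exp (y * wrDir θ + w * θ * Complex.I))
      (wrG w θ x * (x * wrDir θ + w)) x := by
  have h0 : HasDerivAt (fun t : ℝ => (t : ℂ)) 1 x := Complex.ofRealCLM.hasDerivAt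
  have h1 := (Real.hasDerivAt_rpow_const (x := x) (p := w) (Or.inl hx.ne')).ofReal_comp
  have h2 := h1.mul ((h0.mul_const (wrDir θ)).add_const (w * θ * Complex.I)).cexp
  refine h2.congr_deriv ?_
  have e : x ^ w = x ^ (w - 1) * x := by
    rw [Real.rpow_sub_one hx.ne']; field_simp
  rw [e]
  simp only [wrG]
  push_cast
  ring

lemma wrG_bound (w θ x : ℝ) (hw : 0 < w) (hx : 0 < x) :
    ‖wrG w θ x * (x * wrDir θ + w)‖ ≤
      x ^ w * Real.exp (Real.cos θ * x) + w * (x ^ (w - 1) * Real.exp (Real.cos θ * x)) := by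
  have e : x ^ w = x ^ (w - 1) * x := by
    rw [Real.rpow_sub_one hx.ne']; field_simp
  have h1 : ‖(x : ℂ) * wrDir θ + w‖ ≤ x + w := by
    refine (norm_add_le _ _).trans ?_
    rw [norm_mul, wrDir_norm, Complex.norm_real, Complex.norm_real, Real.norm_of_nonneg hx.le,
      Real.norm_of_nonneg hw.le, mul_one]
  rw [norm_mul, wrG_norm w θ x hx, e]
  calc _ ≤ x ^ (w - 1) * Real.exp (Real.cos θ * x) * (x + w) := by gcongr
    _ = _ := by ring

lemma wrG_bound_int (w c : ℝ) (hw : 0 < w) (hc : c < 0) : IntegrableOn (fun x : ℝ =>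
    x ^ w * Real.exp (c * x) + w * (x ^ (w - 1) * Real.exp (c * x))) (Ioi 0) :=
  (wr_rpow_exp_int w c (by linarith) hc).add
    ((wr_rpow_exp_int (w - 1) c (by linarith) hc).const_mul w)

lemma wrG_deriv_zero (w θ : ℝ) (hw : 0 < w) (hc : Real.cos θ < 0) :
    ∫ x in Ioi (0 : ℝ), wrG w θ x * (x * wrDir θ + w) = 0 := by
  have h := integral_Ioi_of_hasDerivAt_of_tendsto (a := 0) (m := 0)
    (f := fun y : ℝ => ((y ^ w : ℝ) : ℂ) * Complex.exp (y * wrDir θ + w * θ * Complex.I))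
    (f' := fun x => wrG w θ x * (x * wrDir θ + w)) ?_ (fun x hx => wrG_deriv_x w θ x hx) ?_ ?_
  · rw [h]; simp [Real.zero_rpow hw.ne']
  · have h1 : Continuous fun y : ℝ => y ^ w := Real.continuous_rpow_const hw.le
    have : Continuous fun y : ℝ => ((y ^ w : ℝ) : ℂ) *
      Complex.exp (y * wrDir θ + w * θ * Complex.I) := by fun_prop
    exact this.continuousWithinAt
  · refine (wrG_bound_int w (Real.cos θ) hw hc).mono' ?_ ?_
    · have := wrG_meas w θ
      exact (show Measurable fun x : ℝ => wrG w θ x * (x * wrDir θ + w) by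
        fun_prop).aestronglyMeasurable
    · exact (ae_restrict_mem measurableSet_Ioi).mono fun x hx => wrG_bound w θ x hw hx
  · rw [tendsto_zero_iff_norm_tendsto_zero]
    have h1 := tendsto_rpow_mul_exp_neg_mul_atTop_nhds_zero w (-Real.cos θ) (by linarith)
    refine h1.congr' ?_
    filter_upwards [Filter.eventually_gt_atTop 0] with x hx
    rw [norm_mul, wrG_exp_norm, Complex.norm_real, Real.norm_of_nonneg (by positivity), neg_neg]

lemma wrG_deriv_int (w θ : ℝ) (hw : 0 < w) (hc : Real.cos θ < 0) :
    HasDerivAt (fun t => ∫ x in Ioi (0 : ℝ), wrG w t x) 0 θ := by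
  have hs : {t : ℝ | Real.cos t < Real.cos θ / 2} ∈ nhds θ :=
    (isOpen_lt Real.continuous_cos continuous_const).mem_nhds
      (show Real.cos θ < Real.cos θ / 2 by linarith)
  have key := hasDerivAt_integral_of_dominated_loc_of_deriv_le (μ := volume.restrict (Ioi (0 : ℝ)))
    (F := fun t x => wrG w t x) (F' := fun t x => Complex.I * (wrG w t x * (x * wrDir t + w)))
    (bound := fun x : ℝ => x ^ w * Real.exp (Real.cos θ / 2 * x)
      + w * (x ^ (w - 1) * Real.exp (Real.cos θ / 2 * x)))
    (x₀ := θ) hs ?_ (wrG_int w θ hw hc) ?_ ?_ (wrG_bound_int w _ hw (by linarith)) ?_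
  · refine key.2.congr_deriv ?_
    rw [integral_const_mul, wrG_deriv_zero w θ hw hc, mul_zero]
  · exact Filter.Eventually.of_forall fun t => (wrG_meas w t).aestronglyMeasurable
  · have := wrG_meas w θ
    exact (show Measurable fun x : ℝ => Complex.I * (wrG w θ x * (x * wrDir θ + w)) by
        fun_prop).aestronglyMeasurable
  · refine (ae_restrict_mem measurableSet_Ioi).mono fun x hx t ht => ?_
    have hx0 : 0 < x := hx
    have ht' : Real.cos t ≤ Real.cos θ / 2 := le_of_lt ht
    rw [norm_mul, Complex.norm_I, one_mul]
    refine (wrG_bound w t x hw hx).trans ?_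
    gcongr
  · exact Filter.Eventually.of_forall fun x t _ => wrG_deriv_θ w t x

lemma wrG_val (w θ : ℝ) (hw : 0 < w) (hθ1 : Real.pi / 2 < θ) (hθ2 : θ < Real.pi) :
    ∫ x in Ioi (0 : ℝ), wrG w θ x
      = Complex.exp ((Real.pi * w : ℝ) * Complex.I) * Real.Gamma w := by
  have hπ := Real.pi_pos
  have hneg : ∀ t ∈ Ioo (Real.pi / 2) (Real.pi + Real.pi / 2), Real.cos t < 0 := fun t ht =>
    Real.cos_neg_of_pi_div_two_lt_of_lt ht.1 ht.2
  have h := isOpen_Ioo.is_const_of_deriv_eq_zero (s := Ioo (Real.pi / 2) (Real.pi + Real.pi / 2))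
    (f := fun t => ∫ x in Ioi (0 : ℝ), wrG w t x) isPreconnected_Ioo
    (fun y hy => (wrG_deriv_int w y hw (hneg y hy)).differentiableAt.differentiableWithinAt)
    (fun y hy => (wrG_deriv_int w y hw (hneg y hy)).deriv)
    (x := θ) (y := Real.pi) ⟨hθ1, by linarith⟩ ⟨by linarith, by linarith⟩
  rw [h]
  have e : ∀ x ∈ Ioi (0 : ℝ), wrG w Real.pi x = Complex.exp ((Real.pi * w : ℝ) * Complex.I) *
      ((Real.exp (-x) * x ^ (w - 1) : ℝ) : ℂ) := by
    intro x hx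
    rw [wrG, Complex.exp_add, show wrDir Real.pi = -1 by
      apply Complex.ext <;> simp [wrDir]]
    push_cast
    rw [mul_neg, mul_one, mul_comm (w : ℂ)]
    ring
  rw [setIntegral_congr_fun measurableSet_Ioi e, integral_const_mul, integral_complex_ofReal,
    Real.Gamma_eq_integral hw]

lemma wrH_deriv_int (θ a z : ℝ) (hσ : 0 < Real.sin θ) (hc : Real.cos θ < 0) (hz : 0 < z)
    (ha : 0 < a) :
    HasDerivAt (fun b => (∫ x in Ioi (0 : ℝ), wrH θ b z x).im) 0 a := by
  have hm : 0 < a / 2 * Real.sin θ := by positivity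
  have key := hasDerivAt_integral_of_dominated_loc_of_deriv_le (μ := volume.restrict (Ioi (0 : ℝ)))
    (F := fun b x => wrH θ b z x) (F' := fun b x => wrH θ b z x - z * wrH θ b (z + 1) x)
    (x₀ := a) (s := Ioo (a / 2) (2 * a))
    (bound := fun x => (Real.exp (2 * a) * ((a / 2 * Real.sin θ) ^ (-z)
      + z * (a / 2 * Real.sin θ) ^ (-(z + 1)))) * Real.exp (Real.cos θ * x))
    (Ioo_mem_nhds (by linarith) (by linarith)) ?_ (wrH_int θ a z hσ hc ha) ?_ ?_ ?_ ?_
  · have h2 := Complex.imCLM.hasFDerivAt.comp_hasDerivAt a key.2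
    refine (h2.congr_deriv ?_)
    exact wrH_ibp θ a z hσ hc ha
  · filter_upwards [lt_mem_nhds ha] with b hb
    exact (wrH_int θ b z hσ hc hb).aestronglyMeasurable
  · exact ((wrH_int θ a z hσ hc ha).sub
      ((wrH_int θ a (z + 1) hσ hc ha).const_mul _)).aestronglyMeasurable
  · refine (ae_restrict_mem measurableSet_Ioi).mono fun x hx b hb => ?_
    have hx0 : 0 < x := hx
    have hb0 : 0 < b := lt_trans (by positivity) hb.1
    have hU : a / 2 * Real.sin θ ≤ ‖wrU θ b x‖ :=
      le_trans (by have := hb.1; gcongr) (wrU_norm_ge_a θ b x)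
    have e1 : ‖wrU θ b x‖ ^ (-z) ≤ (a / 2 * Real.sin θ) ^ (-z) :=
      Real.rpow_le_rpow_of_nonpos hm hU (by linarith)
    have e2 : ‖wrU θ b x‖ ^ (-(z + 1)) ≤ (a / 2 * Real.sin θ) ^ (-(z + 1)) :=
      Real.rpow_le_rpow_of_nonpos hm hU (by linarith)
    have e3 : Real.exp b ≤ Real.exp (2 * a) := Real.exp_le_exp.2 hb.2.le
    calc ‖wrH θ b z x - z * wrH θ b (z + 1) x‖
        ≤ ‖wrH θ b z x‖ + z * ‖wrH θ b (z + 1) x‖ := by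
          refine (norm_sub_le _ _).trans ?_
          rw [norm_mul, Complex.norm_real, Real.norm_of_nonneg hz.le]
      _ = Real.exp b * (‖wrU θ b x‖ ^ (-z) + z * ‖wrU θ b x‖ ^ (-(z + 1)))
            * Real.exp (Real.cos θ * x) := by
          rw [wrH_norm, wrH_norm]; ring
      _ ≤ _ := by gcongr
  · exact (integrableOn_exp_mul_Ioi hc 0).const_mul _
  · refine (ae_restrict_mem measurableSet_Ioi).mono fun x hx b hb => ?_
    have hb0 : 0 < b := lt_trans (by positivity) hb.1
    exact wrH_deriv_a θ b z x (wrU_slit θ b x hσ hb0.le (le_of_lt hx) (Or.inl hb0))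

lemma wrH_const (θ a b z : ℝ) (hσ : 0 < Real.sin θ) (hc : Real.cos θ < 0) (hz : 0 < z)
    (ha : 0 < a) (hb : 0 < b) :
    (∫ x in Ioi (0 : ℝ), wrH θ a z x).im = (∫ x in Ioi (0 : ℝ), wrH θ b z x).im := by
  exact isOpen_Ioi.is_const_of_deriv_eq_zero (s := Ioi (0 : ℝ))
    (f := fun b => (∫ x in Ioi (0 : ℝ), wrH θ b z x).im) isPreconnected_Ioi
    (fun y hy => (wrH_deriv_int θ y z hσ hc hz hy).differentiableAt.differentiableWithinAt)
    (fun y hy => (wrH_deriv_int θ y z hσ hc hz hy).deriv) ha hb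

lemma wrH_lim (θ z : ℝ) (hσ : 0 < Real.sin θ) (hc : Real.cos θ < 0) (hz : 0 < z) (hz1 : z < 1) :
    Filter.Tendsto (fun a => ∫ x in Ioi (0 : ℝ), wrH θ a z x) (nhdsWithin 0 (Ioi 0))
      (nhds (∫ x in Ioi (0 : ℝ), wrH θ 0 z x)) := by
  refine tendsto_integral_filter_of_dominated_convergence
    (fun x => (Real.exp 1 * Real.sin θ ^ (-z)) * (x ^ (-z) * Real.exp (-(-Real.cos θ) * x ^ (1 : ℝ))))
    ?_ ?_ ?_ ?_
  · filter_upwards [self_mem_nhdsWithin] with b hb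
    exact (wrH_int θ b z hσ hc hb).aestronglyMeasurable
  · filter_upwards [self_mem_nhdsWithin, mem_nhdsWithin_of_mem_nhds (gt_mem_nhds one_pos)]
      with b hb hb1
    refine (ae_restrict_mem measurableSet_Ioi).mono fun x hx => ?_
    have hx0 : 0 < x := hx
    rw [wrH_norm, Real.rpow_one, neg_neg]
    have e1 : ‖wrU θ b x‖ ^ (-z) ≤ (x * Real.sin θ) ^ (-z) :=
      Real.rpow_le_rpow_of_nonpos (by positivity) (wrU_norm_ge_x θ b x) (by linarith)
    rw [Real.mul_rpow hx0.le hσ.le] at e1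
    have e3 : Real.exp b ≤ Real.exp 1 := Real.exp_le_exp.2 (le_of_lt hb1)
    calc _ ≤ Real.exp 1 * Real.exp (Real.cos θ * x) * (x ^ (-z) * Real.sin θ ^ (-z)) := by gcongr
      _ = _ := by ring
  · exact (integrableOn_rpow_mul_exp_neg_mul_rpow (by linarith) one_pos (by linarith)).const_mul _
  · refine (ae_restrict_mem measurableSet_Ioi).mono fun x hx => ?_
    have := (wrH_deriv_a θ 0 z x (wrU_slit θ 0 x hσ le_rfl (le_of_lt hx) (Or.inr hx))).continuousAt
    exact this.tendsto.mono_left nhdsWithin_le_nhds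

lemma wrH_zero (θ z : ℝ) (hθ1 : Real.pi / 2 < θ) (hθ2 : θ < Real.pi) (hz1 : z < 1) :
    ∫ x in Ioi (0 : ℝ), wrH θ 0 z x
      = Complex.exp ((Real.pi * (1 - z) : ℝ) * Complex.I) * Real.Gamma (1 - z) := by
  have hπ := Real.pi_pos
  have hlog : Complex.log (wrDir θ) = θ * Complex.I := by
    rw [wrDir_eq, Complex.log_exp] <;> simp <;> linarith
  rw [← wrG_val (1 - z) θ (by linarith) hθ1 hθ2]
  refine setIntegral_congr_fun measurableSet_Ioi fun x hx => ?_
  have hx0 : 0 < x := hx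
  have hxc : (x : ℂ) ≠ 0 := by exact_mod_cast hx0.ne'
  simp only [wrH, wrU, wrG]
  rw [Complex.ofReal_zero, zero_add,
    Complex.cpow_def_of_ne_zero (mul_ne_zero hxc (wrDir_ne θ)),
    Complex.log_ofReal_mul hx0 (wrDir_ne θ), hlog, Real.rpow_def_of_pos hx0, Complex.ofReal_exp]
  conv_lhs => rw [mul_assoc]; rhs; rhs; rw [wrDir_eq]
  rw [← Complex.exp_add, ← Complex.exp_add, ← Complex.exp_add]
  congr 1
  push_cast
  ring

lemma wrH_val1 (θ a z : ℝ) (hθ1 : Real.pi / 2 < θ) (hθ2 : θ < Real.pi) (ha : 0 < a)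
    (hz : 0 < z) (hz1 : z < 1) :
    (∫ x in Ioi (0 : ℝ), wrH θ a z x).im = Real.pi / Real.Gamma z := by
  have hπ := Real.pi_pos
  have hc : Real.cos θ < 0 :=
    Real.cos_neg_of_pi_div_two_lt_of_lt hθ1 (by linarith)
  have hσ : 0 < Real.sin θ := Real.sin_pos_of_pos_of_lt_pi (by linarith) hθ2
  have h1 := (Complex.continuous_im.tendsto _).comp (wrH_lim θ z hσ hc hz hz1)
  have h2 : Filter.Tendsto (fun b => (∫ x in Ioi (0 : ℝ), wrH θ b z x).im) (nhdsWithin 0 (Ioi 0))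
      (nhds (∫ x in Ioi (0 : ℝ), wrH θ a z x).im) := by
    refine tendsto_const_nhds.congr' ?_
    filter_upwards [self_mem_nhdsWithin] with b hb
    exact wrH_const θ a b z hσ hc hz ha hb
  rw [tendsto_nhds_unique h2 h1, wrH_zero θ z hθ1 hθ2 hz1, Complex.im_mul_ofReal,
    Complex.exp_ofReal_mul_I_im, show Real.pi * (1 - z) = Real.pi - Real.pi * z by ring,
    Real.sin_pi_sub]
  have h3 := Real.Gamma_mul_Gamma_one_sub z
  have hs : 0 < Real.sin (Real.pi * z) :=
    Real.sin_pos_of_pos_of_lt_pi (by positivity) (by nlinarith)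
  have hg := Real.Gamma_pos_of_pos hz
  rw [eq_div_iff hs.ne'] at h3
  rw [eq_div_iff hg.ne']
  linarith

lemma wrH_contz (θ a : ℝ) (hσ : 0 < Real.sin θ) (hc : Real.cos θ < 0) (ha : 0 < a) :
    Filter.Tendsto (fun z => ∫ x in Ioi (0 : ℝ), wrH θ a z x) (nhds 1)
      (nhds (∫ x in Ioi (0 : ℝ), wrH θ a 1 x)) := by
  have hm : 0 < a * Real.sin θ := by positivity
  refine tendsto_integral_filter_of_dominated_convergence
    (fun x => ‖wrH θ a 0 x‖ + ‖wrH θ a 2 x‖) ?_ ?_ ?_ ?_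
  · exact Filter.Eventually.of_forall fun z => (wrH_int θ a z hσ hc ha).aestronglyMeasurable
  · filter_upwards [Icc_mem_nhds (show (0 : ℝ) < 1 by norm_num) (show (1 : ℝ) < 2 by norm_num)]
      with z hz
    refine Filter.Eventually.of_forall fun x => ?_
    have hU : 0 < ‖wrU θ a x‖ := hm.trans_le (wrU_norm_ge_a θ a x)
    rw [wrH_norm, wrH_norm, wrH_norm, ← mul_add]
    gcongr
    rcases le_total 1 ‖wrU θ a x‖ with h | h
    · have := Real.rpow_le_rpow_of_exponent_le h (show -z ≤ -0 by linarith [hz.1])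
      have h2 : 0 ≤ ‖wrU θ a x‖ ^ (-2 : ℝ) := by positivity
      linarith
    · have := Real.rpow_le_rpow_of_exponent_ge hU h (show -2 ≤ -z by linarith [hz.2])
      have h2 : 0 ≤ ‖wrU θ a x‖ ^ (-0 : ℝ) := by positivity
      linarith
  · exact (wrH_int θ a 0 hσ hc ha).norm.add (wrH_int θ a 2 hσ hc ha).norm
  · refine Filter.Eventually.of_forall fun x => ?_
    have hU : wrU θ a x ≠ 0 := norm_pos_iff.1 (hm.trans_le (wrU_norm_ge_a θ a x))
    have : Continuous fun z => wrH θ a z x := by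
      unfold wrH
      refine (continuous_const.mul ?_).mul continuous_const
      exact Continuous.const_cpow (by fun_prop) (Or.inl hU)
    exact this.tendsto 1

lemma wrH_val2 (θ a z : ℝ) (hθ1 : Real.pi / 2 < θ) (hθ2 : θ < Real.pi) (ha : 0 < a)
    (hz : 0 < z) (hz1 : z ≤ 1) :
    (∫ x in Ioi (0 : ℝ), wrH θ a z x).im = Real.pi / Real.Gamma z := by
  rcases hz1.lt_or_eq with h | rfl
  · exact wrH_val1 θ a z hθ1 hθ2 ha hz h
  have hπ := Real.pi_pos
  have hc : Real.cos θ < 0 :=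
    Real.cos_neg_of_pi_div_two_lt_of_lt hθ1 (by linarith)
  have hσ : 0 < Real.sin θ := Real.sin_pos_of_pos_of_lt_pi (by linarith) hθ2
  have h1 := ((Complex.continuous_im.tendsto _).comp (wrH_contz θ a hσ hc ha)).mono_left
    (nhdsWithin_le_nhds (s := Iio 1))
  have hg : ContinuousAt Real.Gamma 1 := (Real.differentiableAt_Gamma (fun m => by
    have : (0 : ℝ) ≤ m := m.cast_nonneg
    intro h; linarith)).continuousAt
  have h2 : Filter.Tendsto (fun z => Real.pi / Real.Gamma z) (nhdsWithin 1 (Iio 1))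
      (nhds (Real.pi / Real.Gamma 1)) :=
    ((tendsto_const_nhds.div hg.tendsto (by simp))).mono_left nhdsWithin_le_nhds
  refine tendsto_nhds_unique h1 (h2.congr' ?_)
  filter_upwards [self_mem_nhdsWithin, mem_nhdsWithin_of_mem_nhds (lt_mem_nhds one_pos)]
    with z hz1 hz0
  exact (wrH_val1 θ a z hθ1 hθ2 ha hz0 hz1).symm

/-- The Hankel formula. -/
lemma wrH_val (θ a : ℝ) (hθ1 : Real.pi / 2 < θ) (hθ2 : θ < Real.pi) (ha : 0 < a) (z : ℝ) :
    (∫ x in Ioi (0 : ℝ), wrH θ a z x).im = Real.pi / Real.Gamma z := by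
  have hπ := Real.pi_pos
  have hc : Real.cos θ < 0 :=
    Real.cos_neg_of_pi_div_two_lt_of_lt hθ1 (by linarith)
  have hσ : 0 < Real.sin θ := Real.sin_pos_of_pos_of_lt_pi (by linarith) hθ2
  have up : ∀ n : ℕ, ∀ z : ℝ, 0 < z → z ≤ n + 1 →
      (∫ x in Ioi (0 : ℝ), wrH θ a z x).im = Real.pi / Real.Gamma z := by
    intro n
    induction n with
    | zero => intro z h0 h1; exact wrH_val2 θ a z hθ1 hθ2 ha h0 (by simpa using h1)
    | succ n ih =>
      intro z h0 h1
      rcases le_or_gt z 1 with h | h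
      · exact wrH_val2 θ a z hθ1 hθ2 ha h0 h
      · have h2 := ih (z - 1) (by linarith) (by push_cast at h1; linarith)
        have h3 := wrH_rec θ a (z - 1) hσ hc ha
        have h4 := Real.Gamma_add_one (s := z - 1) (by linarith)
        rw [sub_add_cancel] at h3 h4
        have hp := Real.Gamma_pos_of_pos (show 0 < z - 1 by linarith)
        rw [h2] at h3
        rw [h4, ← div_div, div_right_comm, h3, mul_div_cancel_left₀ _ (by linarith)]
  have down : ∀ n : ℕ, ∀ z : ℝ, -(n : ℝ) < z →
      (∫ x in Ioi (0 : ℝ), wrH θ a z x).im = Real.pi / Real.Gamma z := by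
    intro n
    induction n with
    | zero =>
      intro z h0
      obtain ⟨n, hn⟩ := exists_nat_ge z
      exact up n z (by simpa using h0) (by linarith)
    | succ n ih =>
      intro z h0
      rw [wrH_rec θ a z hσ hc ha, ih (z + 1) (by push_cast at h0; linarith)]
      rcases eq_or_ne z 0 with rfl | hz
      · simp
      · rw [Real.Gamma_add_one hz, ← div_div, mul_div_assoc', mul_div_cancel₀ _ hz]
  obtain ⟨n, hn⟩ := exists_nat_gt (-z)
  exact down n z (by linarith)

lemma wrU_arg (θ a x : ℝ) (hθ1 : Real.pi / 2 < θ) (hθ2 : θ < Real.pi) (ha : 0 < a) (hx : 0 ≤ x) :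
    0 ≤ (wrU θ a x).arg ∧ (wrU θ a x).arg ≤ θ := by
  have hπ := Real.pi_pos
  have hσ : 0 < Real.sin θ := Real.sin_pos_of_pos_of_lt_pi (by linarith) hθ2
  refine ⟨Complex.arg_nonneg_iff.2 (by rw [wrU_im]; positivity), ?_⟩
  by_contra! hcon
  have h1 := Complex.norm_mul_cos_arg (wrU θ a x)
  have h2 := Complex.norm_mul_sin_arg (wrU θ a x)
  rw [wrU_re] at h1
  rw [wrU_im] at h2
  have h3 : 0 ≤ Real.sin ((wrU θ a x).arg - θ) :=
    Real.sin_nonneg_of_nonneg_of_le_pi (by linarith) (by linarith [Complex.arg_le_pi (wrU θ a x)])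
  have h4 := mul_nonneg (norm_nonneg (wrU θ a x)) h3
  rw [Real.sin_sub, mul_sub, ← mul_assoc, ← mul_assoc, h1, h2] at h4
  nlinarith [mul_pos ha hσ]

lemma wrV_re (θ a α x : ℝ) (hθ1 : Real.pi / 2 < θ) (hθ2 : θ < Real.pi) (ha : 0 < a) (hx : 0 ≤ x)
    (hα : 0 < α) (hαθ : θ * α ≤ Real.pi / 2) : 0 ≤ ((wrU θ a x) ^ (α : ℂ)).re := by
  obtain ⟨h1, h2⟩ := wrU_arg θ a x hθ1 hθ2 ha hx
  rw [Complex.cpow_ofReal_re]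
  refine mul_nonneg (by positivity) (Real.cos_nonneg_of_neg_pi_div_two_le_of_le ?_ ?_)
  · have := Real.pi_pos
    have := mul_nonneg h1 hα.le
    linarith
  · exact (mul_le_mul_of_nonneg_right h2 hα.le).trans hαθ

lemma wrH_pow (θ a α μ x : ℝ) (l : ℕ) (hU : wrU θ a x ≠ 0) :
    wrH θ a (-α * l + μ) x = ((wrU θ a x) ^ (α : ℂ)) ^ l * wrH θ a μ x := by
  simp only [wrH]
  rw [show ((-(-α * l + μ) : ℝ) : ℂ) = l * α + ((-μ : ℝ) : ℂ) by push_cast; ring,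
    Complex.cpow_add _ _ hU, Complex.cpow_nat_mul]
  ring

lemma wrH_pow' (θ a α μ x : ℝ) (n : ℕ) (hU : wrU θ a x ≠ 0) :
    wrH θ a (α * n + μ) x = (((wrU θ a x) ^ (α : ℂ))⁻¹) ^ n * wrH θ a μ x := by
  have h := wrH_pow θ a (-α) μ x n hU
  rw [neg_neg, Complex.ofReal_neg, Complex.cpow_neg] at h
  exact h

lemma wrExp_int (θ a α μ t : ℝ) (hσ : 0 < Real.sin θ) (hc : Real.cos θ < 0) (ha : 0 < a)
    (hα0 : 0 < α) (hα1 : α < 1) (ht : 0 ≤ t) :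
    IntegrableOn (fun x => Real.exp (t * ‖wrU θ a x‖ ^ α) * ‖wrH θ a μ x‖) (Ioi 0) := by
  refine integrable_of_isBigO_exp_neg (b := -Real.cos θ / 4) (by linarith) ?_ ?_
  · refine ContinuousOn.mul ?_ (wrH_cont θ a μ hσ ha).norm
    have h1 : Continuous fun y : ℝ => y ^ α := Real.continuous_rpow_const hα0.le
    have h2 := wrU_cont θ a
    exact (Real.continuous_exp.comp (continuous_const.mul (h1.comp h2.norm))).continuousOn
  · have h1 : (fun x => Real.exp (t * ‖wrU θ a x‖ ^ α)) =O[Filter.atTop]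
        fun x => Real.exp (-Real.cos θ / 4 * x) := by
      have h2 : (fun x : ℝ => x ^ α) =o[Filter.atTop] fun x : ℝ => x ^ (1 : ℝ) := by
        have h0 := tendsto_rpow_neg_atTop (show 0 < 1 - α by linarith)
        refine Asymptotics.isLittleO_of_tendsto' ?_ (h0.congr' ?_)
        · filter_upwards [Filter.eventually_gt_atTop 0] with x hx h
          rw [Real.rpow_one] at h
          exact absurd h hx.ne'
        · filter_upwards [Filter.eventually_gt_atTop 0] with x hx
          rw [← Real.rpow_sub hx]; congr 1; ring
      have hpos : 0 < -Real.cos θ / 4 / ((t + 1) * 2 ^ α) := by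
        have : 0 < -Real.cos θ := by linarith
        positivity
      refine Asymptotics.IsBigO.of_bound 1 ?_
      filter_upwards [h2.bound hpos, Filter.eventually_ge_atTop a] with x hx hxa
      have hx0 : 0 ≤ x := ha.le.trans hxa
      rw [Real.norm_of_nonneg (by positivity), Real.norm_of_nonneg (by positivity), one_mul]
      rw [Real.norm_of_nonneg (by positivity), Real.norm_of_nonneg (by positivity),
        Real.rpow_one, div_mul_eq_mul_div, le_div_iff₀ (by positivity)] at hx
      refine Real.exp_le_exp.2 ?_
      have h3 : ‖wrU θ a x‖ ^ α ≤ 2 ^ α * x ^ α := by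
        rw [← Real.mul_rpow (by norm_num) hx0]
        refine Real.rpow_le_rpow (norm_nonneg _) ?_ hα0.le
        linarith [wrU_norm_le θ a x ha.le hx0]
      have h4 : 0 ≤ 2 ^ α * x ^ α := by positivity
      calc t * ‖wrU θ a x‖ ^ α ≤ t * (2 ^ α * x ^ α) := by gcongr
        _ ≤ (t + 1) * (2 ^ α * x ^ α) := by nlinarith
        _ = x ^ α * ((t + 1) * 2 ^ α) := by ring
        _ ≤ _ := hx
    refine (h1.mul (wrH_bigO θ a μ hσ hc ha).norm_left).congr_right fun x => ?_
    rw [← Real.exp_add]; congr 1; ring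

lemma wr_wright (θ a α μ t : ℝ) (hθ1 : Real.pi / 2 < θ) (hθ2 : θ < Real.pi) (ha : 0 < a)
    (hα0 : 0 < α) (hα1 : α < 1) (ht : 0 ≤ t) :
    wright (-α) μ (-t) = Real.pi⁻¹ *
      (∫ x in Ioi (0 : ℝ), Complex.exp (-t * (wrU θ a x) ^ (α : ℂ)) * wrH θ a μ x).im := by
  have hπ := Real.pi_pos
  have hc : Real.cos θ < 0 :=
    Real.cos_neg_of_pi_div_two_lt_of_lt hθ1 (by linarith)
  have hσ : 0 < Real.sin θ := Real.sin_pos_of_pos_of_lt_pi (by linarith) hθ2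
  have hU : ∀ x, wrU θ a x ≠ 0 := fun x =>
    norm_pos_iff.1 ((mul_pos ha hσ).trans_le (wrU_norm_ge_a θ a x))
  have hsum : ∀ y : ℝ, HasSum (fun l : ℕ => y ^ l / (l.factorial : ℝ)) (Real.exp y) := fun y => by
    rw [Real.exp_eq_exp_ℝ]; exact NormedSpace.expSeries_div_hasSum_exp y
  have hsumc : ∀ y : ℂ, HasSum (fun l : ℕ => y ^ l / (l.factorial : ℂ)) (Complex.exp y) :=
    fun y => by
      rw [Complex.exp_eq_exp_ℂ]; exact NormedSpace.expSeries_div_hasSum_exp y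
  have key := hasSum_integral_of_dominated_convergence (μ := volume.restrict (Ioi (0 : ℝ)))
    (F := fun (l : ℕ) x => (((-t) ^ l / l.factorial : ℝ) : ℂ) * wrH θ a (-α * l + μ) x)
    (f := fun x => Complex.exp (-t * (wrU θ a x) ^ (α : ℂ)) * wrH θ a μ x)
    (fun l x => (t * ‖wrU θ a x‖ ^ α) ^ l / (l.factorial : ℝ) * ‖wrH θ a μ x‖) ?_ ?_ ?_ ?_ ?_
  · have h2 := (key.mapL Complex.imCLM).mul_left Real.pi⁻¹
    rw [wright]
    refine (h2.congr_fun ?_).tsum_eq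
    intro l
    simp only [Complex.imCLM_apply]
    rw [integral_const_mul, Complex.im_ofReal_mul, wrH_val θ a hθ1 hθ2 ha]
    field_simp
  · exact fun l => ((wrH_int θ a _ hσ hc ha).const_mul _).aestronglyMeasurable
  · intro l
    refine Filter.Eventually.of_forall fun x => ?_
    rw [wrH_pow θ a α μ x l (hU x), norm_mul, norm_mul, norm_pow, Complex.norm_cpow_real,
      Complex.norm_real, norm_div, norm_pow, norm_neg, Real.norm_of_nonneg ht, mul_pow,
      Real.norm_of_nonneg (by positivity : (0 : ℝ) ≤ l.factorial)]
    apply le_of_eq; ring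
  · exact Filter.Eventually.of_forall fun x => (hsum _).summable.mul_right _
  · refine (wrExp_int θ a α μ t hσ hc ha hα0 hα1 ht).congr ?_
    refine Filter.Eventually.of_forall fun x => ?_
    exact (((hsum _).mul_right _).tsum_eq).symm
  · refine Filter.Eventually.of_forall fun x => ?_
    refine ((hsumc _).mul_right _).congr_fun ?_
    intro l
    rw [wrH_pow θ a α μ x l (hU x), mul_pow]
    push_cast
    ring

lemma wr_ml (θ a α μ s : ℝ) (hθ1 : Real.pi / 2 < θ) (hθ2 : θ < Real.pi) (ha : 0 < a)
    (hα0 : 0 < α) (hs : 0 < s) (hsa : 2 * s ≤ (a * Real.sin θ) ^ α) :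
    mittagLeffler2 α (μ + α) (-s) = Real.pi⁻¹ *
      (∫ x in Ioi (0 : ℝ), (s + (wrU θ a x) ^ (α : ℂ))⁻¹ * wrH θ a μ x).im := by
  have hπ := Real.pi_pos
  have hc : Real.cos θ < 0 :=
    Real.cos_neg_of_pi_div_two_lt_of_lt hθ1 (by linarith)
  have hσ : 0 < Real.sin θ := Real.sin_pos_of_pos_of_lt_pi (by linarith) hθ2
  have hU : ∀ x, wrU θ a x ≠ 0 := fun x =>
    norm_pos_iff.1 ((mul_pos ha hσ).trans_le (wrU_norm_ge_a θ a x))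
  have hV : ∀ x, 2 * s ≤ ‖(wrU θ a x) ^ (α : ℂ)‖ := fun x => by
    rw [Complex.norm_cpow_real]
    exact hsa.trans (Real.rpow_le_rpow (by positivity) (wrU_norm_ge_a θ a x) hα0.le)
  have hq : ∀ x, ‖-(s : ℂ) * ((wrU θ a x) ^ (α : ℂ))⁻¹‖ ≤ 1 / 2 := fun x => by
    rw [norm_mul, norm_neg, norm_inv, Complex.norm_real, Real.norm_of_nonneg hs.le,
      ← div_eq_mul_inv, div_le_iff₀ (by linarith [hV x])]
    linarith [hV x]
  have hgeo : HasSum (fun n : ℕ => (1 / 2 : ℝ) ^ n) 2 := hasSum_geometric_two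
  have key := hasSum_integral_of_dominated_convergence (μ := volume.restrict (Ioi (0 : ℝ)))
    (F := fun (n : ℕ) x => (((-s) ^ n : ℝ) : ℂ) * wrH θ a (α * n + (μ + α)) x)
    (f := fun x => (s + (wrU θ a x) ^ (α : ℂ))⁻¹ * wrH θ a μ x)
    (fun n x => (1 / 2) ^ n * ‖wrH θ a (μ + α) x‖) ?_ ?_ ?_ ?_ ?_
  · have h2 := (key.mapL Complex.imCLM).mul_left Real.pi⁻¹
    rw [mittagLeffler2]
    refine (h2.congr_fun ?_).tsum_eq
    intro l
    simp only [Complex.imCLM_apply]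
    rw [integral_const_mul, Complex.im_ofReal_mul, wrH_val θ a hθ1 hθ2 ha]
    field_simp
  · exact fun l => ((wrH_int θ a _ hσ hc ha).const_mul _).aestronglyMeasurable
  · intro n
    refine Filter.Eventually.of_forall fun x => ?_
    rw [wrH_pow' θ a α _ x n (hU x), ← mul_assoc, Complex.ofReal_pow, ← mul_pow, norm_mul, norm_pow]
    have := hq x
    rw [Complex.ofReal_neg]
    gcongr
  · exact Filter.Eventually.of_forall fun x => hgeo.summable.mul_right _
  · refine ((wrH_int θ a (μ + α) hσ hc ha).norm.const_mul 2).congr ?_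
    refine Filter.Eventually.of_forall fun x => ?_
    exact ((hgeo.mul_right _).tsum_eq).symm
  · refine Filter.Eventually.of_forall fun x => ?_
    have hVne : (wrU θ a x) ^ (α : ℂ) ≠ 0 := norm_pos_iff.1 (by linarith [hV x])
    have h1 := (hasSum_geometric_of_norm_lt_one ((hq x).trans_lt (by norm_num))).mul_right
      (wrH θ a (μ + α) x)
    have h3 : wrH θ a (μ + α) x = ((wrU θ a x) ^ (α : ℂ))⁻¹ * wrH θ a μ x := by
      have := wrH_pow' θ a α μ x 1 (hU x)
      rw [pow_one, Nat.cast_one, mul_one, add_comm] at this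
      exact this
    have h2 : (1 - -(s : ℂ) * ((wrU θ a x) ^ (α : ℂ))⁻¹)⁻¹ * wrH θ a (μ + α) x
        = (s + (wrU θ a x) ^ (α : ℂ))⁻¹ * wrH θ a μ x := by
      rw [h3, ← mul_assoc, ← mul_inv]
      congr 2
      field_simp
      ring
    rw [h2] at h1
    refine h1.congr_fun ?_
    intro n
    rw [wrH_pow' θ a α _ x n (hU x), mul_pow]
    push_cast
    ring

lemma wr_laplace (θ a α μ s : ℝ) (hθ1 : Real.pi / 2 < θ) (hθ2 : θ < Real.pi) (ha : 0 < a)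
    (hα0 : 0 < α) (hαθ : θ * α ≤ Real.pi / 2) (hs : 0 < s) :
    ∫ t in Ioi (0 : ℝ), Real.exp (-(s * t)) *
      (∫ x in Ioi (0 : ℝ), Complex.exp (-t * (wrU θ a x) ^ (α : ℂ)) * wrH θ a μ x).im
      = (∫ x in Ioi (0 : ℝ), (s + (wrU θ a x) ^ (α : ℂ))⁻¹ * wrH θ a μ x).im := by
  have hπ := Real.pi_pos
  have hc : Real.cos θ < 0 :=
    Real.cos_neg_of_pi_div_two_lt_of_lt hθ1 (by linarith)
  have hσ : 0 < Real.sin θ := Real.sin_pos_of_pos_of_lt_pi (by linarith) hθ2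
  set f : ℝ → ℝ → ℂ := fun t x =>
    Complex.exp (-(s + (wrU θ a x) ^ (α : ℂ)) * t) * wrH θ a μ x with hf
  have hint : Integrable (Function.uncurry f)
      ((volume.restrict (Ioi (0 : ℝ))).prod (volume.restrict (Ioi (0 : ℝ)))) := by
    have hb := (integrableOn_exp_mul_Ioi (neg_lt_zero.2 hs) 0).mul_prod
      (wrH_int θ a μ hσ hc ha).norm
    refine hb.mono' ?_ ?_
    · have m1 : Measurable (wrU θ a) := (wrU_cont θ a).measurable
      have m2 : Measurable (wrH θ a μ) := by unfold wrH; fun_prop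
      have : Measurable (Function.uncurry f) := by
        simp only [hf, Function.uncurry_def]
        fun_prop
      exact this.aestronglyMeasurable
    · rw [Measure.prod_restrict]
      refine (ae_restrict_mem (measurableSet_Ioi.prod measurableSet_Ioi)).mono ?_
      rintro ⟨t, x⟩ ⟨ht, hx⟩
      have ht0 : 0 < t := ht
      have hV := wrV_re θ a α x hθ1 hθ2 ha (le_of_lt hx) hα0 hαθ
      simp only [hf, Function.uncurry_apply_pair, norm_mul]
      gcongr
      rw [Complex.norm_exp, Real.exp_le_exp, Complex.re_mul_ofReal]
      simp only [Complex.neg_re, Complex.add_re, Complex.ofReal_re]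
      nlinarith [mul_nonneg hV ht0.le]
  have h1 := integral_integral_swap hint
  have h2 : ∀ t ∈ Ioi (0 : ℝ), Real.exp (-(s * t)) *
      (∫ x in Ioi (0 : ℝ), Complex.exp (-t * (wrU θ a x) ^ (α : ℂ)) * wrH θ a μ x).im
      = Complex.imCLM (∫ x in Ioi (0 : ℝ), f t x) := by
    intro t _
    rw [Complex.imCLM_apply, ← Complex.im_ofReal_mul, ← integral_const_mul]
    congr 2
    funext x
    simp only [hf]
    rw [← mul_assoc, Complex.ofReal_exp, ← Complex.exp_add]
    congr 2
    push_cast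
    ring
  have h3 : IntegrableOn (fun t => ∫ x in Ioi (0 : ℝ), f t x) (Ioi 0) := hint.integral_prod_left
  rw [setIntegral_congr_fun measurableSet_Ioi h2,
    ContinuousLinearMap.integral_comp_comm Complex.imCLM h3, h1, Complex.imCLM_apply]
  congr 1
  refine setIntegral_congr_fun measurableSet_Ioi fun x hx => ?_
  have hV := wrV_re θ a α x hθ1 hθ2 ha (le_of_lt hx) hα0 hαθ
  simp only [hf]
  rw [integral_mul_const, integral_exp_mul_complex_Ioi (by simp; linarith)]
  simp only [Complex.ofReal_zero, mul_zero, Complex.exp_zero]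
  rw [neg_div_neg_eq, one_div]

theorem laplace_wright_eq_mittagLeffler2 (r α : ℝ) (hr : 0 < r) (hα0 : 0 < α) (hα1 : α < 1)
    (s : ℝ) (hs : 0 < s) :
    ∫ t in Ioi (0 : ℝ), Real.exp (-(s * t)) * wright (-α) (r * (1 - α)) (-t)
      = mittagLeffler2 α (r * (1 - α) + α) (-s) := by
  have hπ := Real.pi_pos
  obtain ⟨θ, hθ⟩ : ∃ θ : ℝ, θ = Real.pi / (1 + α) := ⟨_, rfl⟩
  have h1a : 0 < 1 + α := by linarith
  have hθ1 : Real.pi / 2 < θ := by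
    rw [hθ]; gcongr; linarith
  have hθ2 : θ < Real.pi := by
    rw [hθ, div_lt_iff₀ h1a]; nlinarith
  have hαθ : θ * α ≤ Real.pi / 2 := by
    rw [hθ, div_mul_eq_mul_div, div_le_iff₀ h1a]; nlinarith
  have hσ : 0 < Real.sin θ := Real.sin_pos_of_pos_of_lt_pi (by linarith) hθ2
  obtain ⟨a, haa⟩ : ∃ a : ℝ, a = (2 * s) ^ (α⁻¹) / Real.sin θ := ⟨_, rfl⟩
  have ha : 0 < a := by rw [haa]; positivity
  have hsa : 2 * s ≤ (a * Real.sin θ) ^ α := by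
    rw [haa, div_mul_cancel₀ _ hσ.ne', Real.rpow_inv_rpow (by positivity) hα0.ne']
  rw [wr_ml θ a α _ s hθ1 hθ2 ha hα0 hs hsa, ← wr_laplace θ a α _ s hθ1 hθ2 ha hα0 hαθ hs,
    ← integral_const_mul]
  refine setIntegral_congr_fun measurableSet_Ioi fun t ht => ?_
  rw [wr_wright θ a α _ t hθ1 hθ2 ha hα0 hα1 (le_of_lt ht)]
  ring
end

section
/- Let r > 0 and 0 < α < 1. Let Z_r be a gamma random variable with density t^(r-1) e^(-t)/Γ(r) on (0,∞), and let Y_{α,r} be an independent random variable with density t^(r-1) W_{-α, r(1-α)}(-t) on (0,∞). Then Z_r has the same distribution as Z_r^α · Y_{α,r}. -/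
open MeasureTheory Set

lemma gms_re_cpow_bound (p : ℝ) (hp1 : 1 < p) (hp2 : p < 2) :
    ∃ c > 0, ∃ C : ℝ, ∀ v : ℂ, 0 ≤ v.re → v.re ≤ 1 →
      (v ^ (p : ℂ)).re ≤ C - c * ‖v‖ ^ p := by
  have hpi := Real.pi_pos
  set θ := (Real.pi / (2 * p) + Real.pi / 2) / 2 with hθ
  have h1 : Real.pi / (2 * p) < Real.pi / 2 := by
    apply div_lt_div_of_pos_left hpi (by norm_num) (by linarith)
  have h1' : 0 < Real.pi / (2 * p) := by positivity
  have hpp : p * (Real.pi / (2 * p)) = Real.pi / 2 := by field_simp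
  have hθ1 : Real.pi / 2 < p * θ := by
    have : p * (Real.pi / (2 * p)) < p * θ := by
      apply mul_lt_mul_of_pos_left _ (by linarith)
      rw [hθ]; linarith
    linarith
  have hθ2 : θ < Real.pi / 2 := by rw [hθ]; linarith
  have hθ0 : 0 < θ := by rw [hθ]; linarith
  have hθ3 : p * θ ≤ Real.pi := by nlinarith
  have hc : Real.cos (p * θ) < 0 := Real.cos_neg_of_pi_div_two_lt_of_lt hθ1 (by linarith)
  have hc0 : 0 < Real.cos θ := Real.cos_pos_of_mem_Ioo ⟨by linarith, hθ2⟩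
  set c := -Real.cos (p * θ) with hcdef
  refine ⟨c, by linarith, (1 + c) * (1 / Real.cos θ) ^ p, ?_⟩
  intro v hv0 hv1
  rw [Complex.cpow_ofReal_re]
  have hn : 0 ≤ ‖v‖ ^ p := by positivity
  have hM : 0 ≤ (1 / Real.cos θ) ^ p := by positivity
  have habs : |v.arg| ≤ Real.pi / 2 := Complex.abs_arg_le_pi_div_two_iff.2 hv0
  by_cases hcase : θ ≤ |v.arg|
  · have : Real.cos (v.arg * p) ≤ -c := by
      rw [← Real.cos_abs, abs_mul, abs_of_pos (by linarith : 0 < p), mul_comm, hcdef, neg_neg]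
      apply Real.cos_le_cos_of_nonneg_of_le_pi (by positivity) (by nlinarith)
      exact mul_le_mul_of_nonneg_left hcase (by linarith)
    nlinarith [mul_nonneg (by linarith : 0 ≤ 1 + c) hM]
  · push Not at hcase
    have hcos : Real.cos θ ≤ Real.cos v.arg := by
      rw [← Real.cos_abs v.arg]
      exact Real.cos_le_cos_of_nonneg_of_le_pi (abs_nonneg _) (by linarith) hcase.le
    have hle : ‖v‖ ≤ 1 / Real.cos θ := by
      rw [le_div_iff₀ hc0]
      calc ‖v‖ * Real.cos θ ≤ ‖v‖ * Real.cos v.arg := by gcongr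
        _ = v.re := Complex.norm_mul_cos_arg v
        _ ≤ 1 := hv1
    have h2 : ‖v‖ ^ p ≤ (1 / Real.cos θ) ^ p := by gcongr
    have h3 : ‖v‖ ^ p * Real.cos (v.arg * p) ≤ ‖v‖ ^ p := by
      nlinarith [Real.cos_le_one (v.arg * p)]
    nlinarith

lemma gms_decay (p q t K : ℝ) (hp1 : 1 < p) (hp2 : p < 2) (hq0 : 0 < q) (hq1 : q < 1)
    (ht : 0 ≤ t) :
    ∃ D : ℝ, ∀ v : ℂ, 0 ≤ v.re → v.re ≤ 1 → 1 ≤ ‖v‖ →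
      ‖v‖ ^ K * Real.exp (t * ‖v‖ ^ q + (v ^ (p : ℂ)).re) ≤ D := by
  obtain ⟨c, hc, C, hC⟩ := gms_re_cpow_bound p hp1 hp2
  obtain ⟨n, hn⟩ := exists_nat_ge K
  have hM : ∃ M : ℝ, ∀ x : ℝ, 1 ≤ x → t * x ^ q ≤ c / 2 * x + M := by
    refine ⟨t * ((2 * t / c) ^ (1 / (1 - q))) ^ q, fun x hx => ?_⟩
    have hx0 : 0 < x := by linarith
    by_cases h : 2 * t / c ≤ x ^ (1 - q)
    · have e : x = x ^ (1 - q) * x ^ q := by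
        rw [← Real.rpow_add hx0]; simp
      have : t * x ^ q ≤ c / 2 * x := by
        rw [div_le_iff₀ hc] at h
        have hxq : 0 ≤ x ^ q := by positivity
        calc t * x ^ q ≤ (x ^ (1 - q) * c / 2) * x ^ q := by gcongr; linarith
          _ = c / 2 * (x ^ (1 - q) * x ^ q) := by ring
          _ = c / 2 * x := by rw [← e]
      have : 0 ≤ t * ((2 * t / c) ^ (1 / (1 - q))) ^ q := by positivity
      linarith
    · push Not at h
      have : x ≤ (2 * t / c) ^ (1 / (1 - q)) := by
        have h' := Real.rpow_le_rpow (by positivity) h.le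
          (by apply one_div_nonneg.2; linarith : 0 ≤ 1 / (1 - q))
        rwa [← Real.rpow_mul hx0.le, mul_one_div_cancel (by linarith), Real.rpow_one] at h'
      have h3 : t * x ^ q ≤ t * ((2 * t / c) ^ (1 / (1 - q))) ^ q := by gcongr
      have : 0 ≤ c / 2 * x := by positivity
      linarith
  obtain ⟨M, hM⟩ := hM
  refine ⟨(n.factorial / (c / 2) ^ n) * Real.exp (M + C), fun v h0 h1 h2 => ?_⟩
  set x := ‖v‖ with hx
  have hx0 : 0 < x := by linarith
  have e1 : x ^ K ≤ x ^ n := by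
    rw [← Real.rpow_natCast]; exact Real.rpow_le_rpow_of_exponent_le h2 hn
  have e2 : x ^ n ≤ (n.factorial / (c / 2) ^ n) * Real.exp (c / 2 * x) := by
    have := Real.pow_div_factorial_le_exp (c / 2 * x) (by positivity) n
    rw [div_le_iff₀ (by positivity), mul_pow] at this
    rw [div_mul_eq_mul_div, le_div_iff₀ (by positivity)]
    linarith
  have e3 : x ≤ x ^ p := by
    nth_rw 1 [← Real.rpow_one x]
    exact Real.rpow_le_rpow_of_exponent_le h2 hp1.le
  have e4 := hC v h0 h1
  calc x ^ K * Real.exp (t * x ^ q + (v ^ (p : ℂ)).re)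
      ≤ ((n.factorial / (c / 2) ^ n) * Real.exp (c / 2 * x)) * Real.exp (-(c / 2 * x) + (M + C)) := by
        have : t * x ^ q + (v ^ (p : ℂ)).re ≤ -(c / 2 * x) + (M + C) := by
          have := hM x h2
          nlinarith
        gcongr
        exact e1.trans e2
    _ = _ := by
        rw [Real.exp_add, Real.exp_neg]
        field_simp

/-- The vertical line. -/
noncomputable def gmsv (y : ℝ) : ℂ := 1 + y * Complex.I

lemma gmsv_re (y : ℝ) : (gmsv y).re = 1 := by simp [gmsv]
lemma gmsv_im (y : ℝ) : (gmsv y).im = y := by simp [gmsv]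
lemma gmsv_slit (y : ℝ) : gmsv y ∈ Complex.slitPlane := by
  left; rw [gmsv_re]; norm_num
lemma gmsv_ne (y : ℝ) : gmsv y ≠ 0 := Complex.slitPlane_ne_zero (gmsv_slit y)
lemma gmsv_norm_sq (y : ℝ) : ‖gmsv y‖ ^ 2 = 1 + y ^ 2 := by
  rw [← Complex.normSq_eq_norm_sq, Complex.normSq_apply, gmsv_re, gmsv_im]; ring
lemma gmsv_one_le (y : ℝ) : 1 ≤ ‖gmsv y‖ := by
  have := Complex.re_le_norm (gmsv y); rwa [gmsv_re] at this
lemma gmsv_cont : Continuous gmsv := by unfold gmsv; fun_prop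
lemma gmsv_cpow_cont (a : ℂ) : Continuous (fun y => gmsv y ^ a) := by
  rw [continuous_iff_continuousAt]
  intro y
  exact (gmsv_cont.continuousAt).cpow continuousAt_const (gmsv_slit y)
lemma gmsv_deriv (y : ℝ) : HasDerivAt gmsv Complex.I y := by
  unfold gmsv
  have := ((Complex.ofRealCLM.hasDerivAt (x := y)).mul_const Complex.I).const_add 1
  simpa using this

lemma gms_integrable (p q t K : ℝ) (hp1 : 1 < p) (hp2 : p < 2) (hq0 : 0 < q) (hq1 : q < 1)
    (ht : 0 ≤ t) :
    Integrable (fun y : ℝ => ‖gmsv y‖ ^ K *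
      Real.exp (t * ‖gmsv y‖ ^ q + (gmsv y ^ (p : ℂ)).re)) := by
  obtain ⟨D, hD⟩ := gms_decay p q t (K + 2) hp1 hp2 hq0 hq1 ht
  have hpos : ∀ y, 0 < ‖gmsv y‖ := fun y => lt_of_lt_of_le one_pos (gmsv_one_le y)
  refine Integrable.mono' (integrable_inv_one_add_sq.const_mul D) ?_ ?_
  · apply Continuous.aestronglyMeasurable
    have h1 : ∀ a : ℝ, Continuous (fun y => ‖gmsv y‖ ^ a) := fun a =>
      gmsv_cont.norm.rpow_const (fun y => Or.inl (hpos y).ne')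
    have h2 := gmsv_cpow_cont p
    exact (h1 K).mul (Real.continuous_exp.comp ((continuous_const.mul (h1 q)).add
      (Complex.continuous_re.comp h2)))
  · refine Filter.Eventually.of_forall fun y => ?_
    have := hD (gmsv y) (by rw [gmsv_re]; norm_num) (by rw [gmsv_re]) (gmsv_one_le y)
    rw [Real.rpow_add (hpos y), Real.rpow_two, gmsv_norm_sq] at this
    rw [Real.norm_of_nonneg (by positivity), ← div_eq_mul_inv, le_div_iff₀ (by positivity)]
    linarith

/-- The integrand. -/
noncomputable def gmsF (p s : ℝ) (v : ℂ) : ℂ := Complex.exp (v ^ (p : ℂ)) * v ^ ((p - 1 - p * s : ℝ) : ℂ)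

lemma gmsF_norm (p s : ℝ) (v : ℂ) : ‖gmsF p s v‖ = ‖v‖ ^ (p - 1 - p * s) * Real.exp ((v ^ (p : ℂ)).re) := by
  rw [gmsF, norm_mul, Complex.norm_exp, Complex.norm_cpow_real, mul_comm]

lemma gmsF_cont (p s : ℝ) : Continuous (fun y => gmsF p s (gmsv y)) := by
  unfold gmsF
  exact (Complex.continuous_exp.comp (gmsv_cpow_cont _)).mul (gmsv_cpow_cont _)

lemma gmsF_integrable (p s : ℝ) (hp1 : 1 < p) (hp2 : p < 2) :
    Integrable (fun y => gmsF p s (gmsv y)) := by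
  refine Integrable.mono' (gms_integrable p (1/2) 0 (p - 1 - p * s) hp1 hp2 (by norm_num) (by norm_num) le_rfl)
    (gmsF_cont p s).aestronglyMeasurable (Filter.Eventually.of_forall fun y => ?_)
  rw [gmsF_norm]; simp

noncomputable def gmsH (p s : ℝ) : ℂ := ∫ y : ℝ, gmsF p s (gmsv y)

lemma gmsv_tendsto_top : Filter.Tendsto (fun y => ‖gmsv y‖) Filter.atTop Filter.atTop := by
  refine Filter.tendsto_atTop_mono (fun y => ?_) Filter.tendsto_id
  have := Complex.abs_im_le_norm (gmsv y); rw [gmsv_im] at this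
  exact (le_abs_self y).trans this

lemma gmsv_tendsto_bot : Filter.Tendsto (fun y => ‖gmsv y‖) Filter.atBot Filter.atTop := by
  refine Filter.tendsto_atTop_mono (fun y => ?_) Filter.tendsto_neg_atBot_atTop
  have := Complex.abs_im_le_norm (gmsv y); rw [gmsv_im] at this
  exact (neg_le_abs y).trans this

lemma gmsv_cpow_deriv (a : ℂ) (y : ℝ) :
    HasDerivAt (fun y => gmsv y ^ a) (a * gmsv y ^ (a - 1) * Complex.I) y := by
  have h : HasDerivAt (fun z : ℂ => z ^ a) (a * gmsv y ^ (a - 1) * 1) (gmsv y) :=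
    (hasDerivAt_id (gmsv y)).cpow_const (gmsv_slit y)
  have := h.comp y (gmsv_deriv y)
  rw [mul_one] at this
  exact this

lemma gmsH_rec (p s : ℝ) (hp1 : 1 < p) (hp2 : p < 2) : gmsH p s = s * gmsH p (s + 1) := by
  have hp0 : (p : ℂ) ≠ 0 := by
    rw [Complex.ofReal_ne_zero]; linarith
  set f : ℝ → ℂ := fun y => Complex.exp (gmsv y ^ (p : ℂ)) * gmsv y ^ ((-(p * s) : ℝ) : ℂ) with hf
  have hderiv : ∀ y, HasDerivAt f
      (Complex.I * p * (gmsF p s (gmsv y) - s * gmsF p (s + 1) (gmsv y))) y := by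
    intro y
    have h1 : HasDerivAt (fun y => gmsv y ^ (p : ℂ)) (p * gmsv y ^ ((p : ℂ) - 1) * Complex.I) y :=
      gmsv_cpow_deriv _ y
    have h2 : HasDerivAt (fun y => gmsv y ^ ((-(p * s) : ℝ) : ℂ))
        (((-(p * s) : ℝ) : ℂ) * gmsv y ^ (((-(p * s) : ℝ) : ℂ) - 1) * Complex.I) y :=
      gmsv_cpow_deriv _ y
    convert! h1.cexp.mul h2 using 1
    unfold gmsF
    have e1 : gmsv y ^ ((p - 1 - p * s : ℝ) : ℂ)
        = gmsv y ^ ((p : ℂ) - 1) * gmsv y ^ ((-(p * s) : ℝ) : ℂ) := by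
      rw [← Complex.cpow_add _ _ (gmsv_ne y)]; push_cast; ring_nf
    have e2 : ((p - 1 - p * (s + 1) : ℝ) : ℂ) = ((-(p * s) : ℝ) : ℂ) - 1 := by
      push_cast; ring
    rw [e1, e2]; push_cast; ring
  have hnorm : ∃ D : ℝ, ∀ y, ‖f y‖ ≤ D * ‖gmsv y‖⁻¹ := by
    obtain ⟨D, hD⟩ := gms_decay p (1/2) 0 (-(p * s) + 1) hp1 hp2 (by norm_num) (by norm_num) le_rfl
    refine ⟨D, fun y => ?_⟩
    have hpos : 0 < ‖gmsv y‖ := lt_of_lt_of_le one_pos (gmsv_one_le y)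
    have := hD (gmsv y) (by rw [gmsv_re]; norm_num) (by rw [gmsv_re]) (gmsv_one_le y)
    rw [Real.rpow_add hpos, Real.rpow_one, zero_mul, zero_add] at this
    rw [hf]; simp only
    rw [norm_mul, Complex.norm_exp, Complex.norm_cpow_real, ← div_eq_mul_inv, le_div_iff₀ hpos]
    linarith
  obtain ⟨D, hD⟩ := hnorm
  have hlim : ∀ l : Filter ℝ, Filter.Tendsto (fun y => ‖gmsv y‖) l Filter.atTop →
      Filter.Tendsto f l (nhds 0) := by
    intro l hl
    refine squeeze_zero_norm hD ?_
    simpa using (tendsto_inv_atTop_zero.comp hl).const_mul D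
  have hIntg : Integrable (fun y => Complex.I * p * (gmsF p s (gmsv y) - s * gmsF p (s + 1) (gmsv y))) :=
    ((gmsF_integrable p s hp1 hp2).sub ((gmsF_integrable p (s+1) hp1 hp2).const_mul _)).const_mul _
  have := integral_of_hasDerivAt_of_tendsto hderiv hIntg (hlim _ gmsv_tendsto_bot) (hlim _ gmsv_tendsto_top)
  rw [integral_const_mul, integral_sub (gmsF_integrable p s hp1 hp2)
    ((gmsF_integrable p (s+1) hp1 hp2).const_mul _), integral_const_mul, sub_zero] at this
  have h3 := (mul_eq_zero.1 this).resolve_left (mul_ne_zero Complex.I_ne_zero hp0)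
  exact sub_eq_zero.1 h3

lemma gmsH_cont (p : ℝ) (hp1 : 1 < p) (hp2 : p < 2) : Continuous (gmsH p) := by
  rw [continuous_iff_continuousAt]
  intro s₀
  unfold gmsH
  refine continuousAt_of_dominated (bound := fun y => ‖gmsv y‖ ^ (p - 1 - p * (s₀ - 1)) *
      Real.exp (0 * ‖gmsv y‖ ^ (1/2 : ℝ) + (gmsv y ^ (p : ℂ)).re))
    (Filter.Eventually.of_forall fun s => (gmsF_cont p s).aestronglyMeasurable) ?_
    (gms_integrable p (1/2) 0 _ hp1 hp2 (by norm_num) (by norm_num) le_rfl) ?_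
  · filter_upwards [lt_mem_nhds (show s₀ - 1 < s₀ by linarith)] with s hs
    refine Filter.Eventually.of_forall fun y => ?_
    rw [gmsF_norm, zero_mul, zero_add]
    gcongr
    · exact gmsv_one_le y
  · refine Filter.Eventually.of_forall fun y => ?_
    unfold gmsF
    refine ContinuousAt.mul continuousAt_const ?_
    refine ContinuousAt.cpow continuousAt_const ?_ (gmsv_slit y)
    fun_prop

lemma gms_laplace (a : ℝ) (ha : 0 < a) (w : ℂ) (hw : 0 < w.re) :
    ∫ t in Ioi (0:ℝ), ((t ^ (a - 1) : ℝ) : ℂ) * Complex.exp (-(w * t)) =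
      w ^ (-(a : ℂ)) * (Real.Gamma a : ℂ) := by
  set ν := (volume.restrict (Ioi (0:ℝ))).withDensity (fun t => ENNReal.ofReal (t ^ (a - 1))) with hν
  have hmeas : Measurable (fun t : ℝ => ENNReal.ofReal (t ^ (a - 1))) := by fun_prop
  have hcm : ∀ w : ℂ, ProbabilityTheory.complexMGF (fun t => -t) ν w =
      ∫ t in Ioi (0:ℝ), ((t ^ (a - 1) : ℝ) : ℂ) * Complex.exp (-(w * t)) := by
    intro w
    rw [ProbabilityTheory.complexMGF, hν, integral_withDensity_eq_integral_toReal_smul hmeas (by simp)]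
    refine setIntegral_congr_fun measurableSet_Ioi fun t ht => ?_
    have : 0 ≤ t ^ (a - 1) := Real.rpow_nonneg (le_of_lt ht) _
    simp only [ENNReal.toReal_ofReal this]
    simp
  have hset : Ioi (0:ℝ) ⊆ interior (ProbabilityTheory.integrableExpSet (fun t => -t) ν) := by
    rw [isOpen_Ioi.subset_interior_iff]
    intro x hx
    simp only [ProbabilityTheory.integrableExpSet, mem_ofPred_eq]
    rw [hν, integrable_withDensity_iff_integrable_smul' hmeas (by simp)]
    have := integrableOn_rpow_mul_exp_neg_mul_rpow (p := 1) (s := a - 1) (b := x) (by linarith) one_pos hx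
    refine this.congr_fun (fun t ht => ?_) measurableSet_Ioi
    have : 0 ≤ t ^ (a - 1) := Real.rpow_nonneg (le_of_lt ht) _
    simp only [ENNReal.toReal_ofReal this]
    simp
  have hU : IsOpen {z : ℂ | 0 < z.re} := isOpen_Ioi.preimage Complex.continuous_re
  have han1 : AnalyticOnNhd ℂ (ProbabilityTheory.complexMGF (fun t => -t) ν) {z : ℂ | 0 < z.re} :=
    ProbabilityTheory.analyticOnNhd_complexMGF.mono fun z hz => hset hz
  have han2 : AnalyticOnNhd ℂ (fun z : ℂ => z ^ (-(a : ℂ)) * (Real.Gamma a : ℂ)) {z : ℂ | 0 < z.re} := by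
    apply DifferentiableOn.analyticOnNhd _ hU
    intro z hz
    apply DifferentiableAt.differentiableWithinAt
    exact ((differentiableAt_id).cpow_const (Or.inl hz)).mul_const _
  have hpre : IsPreconnected {z : ℂ | 0 < z.re} := (convex_halfSpace_re_gt 0).isPreconnected
  have hreal : ∀ x : ℝ, 0 < x → ProbabilityTheory.complexMGF (fun t => -t) ν x =
      (x : ℂ) ^ (-(a : ℂ)) * (Real.Gamma a : ℂ) := by
    intro x hx
    rw [hcm]
    have := Real.integral_rpow_mul_exp_neg_mul_Ioi ha hx
    rw [one_div, Real.inv_rpow hx.le, ← Real.rpow_neg hx.le] at this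
    have h2 := congrArg (fun u : ℝ => (u : ℂ)) this
    beta_reduce at h2
    rw [← integral_complex_ofReal, Complex.ofReal_mul, Complex.ofReal_cpow hx.le] at h2
    push_cast at h2 ⊢
    exact h2
  have := han1.eqOn_of_preconnected_of_frequently_eq han2 hpre (z₀ := 1) (by simp) (by
    have h_real : ∃ᶠ (x : ℝ) in nhdsWithin 1 {1}ᶜ, ProbabilityTheory.complexMGF (fun t => -t) ν x =
      (x : ℂ) ^ (-(a : ℂ)) * (Real.Gamma a : ℂ) := by
      apply Filter.Eventually.frequently
      filter_upwards [mem_nhdsWithin_of_mem_nhds (lt_mem_nhds (show (0:ℝ) < 1 by norm_num))] with x hx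
      exact hreal x hx
    rw [Filter.frequently_iff_seq_forall] at h_real ⊢
    obtain ⟨xs, hx_tendsto, hx_eq⟩ := h_real
    refine ⟨fun n ↦ xs n, ?_, fun n ↦ hx_eq n⟩
    rw [tendsto_nhdsWithin_iff] at hx_tendsto ⊢
    constructor
    · exact (Complex.continuous_ofReal.tendsto 1).comp hx_tendsto.1
    · simpa using hx_tendsto.2)
  rw [← hcm]
  exact this hw

lemma gmsF_contAt (p s : ℝ) (hp1 : 1 < p) (hs : s < 0) (v : ℂ) (hv : 0 ≤ v.re) :
    ContinuousAt (gmsF p s) v := by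
  have hk : 0 < p - 1 - p * s := by nlinarith
  unfold gmsF
  refine ContinuousAt.mul (Complex.continuous_exp.continuousAt.comp ?_) ?_
  · exact Complex.continuousAt_cpow_const_of_re_pos (Or.inl hv) (by simp; linarith)
  · exact Complex.continuousAt_cpow_const_of_re_pos (Or.inl hv) (by rwa [Complex.ofReal_re])

lemma gmsF_decay (p s : ℝ) (hp1 : 1 < p) (hp2 : p < 2) :
    ∃ D : ℝ, 0 ≤ D ∧ ∀ v : ℂ, 0 ≤ v.re → v.re ≤ 1 → 1 ≤ ‖v‖ → ‖gmsF p s v‖ ≤ D / ‖v‖ ^ 2 := by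
  obtain ⟨D, hD⟩ := gms_decay p (1/2) 0 (p - 1 - p * s + 2) hp1 hp2 (by norm_num) (by norm_num) le_rfl
  refine ⟨max D 0, le_max_right _ _, fun v h0 h1 h2 => ?_⟩
  have hpos : 0 < ‖v‖ := by linarith
  have := hD v h0 h1 h2
  rw [Real.rpow_add hpos, Real.rpow_two, zero_mul, zero_add] at this
  rw [gmsF_norm, le_div_iff₀ (by positivity)]
  refine le_trans ?_ (le_max_left _ _)
  linarith

lemma gmsF_int_imag (p s : ℝ) (hp1 : 1 < p) (hp2 : p < 2) (hs : s < 0) :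
    Integrable (fun y : ℝ => gmsF p s (y * Complex.I)) := by
  obtain ⟨D, hD0, hD⟩ := gmsF_decay p s hp1 hp2
  have hk : 0 < p - 1 - p * s := by nlinarith
  refine Integrable.mono' (integrable_inv_one_add_sq.const_mul (2 * D + 2 * Real.exp 1)) ?_
    (Filter.Eventually.of_forall fun y => ?_)
  · apply Continuous.aestronglyMeasurable
    rw [continuous_iff_continuousAt]
    intro y
    exact ContinuousAt.comp (f := fun y : ℝ => (y : ℂ) * Complex.I)
      (gmsF_contAt p s hp1 hs _ (by simp)) (by fun_prop)
  · have hn : ‖(y : ℂ) * Complex.I‖ = |y| := by simp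
    rw [← div_eq_mul_inv]
    have he := Real.exp_pos 1
    by_cases hy : 1 ≤ |y|
    · refine (hD _ (by simp) (by simp) (by rwa [hn])).trans ?_
      rw [hn, sq_abs]
      have : 1 ≤ y ^ 2 := by rw [← sq_abs]; nlinarith
      rw [div_le_div_iff₀ (by linarith) (by positivity)]
      nlinarith
    · push Not at hy
      rw [gmsF_norm, hn]
      have h1 : |y| ^ (p - 1 - p * s) ≤ 1 := Real.rpow_le_one (abs_nonneg _) hy.le hk.le
      have h2 : (((y : ℂ) * Complex.I) ^ (p : ℂ)).re ≤ 1 := by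
        refine (Complex.re_le_norm _).trans ?_
        rw [Complex.norm_cpow_real, hn]
        exact Real.rpow_le_one (abs_nonneg _) hy.le (by linarith)
      have h3 : y ^ 2 ≤ 1 := by rw [← sq_abs]; nlinarith [abs_nonneg y]
      calc |y| ^ (p - 1 - p * s) * Real.exp ((((y : ℂ) * Complex.I) ^ (p : ℂ)).re)
          ≤ 1 * Real.exp 1 := by gcongr
        _ ≤ _ := by
          rw [le_div_iff₀ (by positivity)]
          nlinarith

lemma gmsH_shift (p s : ℝ) (hp1 : 1 < p) (hp2 : p < 2) (hs : s < 0) :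
    gmsH p s = ∫ y : ℝ, gmsF p s (y * Complex.I) := by
  obtain ⟨D, hD0, hD⟩ := gmsF_decay p s hp1 hp2
  have hrect : ∀ T : ℝ, 0 < T →
      (∫ x : ℝ in (0:ℝ)..1, gmsF p s (x + (-T : ℝ) * Complex.I))
        - (∫ x : ℝ in (0:ℝ)..1, gmsF p s (x + T * Complex.I)) +
      Complex.I • (∫ y : ℝ in -T..T, gmsF p s (gmsv y)) -
      Complex.I • (∫ y : ℝ in -T..T, gmsF p s (y * Complex.I)) = 0 := by
    intro T hT
    have := Complex.integral_boundary_rect_eq_zero_of_continuousOn_of_differentiableOn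
      (gmsF p s) ⟨0, -T⟩ ⟨1, T⟩ ?_ ?_
    · simpa [gmsv] using this
    · intro v hv
      rw [Complex.mem_reProdIm, uIcc_of_le (by norm_num)] at hv
      exact (gmsF_contAt p s hp1 hs v hv.1.1).continuousWithinAt
    · intro v hv
      rw [Complex.mem_reProdIm] at hv
      have hre : 0 < v.re := by simpa using hv.1.1
      apply DifferentiableAt.differentiableWithinAt
      unfold gmsF
      have : ∀ a : ℂ, DifferentiableAt ℂ (fun v : ℂ => v ^ a) v := fun a =>
        differentiableAt_id.cpow_const (Or.inl hre)
      exact (this _).cexp.mul (this _)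
  have hhor : ∀ σ : ℝ → ℝ, (∀ T, |σ T| = |T|) → Filter.Tendsto
      (fun T : ℝ => ∫ x : ℝ in (0:ℝ)..1, gmsF p s (x + (σ T : ℝ) * Complex.I)) Filter.atTop (nhds 0) := by
    intro σ hσ
    have hb : ∀ᶠ T : ℝ in Filter.atTop,
        ‖∫ x : ℝ in (0:ℝ)..1, gmsF p s (x + (σ T : ℝ) * Complex.I)‖ ≤ D * T⁻¹ := by
      filter_upwards [Filter.eventually_ge_atTop 1] with T hT
      have := intervalIntegral.norm_integral_le_of_norm_le_const (a := 0) (b := 1)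
        (f := fun x : ℝ => gmsF p s (x + (σ T : ℝ) * Complex.I)) (C := D * T⁻¹) ?_
      · simpa using this
      · intro x hx
        rw [uIoc_of_le (by norm_num)] at hx
        have hTn : T ≤ ‖(x : ℂ) + (σ T : ℝ) * Complex.I‖ := by
          have := Complex.abs_im_le_norm ((x : ℂ) + (σ T : ℝ) * Complex.I)
          simp only [Complex.add_im, Complex.ofReal_im, Complex.mul_im, Complex.ofReal_re,
            Complex.I_im, mul_one, Complex.I_re, mul_zero, add_zero, zero_add, hσ] at this
          exact (le_abs_self T).trans this
        refine (hD _ (by simp [hx.1.le]) (by simp [hx.2]) (hT.trans hTn)).trans ?_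
        rw [← div_eq_mul_inv]
        gcongr
        nlinarith
    refine squeeze_zero_norm' hb ?_
    simpa using tendsto_inv_atTop_zero.const_mul D
  have h1 := hhor (fun T => -T) (fun T => abs_neg T)
  have h2 := hhor (fun T => T) (fun T => rfl)
  have h3 := intervalIntegral_tendsto_integral (gmsF_integrable p s hp1 hp2)
    Filter.tendsto_neg_atTop_atBot Filter.tendsto_id
  have h4 := intervalIntegral_tendsto_integral (gmsF_int_imag p s hp1 hp2 hs)
    Filter.tendsto_neg_atTop_atBot Filter.tendsto_id
  have h5 := (((h1.sub h2).add (h3.const_smul Complex.I)).sub (h4.const_smul Complex.I))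
  have h6 := tendsto_nhds_unique_of_eventuallyEq h5 (tendsto_const_nhds (x := (0:ℂ))) (by
    filter_upwards [Filter.eventually_gt_atTop 0] with T hT
    exact hrect T hT)
  rw [sub_zero, zero_add, ← smul_sub] at h6
  have h7 := (smul_eq_zero.1 h6).resolve_left Complex.I_ne_zero
  exact sub_eq_zero.1 h7

lemma gms_real_mul_cpow (y : ℝ) (hy : 0 < y) (x : ℂ) (hx : x ≠ 0) (a : ℝ) :
    ((y : ℂ) * x) ^ (a : ℂ) = ((y ^ a : ℝ) : ℂ) * x ^ (a : ℂ) := by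
  have hy' : (y : ℂ) ≠ 0 := Complex.ofReal_ne_zero.2 hy.ne'
  rw [Complex.cpow_def_of_ne_zero (mul_ne_zero hy' hx), Complex.cpow_def_of_ne_zero hx,
    Complex.log_ofReal_mul hy hx, add_mul, Complex.exp_add, Complex.ofReal_cpow hy.le,
    Complex.cpow_def_of_ne_zero hy', Complex.ofReal_log hy.le]

lemma gmsF_ray (p s : ℝ) (hp1 : 1 < p) (hp2 : p < 2) (hs : s < 0) (σ : ℝ) (hσ : σ = 1 ∨ σ = -1) :
    ∫ y in Ioi (0:ℝ), gmsF p s (y * (σ * Complex.I)) =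
      (1 / p) * Complex.exp (σ * (Real.pi * (1 / 2 - s)) * Complex.I) * Real.Gamma (1 - s) := by
  have hpi := Real.pi_pos
  set e : ℂ := σ * Complex.I with he
  have hne : e ≠ 0 := by rcases hσ with h | h <;> simp [he, h]
  have hlog : Complex.log e = (σ * (Real.pi / 2) : ℝ) * Complex.I := by
    rcases hσ with h | h
    · simp [he, h, Complex.log_I]
    · simp [he, h, Complex.log_neg_I]
  have hpow : ∀ a : ℂ, e ^ a = Complex.exp ((σ * (Real.pi / 2) : ℝ) * Complex.I * a) := by
    intro a; rw [Complex.cpow_def_of_ne_zero hne, hlog]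
  set w : ℂ := Complex.exp ((σ * (Real.pi * (p / 2 - 1)) : ℝ) * Complex.I) with hw
  have hew : e ^ (p : ℂ) = -w := by
    rw [hpow, hw]
    have : -Complex.exp ((σ * (Real.pi * (p / 2 - 1)) : ℝ) * Complex.I)
      = Complex.exp ((σ * (Real.pi * (p / 2 - 1)) : ℝ) * Complex.I) * Complex.exp (σ * (Real.pi * Complex.I)) := by
      rcases hσ with h | h
      · simp [h, Complex.exp_pi_mul_I]
      · simp [h, Complex.exp_neg, Complex.exp_pi_mul_I]
    rw [this, ← Complex.exp_add]
    congr 1; push_cast; ring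
  have hwre : 0 < w.re := by
    rw [hw, Complex.exp_ofReal_mul_I_re]
    apply Real.cos_pos_of_mem_Ioo
    rcases hσ with h | h <;> rw [h] <;> constructor <;> nlinarith
  have hwpow : ∀ a : ℂ, w ^ a = Complex.exp ((σ * (Real.pi * (p / 2 - 1)) : ℝ) * Complex.I * a) := by
    intro a
    rw [Complex.cpow_def_of_ne_zero (Complex.exp_ne_zero _), Complex.log_exp]
    · simp only [Complex.mul_im, Complex.ofReal_re, Complex.I_im, Complex.ofReal_im, Complex.I_re]
      rcases hσ with h | h <;> rw [h] <;> nlinarith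
    · simp only [Complex.mul_im, Complex.ofReal_re, Complex.I_im, Complex.ofReal_im, Complex.I_re]
      rcases hσ with h | h <;> rw [h] <;> nlinarith
  have hlap := gms_laplace (1 - s) (by linarith) w hwre
  rw [← integral_comp_rpow_Ioi _ (show p ≠ 0 by linarith)] at hlap
  have hp0 : (p : ℂ) ≠ 0 := by rw [Complex.ofReal_ne_zero]; linarith
  have hcongr : ∀ y ∈ Ioi (0:ℝ), gmsF p s (y * e) = (e ^ ((p - 1 - p * s : ℝ) : ℂ) / p) *
      ((|p| * y ^ (p - 1)) • ((((y ^ p) ^ (1 - s - 1) : ℝ) : ℂ) * Complex.exp (-(w * (y ^ p : ℝ))))) := by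
    intro y hy
    have hy' : 0 < y := hy
    unfold gmsF
    rw [gms_real_mul_cpow y hy e hne, gms_real_mul_cpow y hy e hne, hew, abs_of_pos (by linarith),
      ← Real.rpow_mul hy'.le]
    have e1 : y ^ (p - 1 - p * s) = y ^ (p - 1) * y ^ (p * (1 - s - 1)) := by
      rw [← Real.rpow_add hy']; ring_nf
    rw [e1, Complex.real_smul]
    have e2 : ((y ^ p : ℝ) : ℂ) * -w = -(w * (y ^ p : ℝ)) := by ring
    rw [e2]
    push_cast
    field_simp
  rw [setIntegral_congr_fun measurableSet_Ioi hcongr, integral_const_mul, hlap, hpow, hwpow]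
  have : Complex.exp (σ * (Real.pi * (1 / 2 - s)) * Complex.I) =
    Complex.exp ((σ * (Real.pi / 2) : ℝ) * Complex.I * ((p - 1 - p * s : ℝ) : ℂ)) *
    Complex.exp ((σ * (Real.pi * (p / 2 - 1)) : ℝ) * Complex.I * (-((1 - s : ℝ) : ℂ))) := by
    rw [← Complex.exp_add]; congr 1; push_cast; ring
  rw [this]
  ring

lemma gmsH_neg (p s : ℝ) (hp1 : 1 < p) (hp2 : p < 2) (hs : s < 0) :
    (p / (2 * Real.pi)) * gmsH p s = ((Real.Gamma s)⁻¹ : ℝ) := by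
  have hpi := Real.pi_pos
  have hp0 : (p : ℂ) ≠ 0 := by rw [Complex.ofReal_ne_zero]; linarith
  have hI := gmsF_int_imag p s hp1 hp2 hs
  have hsplit : gmsH p s = (1 / p) * (2 * Real.sin (Real.pi * s) : ℝ) * Real.Gamma (1 - s) := by
    rw [gmsH_shift p s hp1 hp2 hs, ← intervalIntegral.integral_Iic_add_Ioi (b := 0) hI.integrableOn hI.integrableOn]
    have h1 := gmsF_ray p s hp1 hp2 hs 1 (Or.inl rfl)
    have h2 := gmsF_ray p s hp1 hp2 hs (-1) (Or.inr rfl)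
    have h3 := integral_comp_neg_Ioi (0:ℝ) (fun y : ℝ => gmsF p s (y * Complex.I))
    rw [neg_zero] at h3
    rw [← h3]
    have h4 : ∫ y in Ioi (0:ℝ), gmsF p s ((-y : ℝ) * Complex.I) = 
      ∫ y in Ioi (0:ℝ), gmsF p s (y * ((-1 : ℝ) * Complex.I)) := by
      congr 1; ext y; congr 1; push_cast; ring
    rw [h4, h2]
    rw [Complex.ofReal_one, one_mul] at h1
    rw [h1]
    have hs2 : Real.sin (Real.pi * s) = Real.cos (Real.pi * (1 / 2 - s)) := by
      rw [← Real.cos_pi_div_two_sub]; congr 1; ring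
    rw [hs2]
    push_cast
    rw [Complex.cos]
    ring_nf
  rw [hsplit]
  have hG : Real.Gamma (1 - s) ≠ 0 := (Real.Gamma_pos_of_pos (by linarith)).ne'
  have href := Real.Gamma_mul_Gamma_one_sub s
  have hkey : Real.sin (Real.pi * s) / Real.pi * Real.Gamma (1 - s) = (Real.Gamma s)⁻¹ := by
    by_cases h : Real.sin (Real.pi * s) = 0
    · rw [h, div_zero] at href
      rw [(mul_eq_zero.1 href).resolve_right hG, h]; simp
    · have hGs : Real.Gamma s ≠ 0 := by
        intro h0
        rw [h0, zero_mul] at href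
        exact (div_ne_zero hpi.ne' h) href.symm
      rw [eq_div_iff h] at href
      field_simp
      linarith
  rw [← hkey]
  push_cast
  have : (Real.pi : ℂ) ≠ 0 := Complex.ofReal_ne_zero.2 hpi.ne'
  field_simp

lemma gmsH_eq (p : ℝ) (hp1 : 1 < p) (hp2 : p < 2) (s : ℝ) :
    (p / (2 * Real.pi)) * gmsH p s = ((Real.Gamma s)⁻¹ : ℝ) := by
  have hind : ∀ n : ℕ, ∀ s : ℝ, s < n → (∀ m : ℤ, s ≠ m) →
      (p / (2 * Real.pi)) * gmsH p s = ((Real.Gamma s)⁻¹ : ℝ) := by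
    intro n
    induction n with
    | zero => intro s hs _; exact gmsH_neg p s hp1 hp2 (by simpa using hs)
    | succ n ih =>
      intro s hs hm
      have h1 := ih (s - 1) (by push_cast at hs; linarith) (fun m hm' => hm (m + 1) (by push_cast; linarith))
      have hs1 : s - 1 ≠ 0 := by
        have := hm 1
        push_cast at this
        exact sub_ne_zero.2 this
      rw [gmsH_rec p (s - 1) hp1 hp2, sub_add_cancel] at h1
      have h2 := Real.Gamma_add_one hs1
      rw [sub_add_cancel] at h2
      rw [h2, mul_inv, Complex.ofReal_mul, ← h1]
      have : ((s - 1 : ℝ) : ℂ) ≠ 0 := Complex.ofReal_ne_zero.2 hs1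
      rw [Complex.ofReal_inv]
      field_simp
  have hc1 : Continuous (fun s => (p / (2 * Real.pi)) * gmsH p s) :=
    continuous_const.mul (gmsH_cont p hp1 hp2)
  have hc2 : Continuous (fun s : ℝ => (((Real.Gamma s)⁻¹ : ℝ) : ℂ)) := by
    have := Complex.differentiable_one_div_Gamma.continuous.comp Complex.continuous_ofReal
    refine this.congr fun s => ?_
    simp [Complex.Gamma_ofReal]
  have hdense : Dense {s : ℝ | ∀ m : ℤ, s ≠ m} := by
    have : {s : ℝ | ∀ m : ℤ, s ≠ m} = (range (fun m : ℤ => (m : ℝ)))ᶜ := by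
      ext s; simp [eq_comm]
    rw [this]
    exact (countable_range _).dense_compl ℝ
  have := Continuous.ext_on hdense hc1 hc2 (fun s hs => by
    obtain ⟨n, hn⟩ := exists_nat_gt s
    exact hind n s hn hs)
  exact congrFun this s

lemma gms_exp_hasSum (z : ℂ) : HasSum (fun l : ℕ => z ^ l / (l.factorial : ℂ)) (Complex.exp z) := by
  rw [Complex.exp_eq_exp_ℂ]
  exact NormedSpace.expSeries_div_hasSum_exp z

lemma gms_exp_hasSum_real (z : ℝ) : HasSum (fun l : ℕ => z ^ l / (l.factorial : ℝ)) (Real.exp z) := by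
  rw [Real.exp_eq_exp_ℝ]
  exact NormedSpace.expSeries_div_hasSum_exp z

lemma gmsF_shift_exp (p α β : ℝ) (v : ℂ) (hv : v ≠ 0) (l : ℕ) :
    gmsF p (-α * l + β) v = gmsF p β v * (v ^ ((p * α : ℝ) : ℂ)) ^ l := by
  unfold gmsF
  rw [mul_assoc, ← Complex.cpow_nat_mul, ← Complex.cpow_add _ _ hv]
  congr 2; push_cast; ring

lemma gms_wright_rep (p α β t : ℝ) (hp1 : 1 < p) (hp2 : p < 2) (hα : 0 < α) (hq : p * α < 1)
    (ht : 0 ≤ t) :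
    ((wright (-α) β (-t) : ℝ) : ℂ) = (p / (2 * Real.pi)) *
      ∫ y, gmsF p β (gmsv y) * Complex.exp (-(gmsv y ^ ((p * α : ℝ) : ℂ) * t)) := by
  have hq0 : 0 < p * α := by positivity
  have hsum := hasSum_integral_of_dominated_convergence (μ := (volume : Measure ℝ))
    (F := fun (l : ℕ) (y : ℝ) => (((-t : ℝ) : ℂ) ^ l / (l.factorial : ℂ)) * gmsF p (-α * l + β) (gmsv y))
    (f := fun y => gmsF p β (gmsv y) * Complex.exp (-(gmsv y ^ ((p * α : ℝ) : ℂ) * t)))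
    (fun (l : ℕ) y => ‖gmsF p β (gmsv y)‖ * ((t * ‖gmsv y‖ ^ (p * α)) ^ l / (l.factorial : ℝ)))
    (fun l => ((gmsF_cont p _).const_mul _ |>.aestronglyMeasurable))
    (fun l => Filter.Eventually.of_forall fun y => by
      rw [gmsF_shift_exp p α β _ (gmsv_ne y) l]
      rw [norm_mul, norm_mul, norm_div, norm_pow, norm_pow, Complex.norm_cpow_real, mul_pow]
      simp only [Complex.norm_real, norm_neg, Complex.norm_natCast, Real.norm_of_nonneg ht]
      apply le_of_eq; ring)
    (Filter.Eventually.of_forall fun y => (gms_exp_hasSum_real _).summable.mul_left _)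
    (by
      have : ∀ y, ∑' l : ℕ, ‖gmsF p β (gmsv y)‖ * ((t * ‖gmsv y‖ ^ (p * α)) ^ l / (l.factorial : ℝ))
          = ‖gmsv y‖ ^ (p - 1 - p * β) * Real.exp (t * ‖gmsv y‖ ^ (p * α) + (gmsv y ^ (p : ℂ)).re) := by
        intro y
        rw [tsum_mul_left, (gms_exp_hasSum_real _).tsum_eq, gmsF_norm, Real.exp_add]; ring
      simp_rw [this]
      exact gms_integrable p (p * α) t _ hp1 hp2 hq0 hq ht)
    (Filter.Eventually.of_forall fun y => by
      have := (gms_exp_hasSum (-(gmsv y ^ ((p * α : ℝ) : ℂ) * t))).mul_left (gmsF p β (gmsv y))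
      refine this.congr_fun ?_
      intro l
      rw [gmsF_shift_exp p α β _ (gmsv_ne y) l]
      rw [← mul_neg, mul_pow, ← Complex.ofReal_neg]
      ring)
  have h2 := (hsum.mul_left ((p : ℂ) / (2 * Real.pi))).tsum_eq
  rw [← h2, wright, Complex.ofReal_tsum]
  congr 1; ext l
  rw [integral_const_mul]
  have := gmsH_eq p hp1 hp2 (-α * l + β)
  unfold gmsH at this
  rw [mul_left_comm, this]
  push_cast
  rw [div_mul_eq_div_div, div_eq_mul_inv _ ((Real.Gamma _ : ℝ) : ℂ)]

lemma gms_mellin (p α β z : ℝ) (hp1 : 1 < p) (hp2 : p < 2) (hα : 0 < α) (hq : p * α < 1)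
    (hz : 0 < z) :
    IntegrableOn (fun t => t ^ (z - 1) * wright (-α) β (-t)) (Ioi 0) ∧
    ∫ t in Ioi (0:ℝ), t ^ (z - 1) * wright (-α) β (-t) =
      Real.Gamma z * (Real.Gamma (β + α * z))⁻¹ := by
  have hpi := Real.pi_pos
  have hq0 : 0 < p * α := by positivity
  set κ := Real.cos (Real.pi / 2 * (p * α)) with hκ
  have hκ0 : 0 < κ := Real.cos_pos_of_mem_Ioo ⟨by nlinarith, by nlinarith⟩
  have hre : ∀ y, κ ≤ (gmsv y ^ ((p * α : ℝ) : ℂ)).re := by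
    intro y
    rw [Complex.cpow_ofReal_re]
    have h1 : 1 ≤ ‖gmsv y‖ ^ (p * α) := Real.one_le_rpow (gmsv_one_le y) hq0.le
    have habs : |(gmsv y).arg| ≤ Real.pi / 2 :=
      Complex.abs_arg_le_pi_div_two_iff.2 (by rw [gmsv_re]; norm_num)
    have h2 : κ ≤ Real.cos ((gmsv y).arg * (p * α)) := by
      rw [hκ, ← Real.cos_abs ((gmsv y).arg * (p * α)), abs_mul, abs_of_pos hq0]
      apply Real.cos_le_cos_of_nonneg_of_le_pi (by positivity) (by nlinarith)
      gcongr
    nlinarith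
  set f : ℝ → ℝ → ℂ := fun t y => ((t ^ (z - 1) : ℝ) : ℂ) *
    (gmsF p β (gmsv y) * Complex.exp (-(gmsv y ^ ((p * α : ℝ) : ℂ) * t))) with hf
  have hint0 : IntegrableOn (fun t : ℝ => t ^ (z - 1) * Real.exp (-κ * t)) (Ioi 0) := by
    have := integrableOn_rpow_mul_exp_neg_mul_rpow (p := 1) (s := z - 1) (b := κ) (by linarith) one_pos hκ0
    simpa using this
  have hIntg : Integrable (Function.uncurry f) ((volume.restrict (Ioi (0:ℝ))).prod volume) := by
    refine Integrable.mono' (hint0.mul_prod (gmsF_integrable p β hp1 hp2).norm) ?_ ?_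
    · apply Measurable.aestronglyMeasurable
      have m1 := (gmsF_cont p β).measurable
      have m2 := (gmsv_cpow_cont ((p * α : ℝ) : ℂ)).measurable
      simp only [hf, Function.uncurry_def]
      have m1' := m1.comp (measurable_snd : Measurable (Prod.snd : ℝ × ℝ → ℝ))
      have m2' := m2.comp (measurable_snd : Measurable (Prod.snd : ℝ × ℝ → ℝ))
      simp only [Function.comp_def] at m1' m2'
      fun_prop
    · have : ∀ᵐ x : ℝ × ℝ ∂((volume.restrict (Ioi (0:ℝ))).prod volume), x.1 ∈ Ioi (0:ℝ) :=
        Measure.quasiMeasurePreserving_fst.ae (ae_restrict_mem measurableSet_Ioi)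
      filter_upwards [this] with x hx
      have hx' : 0 < x.1 := hx
      simp only [hf, Function.uncurry_def, norm_mul, Complex.norm_real, Complex.norm_exp]
      rw [Real.norm_of_nonneg (Real.rpow_nonneg hx'.le _)]
      have : (-(gmsv x.2 ^ ((p * α : ℝ) : ℂ) * (x.1 : ℂ))).re ≤ -κ * x.1 := by
        rw [Complex.neg_re, Complex.re_mul_ofReal]
        nlinarith [hre x.2]
      have h3 := Real.exp_le_exp.2 this
      have h4 : 0 ≤ x.1 ^ (z - 1) := Real.rpow_nonneg hx'.le _
      calc _ ≤ x.1 ^ (z - 1) * (‖gmsF p β (gmsv x.2)‖ * Real.exp (-κ * x.1)) := by gcongr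
        _ = _ := by ring
  have hrep : ∀ t ∈ Ioi (0:ℝ), (((t ^ (z - 1) * wright (-α) β (-t) : ℝ)) : ℂ) =
      (p / (2 * Real.pi)) * ∫ y, f t y := by
    intro t ht
    rw [Complex.ofReal_mul, gms_wright_rep p α β t hp1 hp2 hα hq (le_of_lt ht), hf]
    simp only
    rw [integral_const_mul]; ring
  have hI : Integrable (fun t => (p / (2 * Real.pi) : ℂ) * ∫ y, f t y) (volume.restrict (Ioi (0:ℝ))) :=
    hIntg.integral_prod_left.const_mul _
  have hI2 : Integrable (fun t : ℝ => (((t ^ (z - 1) * wright (-α) β (-t) : ℝ)) : ℂ))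
      (volume.restrict (Ioi (0:ℝ))) :=
    hI.congr (by
      filter_upwards [ae_restrict_mem measurableSet_Ioi] with t ht
      exact (hrep t ht).symm)
  constructor
  · have := hI2.re
    simp only [Complex.ofReal_re, RCLike.re_eq_complex_re] at this
    exact this
  · apply Complex.ofReal_injective
    rw [← integral_complex_ofReal, setIntegral_congr_fun measurableSet_Ioi hrep, integral_const_mul,
      integral_integral_swap hIntg]
    have hinner : ∀ y, ∫ t in Ioi (0:ℝ), f t y = gmsF p (β + α * z) (gmsv y) * Real.Gamma z := by
      intro y
      have h1 := gms_laplace z hz (gmsv y ^ ((p * α : ℝ) : ℂ)) (lt_of_lt_of_le hκ0 (hre y))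
      have h2 : ∀ t, f t y = gmsF p β (gmsv y) *
        (((t ^ (z - 1) : ℝ) : ℂ) * Complex.exp (-(gmsv y ^ ((p * α : ℝ) : ℂ) * t))) := by
        intro t; rw [hf]; ring
      simp_rw [h2]
      rw [integral_const_mul, h1, ← mul_assoc]
      congr 1
      have h3 : (gmsv y ^ ((p * α : ℝ) : ℂ)) ^ (-(z : ℂ)) = gmsv y ^ (((p * α : ℝ) : ℂ) * (-(z : ℂ))) := by
        have habs : |(gmsv y).arg| ≤ Real.pi / 2 :=
          Complex.abs_arg_le_pi_div_two_iff.2 (by rw [gmsv_re]; norm_num)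
        have him : (Complex.log (gmsv y) * ((p * α : ℝ) : ℂ)).im = (gmsv y).arg * (p * α) := by
          rw [Complex.im_mul_ofReal, Complex.log_im]
        have hb : |(gmsv y).arg * (p * α)| < Real.pi := by
          rw [abs_mul, abs_of_pos hq0]; nlinarith [abs_nonneg (gmsv y).arg]
        rw [abs_lt] at hb
        rw [Complex.cpow_mul]
        · rw [him]; exact hb.1
        · rw [him]; exact hb.2.le
      rw [h3]
      unfold gmsF
      rw [mul_assoc, ← Complex.cpow_add _ _ (gmsv_ne y)]
      congr 2; push_cast; ring
    simp_rw [hinner]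
    rw [integral_mul_const]
    have := gmsH_eq p hp1 hp2 (β + α * z)
    unfold gmsH at this
    rw [← mul_assoc, this]
    push_cast; ring

lemma gms_unique {Ω : Type*} [MeasurableSpace Ω] (μ : Measure Ω) [IsProbabilityMeasure μ]
    (X Y : Ω → ℝ) (hX : Measurable X) (hY : Measurable Y) (ε : ℝ) (hε : 0 < ε)
    (h1 : ∀ s ∈ Ioo (-ε) ε, Integrable (fun ω => Real.exp (s * X ω)) μ)
    (h2 : ∀ s ∈ Ioo (-ε) ε, Integrable (fun ω => Real.exp (s * Y ω)) μ)
    (h : ∀ s ∈ Ioo (-ε) ε, ProbabilityTheory.mgf X μ s = ProbabilityTheory.mgf Y μ s) :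
    μ.map X = μ.map Y := by
  have hs : ∀ (W : Ω → ℝ), (∀ s ∈ Ioo (-ε) ε, Integrable (fun ω => Real.exp (s * W ω)) μ) →
      AnalyticOnNhd ℂ (ProbabilityTheory.complexMGF W μ) {z : ℂ | z.re ∈ Ioo (-ε) ε} := by
    intro W hW
    refine ProbabilityTheory.analyticOnNhd_complexMGF.mono ?_
    intro z hz
    exact interior_maximal (fun s hs => hW s hs) isOpen_Ioo hz
  have hpre : IsPreconnected {z : ℂ | z.re ∈ Ioo (-ε) ε} :=
    ((convex_Ioo (-ε) ε).linear_preimage Complex.reLm).isPreconnected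
  have key := (hs X h1).eqOn_of_preconnected_of_frequently_eq (hs Y h2) hpre (z₀ := 0)
    (by simp [hε]) (by
    have h_real : ∃ᶠ (x : ℝ) in nhdsWithin 0 {0}ᶜ, ProbabilityTheory.complexMGF X μ x =
      ProbabilityTheory.complexMGF Y μ x := by
      apply Filter.Eventually.frequently
      filter_upwards [mem_nhdsWithin_of_mem_nhds (Ioo_mem_nhds (show -ε < 0 by linarith) hε)]
        with x hx
      rw [ProbabilityTheory.complexMGF_ofReal, ProbabilityTheory.complexMGF_ofReal, h x hx]
    rw [Filter.frequently_iff_seq_forall] at h_real ⊢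
    obtain ⟨xs, hx_tendsto, hx_eq⟩ := h_real
    refine ⟨fun n ↦ xs n, ?_, fun n ↦ hx_eq n⟩
    rw [tendsto_nhdsWithin_iff] at hx_tendsto ⊢
    constructor
    · exact (Complex.continuous_ofReal.tendsto 0).comp hx_tendsto.1
    · simpa using hx_tendsto.2)
  have := Measure.isProbabilityMeasure_map (μ := μ) hX.aemeasurable
  have := Measure.isProbabilityMeasure_map (μ := μ) hY.aemeasurable
  apply Measure.ext_of_charFun
  ext t
  rw [← ProbabilityTheory.complexMGF_mul_I hX.aemeasurable,
    ← ProbabilityTheory.complexMGF_mul_I hY.aemeasurable]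
  exact key (by simp [hε])

lemma gms_pos {Ω : Type*} [MeasurableSpace Ω] (μ : Measure Ω)
    (X : Ω → ℝ) (hX : Measurable X) (g : ℝ → ENNReal)
    (hlaw : μ.map X = (volume.restrict (Ioi (0 : ℝ))).withDensity g) :
    ∀ᵐ ω ∂μ, 0 < X ω := by
  have : ∀ᵐ x ∂(μ.map X), 0 < x := by
    rw [hlaw]
    exact (withDensity_absolutelyContinuous _ _).ae_le (ae_restrict_mem measurableSet_Ioi)
  exact ae_of_ae_map hX.aemeasurable this

lemma gms_log_mgf {Ω : Type*} [MeasurableSpace Ω] (μ : Measure Ω)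
    (X : Ω → ℝ) (hX : Measurable X) (f : ℝ → ℝ)
    (hf : AEMeasurable f (volume.restrict (Ioi (0 : ℝ))))
    (hf0 : ∀ᵐ x ∂(volume.restrict (Ioi (0 : ℝ))), 0 ≤ f x)
    (hlaw : μ.map X = (volume.restrict (Ioi (0 : ℝ))).withDensity (fun t => ENNReal.ofReal (f t)))
    (s : ℝ) (hs : IntegrableOn (fun t => t ^ s * f t) (Ioi 0)) :
    Integrable (fun ω => Real.exp (s * Real.log (X ω))) μ ∧
    ProbabilityTheory.mgf (fun ω => Real.log (X ω)) μ s = ∫ t in Ioi (0:ℝ), t ^ s * f t := by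
  have hm : Measurable (fun t : ℝ => Real.exp (s * Real.log t)) := by fun_prop
  have hae : (fun t => t ^ s * f t) =ᵐ[volume.restrict (Ioi (0 : ℝ))]
      (fun t => (ENNReal.ofReal (f t)).toReal • Real.exp (s * Real.log t)) := by
    filter_upwards [hf0, ae_restrict_mem measurableSet_Ioi] with t h0 ht
    rw [ENNReal.toReal_ofReal h0, Real.rpow_def_of_pos ht, smul_eq_mul, mul_comm s, mul_comm]
  have hfm : AEMeasurable (fun t => ENNReal.ofReal (f t)) (volume.restrict (Ioi (0 : ℝ))) :=
    hf.ennreal_ofReal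
  constructor
  · have : Integrable (fun t : ℝ => Real.exp (s * Real.log t)) (μ.map X) := by
      rw [hlaw, integrable_withDensity_iff_integrable_smul₀' hfm (by simp)]
      exact (integrable_congr hae).1 hs
    exact this.comp_measurable hX
  · unfold ProbabilityTheory.mgf
    rw [integral_congr_ae hae, ← integral_withDensity_eq_integral_toReal_smul₀ hfm (by simp),
      ← hlaw, integral_map hX.aemeasurable hm.aestronglyMeasurable]

lemma gms_ae_nonneg {ν : Measure ℝ} (f : ℝ → ℝ) (hf : Integrable f ν) (h1 : ∫ x, f x ∂ν = 1)
    (h2 : ∫⁻ x, ENNReal.ofReal (f x) ∂ν = 1) : ∀ᵐ x ∂ν, 0 ≤ f x := by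
  have h := integral_eq_lintegral_pos_part_sub_lintegral_neg_part hf
  rw [h1, h2] at h
  have hfin : ∫⁻ x, ENNReal.ofReal (-f x) ∂ν ≠ ⊤ := hf.neg.lintegral_lt_top.ne
  have h0 : ∫⁻ x, ENNReal.ofReal (-f x) ∂ν = 0 := by
    have : (∫⁻ x, ENNReal.ofReal (-f x) ∂ν).toReal = 0 := by
      rw [ENNReal.toReal_one] at h
      linarith
    exact ((ENNReal.toReal_eq_zero_iff _).1 this).resolve_right hfin
  rw [lintegral_eq_zero_iff' (f := fun x => ENNReal.ofReal (-f x))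
    hf.neg.aemeasurable.ennreal_ofReal] at h0
  filter_upwards [h0] with x hx
  simpa using hx

theorem gamma_mult_self_decomposition
    {Ω : Type*} [MeasurableSpace Ω] (μ : Measure Ω) [IsProbabilityMeasure μ]
    (r α : ℝ) (hr : 0 < r) (hα0 : 0 < α) (hα1 : α < 1)
    (Z Y : Ω → ℝ) (hZ : Measurable Z) (hY : Measurable Y)
    (hindep : ProbabilityTheory.IndepFun Z Y μ)
    (hlawZ : μ.map Z =
      (volume.restrict (Ioi (0 : ℝ))).withDensity
        (fun t => ENNReal.ofReal (t ^ (r - 1) * Real.exp (-t) / Real.Gamma r)))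
    (hlawY : μ.map Y =
      (volume.restrict (Ioi (0 : ℝ))).withDensity
        (fun t => ENNReal.ofReal (t ^ (r - 1) * wright (-α) (r * (1 - α)) (-t)))) :
    μ.map Z = μ.map (fun ω => Z ω ^ α * Y ω) := by
  obtain ⟨p, hp1, hp2, hq⟩ : ∃ p : ℝ, 1 < p ∧ p < 2 ∧ p * α < 1 := by
    have : (1:ℝ) < min 2 (1/α) := lt_min (by norm_num) (by rw [lt_div_iff₀ hα0]; linarith)
    obtain ⟨p, h1, h2⟩ := exists_between this
    refine ⟨p, h1, h2.trans_le (min_le_left _ _), ?_⟩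
    exact (lt_div_iff₀ hα0).1 (h2.trans_le (min_le_right _ _))
  have hΓ : Real.Gamma r ≠ 0 := (Real.Gamma_pos_of_pos hr).ne'
  have hmel := fun z (hz : 0 < z) => gms_mellin p α (r * (1 - α)) z hp1 hp2 hα0 hq hz
  have hYint := (hmel r hr).1
  have hY1 : ∫ t in Ioi (0:ℝ), t ^ (r - 1) * wright (-α) (r * (1 - α)) (-t) = 1 := by
    rw [(hmel r hr).2, show r * (1 - α) + α * r = r by ring, mul_inv_cancel₀ hΓ]
  have hYl : ∫⁻ t in Ioi (0:ℝ),
      ENNReal.ofReal (t ^ (r - 1) * wright (-α) (r * (1 - α)) (-t)) = 1 := by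
    have := Measure.isProbabilityMeasure_map (μ := μ) hY.aemeasurable
    have h := measure_univ (μ := μ.map Y)
    rw [hlawY, withDensity_apply _ MeasurableSet.univ, Measure.restrict_univ] at h
    exact h
  have hY0 := gms_ae_nonneg _ hYint hY1 hYl
  have hshift : ∀ (g : ℝ → ℝ) (s : ℝ), EqOn (fun t => t ^ (r + s - 1) * g t)
      (fun t => t ^ s * (t ^ (r - 1) * g t)) (Ioi 0) := by
    intro g s t ht
    simp only
    rw [← mul_assoc, ← Real.rpow_add ht]
    ring_nf
  have hV : ∀ s ∈ Ioo (-r) r, Integrable (fun ω => Real.exp (s * Real.log (Y ω))) μ ∧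
      ProbabilityTheory.mgf (fun ω => Real.log (Y ω)) μ s
        = Real.Gamma (r + s) * (Real.Gamma (r + α * s))⁻¹ := by
    intro s hs
    have hz : 0 < r + s := by linarith [hs.1]
    have hm := hmel (r + s) hz
    have := gms_log_mgf μ Y hY _ hYint.aemeasurable hY0 hlawY s
      (hm.1.congr_fun (hshift _ s) measurableSet_Ioi)
    refine ⟨this.1, ?_⟩
    rw [this.2, ← setIntegral_congr_fun measurableSet_Ioi (hshift _ s), hm.2]
    congr 3
    ring
  have hZeq : ∀ s, EqOn (fun t => Real.exp (-t) * t ^ (r + s - 1) * (Real.Gamma r)⁻¹)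
      (fun t => t ^ s * (t ^ (r - 1) * Real.exp (-t) / Real.Gamma r)) (Ioi 0) := by
    intro s t ht
    have := hshift (fun t => Real.exp (-t)) s ht
    simp only at this ⊢
    rw [mul_comm (Real.exp (-t)), this]
    ring
  have hU : ∀ s ∈ Ioo (-r) r, Integrable (fun ω => Real.exp (s * Real.log (Z ω))) μ ∧
      ProbabilityTheory.mgf (fun ω => Real.log (Z ω)) μ s
        = Real.Gamma (r + s) * (Real.Gamma r)⁻¹ := by
    intro s hs
    have hz : 0 < r + s := by linarith [hs.1]
    have hm := Real.GammaIntegral_convergent hz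
    have := gms_log_mgf μ Z hZ _ (by fun_prop) (by
        filter_upwards [ae_restrict_mem measurableSet_Ioi] with t ht
        have h0 := Real.Gamma_pos_of_pos hr
        have h1 := Real.rpow_pos_of_pos (show (0:ℝ) < t from ht) (r - 1)
        positivity) hlawZ s
      (IntegrableOn.congr_fun (hm.mul_const _) (hZeq s) measurableSet_Ioi)
    refine ⟨this.1, ?_⟩
    rw [this.2, ← setIntegral_congr_fun measurableSet_Ioi (hZeq s), integral_mul_const,
      ← Real.Gamma_eq_integral hz]
  have hUm : Measurable (fun ω => Real.log (Z ω)) := by fun_prop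
  have hVm : Measurable (fun ω => Real.log (Y ω)) := by fun_prop
  have hind : ProbabilityTheory.IndepFun (fun ω => α * Real.log (Z ω))
      (fun ω => Real.log (Y ω)) μ :=
    hindep.comp (φ := fun z => α * Real.log z) (ψ := fun y => Real.log y)
      (by fun_prop) (by fun_prop)
  have hαs : ∀ s ∈ Ioo (-r) r, α * s ∈ Ioo (-r) r := by
    intro s hs
    constructor <;> nlinarith [hs.1, hs.2]
  have hmap : μ.map (fun ω => Real.log (Z ω)) =
      μ.map ((fun ω => α * Real.log (Z ω)) + (fun ω => Real.log (Y ω))) := by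
    refine gms_unique μ _ _ hUm ((hUm.const_mul α).add hVm) r hr (fun s hs => (hU s hs).1) ?_ ?_
    · intro s hs
      refine hind.integrable_exp_mul_add ?_ (hV s hs).1
      have := (hU _ (hαs s hs)).1
      refine this.congr (Filter.Eventually.of_forall fun ω => ?_)
      simp only
      ring_nf
    · intro s hs
      rw [hind.mgf_add' (hUm.const_mul α).aestronglyMeasurable hVm.aestronglyMeasurable,
        ProbabilityTheory.mgf_const_mul, (hU s hs).2, (hU _ (hαs s hs)).2, (hV s hs).2]
      have h3 : Real.Gamma (r + α * s) ≠ 0 :=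
        (Real.Gamma_pos_of_pos (by linarith [(hαs s hs).1])).ne'
      generalize Real.Gamma (r + α * s) = c at h3
      field_simp
  have hZpos := gms_pos μ Z hZ _ hlawZ
  have hYpos := gms_pos μ Y hY _ hlawY
  have e1 : μ.map Z = (μ.map (fun ω => Real.log (Z ω))).map Real.exp := by
    rw [Measure.map_map Real.measurable_exp hUm]
    apply Measure.map_congr
    filter_upwards [hZpos] with ω h
    simp [Real.exp_log h]
  have e2 : μ.map (fun ω => Z ω ^ α * Y ω) =
      (μ.map ((fun ω => α * Real.log (Z ω)) + (fun ω => Real.log (Y ω)))).map Real.exp := by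
    rw [Measure.map_map Real.measurable_exp ((hUm.const_mul α).add hVm)]
    apply Measure.map_congr
    filter_upwards [hZpos, hYpos] with ω h h'
    simp only [Function.comp, Pi.add_apply]
    rw [Real.exp_add, Real.exp_log h', Real.rpow_def_of_pos h, mul_comm α]
  rw [e1, hmap, ← e2]
end
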